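/- arXiv:1907.11303 — 2 statements merged into one kernel-verified Lean document; each statement's English description precedes it below -/
import Mathlib

section
/- Let n ≥ 3. There exist ε₂ > 0 and a constant C > 0 depending only on n and ε₂ such that for every p on the critical hyperbola with |p − (n+2)/(n−2)| ≤ ε₂, the ground state (U_p, V_p) satisfies |∇^l U_p(x)| + |∇^l V_p(x)| ≤ C/(1 + |x|^{n−2+l}) for all x ∈ ℝⁿ and l = 1, 2, 3, where |∇^l f(x)| denotes the norm of the l-th total derivative of f at x. -/
open Filter MeasureTheory Topology

noncomputable def lap {n : ℕ} (f : EuclideanSpace ℝ (Fin n) → ℝ)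
    (x : EuclideanSpace ℝ (Fin n)) : ℝ :=
  ∑ i, fderiv ℝ (fderiv ℝ f) x (EuclideanSpace.single i 1) (EuclideanSpace.single i 1)

def IsGroundState (n : ℕ) (p q : ℝ) (U V : EuclideanSpace ℝ (Fin n) → ℝ) : Prop :=
  ContDiff ℝ 2 U ∧ ContDiff ℝ 2 V ∧
  (∀ x, 0 < U x) ∧ (∀ x, 0 < V x) ∧
  (∀ x, -lap U x = V x ^ p) ∧ (∀ x, -lap V x = U x ^ q) ∧
  (∀ x y, ‖x‖ ≤ ‖y‖ → U y ≤ U x) ∧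
  (∀ x y, ‖x‖ ≤ ‖y‖ → V y ≤ V x) ∧
  Tendsto U (cocompact _) (nhds 0) ∧
  Tendsto V (cocompact _) (nhds 0) ∧
  U 0 = 1

/-! ### Monotonicity from derivatives on an open half-line or interval -/

lemma antitoneOn_Ici_of_hasDerivAt_nonpos {f f' : ℝ → ℝ} {a : ℝ} (hc : ContinuousOn f (Set.Ici a))
    (hf : ∀ r, a < r → HasDerivAt f (f' r) r) (h0 : ∀ r, a < r → f' r ≤ 0) :
    AntitoneOn f (Set.Ici a) :=
  antitoneOn_of_hasDerivWithinAt_nonpos (convex_Ici a) hc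
    (fun r hr ↦ (hf r (by simpa using hr)).hasDerivWithinAt) (fun r hr ↦ h0 r (by simpa using hr))

lemma monotoneOn_Ici_of_hasDerivAt_nonneg {f f' : ℝ → ℝ} {a : ℝ} (hc : ContinuousOn f (Set.Ici a))
    (hf : ∀ r, a < r → HasDerivAt f (f' r) r) (h0 : ∀ r, a < r → 0 ≤ f' r) :
    MonotoneOn f (Set.Ici a) :=
  monotoneOn_of_hasDerivWithinAt_nonneg (convex_Ici a) hc
    (fun r hr ↦ (hf r (by simpa using hr)).hasDerivWithinAt) (fun r hr ↦ h0 r (by simpa using hr))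

/-! ### Radial profiles -/

/-- `u` is a positive decreasing radial profile, vanishing at infinity, of a solution of
`-Δu = v ^ p` in dimension `n`; `φ` denotes `-u'(r) / r`. -/
structure RadialProfile (n : ℕ) (p : ℝ) (u φ v : ℝ → ℝ) : Prop where
  pos : ∀ r, 0 < u r
  anti : AntitoneOn u (Set.Ici 0)
  cont : Continuous u
  cont_slope : Continuous φ
  lim : Tendsto u atTop (𝓝 0)
  hasDerivAt : ∀ r, 0 < r → HasDerivAt u (-(r * φ r)) r
  hasDerivAt_slope : ∀ r, 0 < r → HasDerivAt φ ((v r ^ p - n * φ r) / r) r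
  le_slope : ∀ r, 0 ≤ r → v r ^ p / n ≤ φ r
  slope_le : ∀ r, 0 ≤ r → φ r ≤ v 0 ^ p / n

namespace RadialProfile

variable {n : ℕ} {p q : ℝ} {u φ v ψ : ℝ → ℝ}

lemma slope_pos (h : RadialProfile n p u φ v) (hn : 3 ≤ n) (hv : ∀ r, 0 < v r) {r : ℝ}
    (hr : 0 ≤ r) : 0 < φ r := by
  have hn' : (0 : ℝ) < n := by positivity
  have := h.le_slope r hr
  have : 0 < v r ^ p / n := div_pos (Real.rpow_pos_of_pos (hv r) p) hn'
  linarith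

lemma le_zero (h : RadialProfile n p u φ v) {r : ℝ} (hr : 0 ≤ r) : u r ≤ u 0 :=
  h.anti (by simp) hr hr

lemma hasDerivAt_sq_mul_slope (h : RadialProfile n p u φ v) {r : ℝ} (hr : 0 < r) :
    HasDerivAt (fun r ↦ r ^ 2 * φ r) (r * v r ^ p - (n - 2) * (r * φ r)) r := by
  have h2 := ((hasDerivAt_id r).pow 2).mul (h.hasDerivAt_slope r hr)
  refine (h2.congr_deriv ?_)
  simp only [id, Pi.pow_apply]
  field_simp
  ring

/-- The profile decays at most like the fundamental solution. -/
lemma sq_mul_slope_le (h : RadialProfile n p u φ v) (hn : 3 ≤ n) (hv : ∀ r, 0 < v r) {r : ℝ}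
    (hr : 0 ≤ r) : r ^ 2 * φ r ≤ (n - 2) * u r := by
  have hn' : (1 : ℝ) ≤ (n : ℝ) - 2 := by
    have : (3 : ℝ) ≤ n := by exact_mod_cast hn
    linarith
  have hanti : AntitoneOn (fun r ↦ ((n : ℝ) - 2) * u r - r ^ 2 * φ r) (Set.Ici 0) := by
    refine antitoneOn_Ici_of_hasDerivAt_nonpos (f' := fun r ↦ -(r * v r ^ p)) ?_ ?_ ?_
    · have := h.cont; have := h.cont_slope; fun_prop
    · intro r hr
      refine (((h.hasDerivAt r hr).const_mul _).sub (h.hasDerivAt_sq_mul_slope hr)).congr_deriv ?_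
      ring
    · intro r hr
      have := Real.rpow_pos_of_pos (hv r) p
      have : 0 < r * v r ^ p := by positivity
      linarith
  by_contra! hlt
  set c := r ^ 2 * φ r - (n - 2) * u r with hc
  have hcpos : 0 < c := by linarith
  have hge : ∀ s, r < s → c ≤ s ^ 2 * φ s := by
    intro s hs
    have := hanti (Set.mem_Ici.2 hr) (Set.mem_Ici.2 (hr.trans hs.le)) hs.le
    simp only at this
    have := h.pos s
    nlinarith
  have hr1 : 0 < r + 1 := by linarith
  have hlog : AntitoneOn (fun s ↦ u s + c * Real.log s) (Set.Ici (r + 1)) := by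
    refine antitoneOn_Ici_of_hasDerivAt_nonpos (f' := fun s ↦ -(s * φ s) + c * s⁻¹) ?_ ?_ ?_
    · refine h.cont.continuousOn.add (continuousOn_const.mul (Real.continuousOn_log.mono ?_))
      intro s hs
      have : r + 1 ≤ s := hs
      simp; linarith
    · intro s hs
      exact (h.hasDerivAt s (by linarith)).add ((Real.hasDerivAt_log (by linarith)).const_mul c)
    · intro s hs
      have hs0 : 0 < s := by linarith
      have := hge s (by linarith)
      have : c * s⁻¹ ≤ s * φ s := by
        rw [← div_eq_mul_inv, div_le_iff₀ hs0]; nlinarith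
      linarith
  have htend : Tendsto (fun s ↦ c * Real.log s) atTop atTop :=
    Real.tendsto_log_atTop.const_mul_atTop hcpos
  obtain ⟨s, hs1, hs2⟩ := ((htend.eventually_gt_atTop
    (u (r + 1) + c * Real.log (r + 1))).and (eventually_ge_atTop (r + 1))).exists
  have := hlog (Set.mem_Ici.2 le_rfl) (Set.mem_Ici.2 hs2) hs2
  simp only at this
  have := h.pos s
  linarith

lemma monotoneOn_pow_mul (h : RadialProfile n p u φ v) (hn : 3 ≤ n) (hv : ∀ r, 0 < v r) :
    MonotoneOn (fun r ↦ r ^ (n - 2) * u r) (Set.Ici 0) := by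
  obtain ⟨k, rfl⟩ : ∃ k, n = k + 3 := ⟨n - 3, by omega⟩
  refine monotoneOn_Ici_of_hasDerivAt_nonneg
    (f' := fun r ↦ r ^ k * ((k + 1) * u r - r ^ 2 * φ r)) ?_ ?_ ?_
  · have := h.cont; fun_prop
  · intro r hr
    refine (((hasDerivAt_id r).pow (k + 1)).mul (h.hasDerivAt r hr)).congr_deriv ?_
    simp
    ring
  · intro r hr
    have := h.sq_mul_slope_le hn hv hr.le
    push_cast at this
    have : 0 ≤ (k + 1) * u r - r ^ 2 * φ r := by linarith
    positivity

lemma sub_le (h : RadialProfile n p u φ v) {r : ℝ} (hr : 0 ≤ r) :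
    u 0 - v 0 ^ p * r ^ 2 / (2 * n) ≤ u r := by
  have hm : MonotoneOn (fun r ↦ u r + v 0 ^ p * r ^ 2 / (2 * n)) (Set.Ici 0) := by
    refine monotoneOn_Ici_of_hasDerivAt_nonneg
      (f' := fun r ↦ -(r * φ r) + v 0 ^ p * (2 * r) / (2 * n)) ?_ ?_ ?_
    · have := h.cont; fun_prop
    · intro r hr
      refine (h.hasDerivAt r hr).add ?_
      refine ((((hasDerivAt_id r).pow 2).const_mul (v 0 ^ p)).div_const _).congr_deriv ?_
      simp
    · intro r hr
      have := mul_le_mul_of_nonneg_left (h.slope_le r hr.le) hr.le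
      have e : v 0 ^ p * (2 * r) / (2 * n) = r * (v 0 ^ p / n) := by
        rw [mul_left_comm, mul_div_mul_left _ _ two_ne_zero]; ring
      rw [e]; linarith
  have := hm (Set.mem_Ici.2 le_rfl) (Set.mem_Ici.2 hr) hr
  simp at this
  linarith

lemma le_sub (h : RadialProfile n p u φ v) (hv : AntitoneOn v (Set.Ici 0))
    (hp : 0 ≤ p) {k R : ℝ} (hR : 0 ≤ R) (hk : 0 ≤ k) (hkv : k ≤ v R) :
    u R ≤ u 0 - k ^ p * R ^ 2 / (2 * n) := by
  have hm : AntitoneOn (fun r ↦ u r + k ^ p * r ^ 2 / (2 * n)) (Set.Icc 0 R) := by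
    refine antitoneOn_of_hasDerivWithinAt_nonpos (convex_Icc 0 R)
      (f' := fun r ↦ -(r * φ r) + k ^ p * (2 * r) / (2 * n)) ?_ ?_ ?_
    · have := h.cont; fun_prop
    · intro r hr
      rw [interior_Icc] at hr ⊢
      refine ((h.hasDerivAt r hr.1).add ?_).hasDerivWithinAt
      refine ((((hasDerivAt_id r).pow 2).const_mul (k ^ p)).div_const _).congr_deriv ?_
      simp
    · intro r hr
      rw [interior_Icc] at hr
      have h1 := mul_le_mul_of_nonneg_left (h.le_slope r hr.1.le) hr.1.le
      have h2 : k ^ p ≤ v r ^ p :=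
        Real.rpow_le_rpow hk (hkv.trans (hv hr.1.le hR hr.2.le)) hp
      have h3 : r * (k ^ p / n) ≤ r * (v r ^ p / n) := by
        have := hr.1.le
        gcongr
      have e : k ^ p * (2 * r) / (2 * n) = r * (k ^ p / n) := by
        rw [mul_left_comm, mul_div_mul_left _ _ two_ne_zero]; ring
      rw [e]; linarith
  have := hm (Set.mem_Icc.2 ⟨le_rfl, hR⟩) (Set.mem_Icc.2 ⟨hR, le_rfl⟩) hR
  simp at this
  linarith

/-- The Pohozaev identity on the critical hyperbola. -/
lemma pohozaev (hu : RadialProfile n p u φ v) (hv : RadialProfile n q v ψ u) (hn : 3 ≤ n)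
    {α β : ℝ} (hβ : β * (p + 1) = n) (hα : α * (q + 1) = n)
    (hαβ : α + β = n - 2) {r : ℝ} (hr : 0 < r) :
    r ^ 2 * φ r * ψ r + β / n * (v r ^ p * v r) + α / n * (u r ^ q * u r)
      - β * (φ r * v r) - α * (ψ r * u r) = 0 := by
  have hn' : (n : ℝ) ≠ 0 := by positivity
  set Q : ℝ → ℝ := fun r ↦ r ^ 2 * φ r * ψ r + β / n * v r ^ (p + 1) + α / n * u r ^ (q + 1)
      - β * (φ r * v r) - α * (ψ r * u r) with hQ
  have hQc : Continuous Q := by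
    have := hu.cont; have := hv.cont; have := hu.cont_slope; have := hv.cont_slope
    have h1 : Continuous fun r ↦ v r ^ (p + 1) :=
      hv.cont.rpow_const fun x ↦ Or.inl (hv.pos x).ne'
    have h2 : Continuous fun r ↦ u r ^ (q + 1) :=
      hu.cont.rpow_const fun x ↦ Or.inl (hu.pos x).ne'
    fun_prop
  have hd : ∀ r, 0 < r → HasDerivAt (fun r ↦ r ^ n * Q r) 0 r := by
    intro r hr
    have h1 : HasDerivAt (fun r ↦ v r ^ (p + 1)) (-(r * ψ r) * (p + 1) * v r ^ p) r := by
      have := (hv.hasDerivAt r hr).rpow_const (p := p + 1) (Or.inl (hv.pos r).ne')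
      simpa using this
    have h2 : HasDerivAt (fun r ↦ u r ^ (q + 1)) (-(r * φ r) * (q + 1) * u r ^ q) r := by
      have := (hu.hasDerivAt r hr).rpow_const (p := q + 1) (Or.inl (hu.pos r).ne')
      simpa using this
    have h3 := (hu.hasDerivAt_sq_mul_slope hr).mul (hv.hasDerivAt_slope r hr)
    have h4 := (hu.hasDerivAt_slope r hr).mul (hv.hasDerivAt r hr)
    have h5 := (hv.hasDerivAt_slope r hr).mul (hu.hasDerivAt r hr)
    have h6 := (((h3.add (h1.const_mul (β / n))).add (h2.const_mul (α / n))).sub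
      (h4.const_mul β)).sub (h5.const_mul α)
    have h7 := ((hasDerivAt_id r).pow n).mul h6
    refine h7.congr_deriv ?_
    have e1 : v r ^ (p + 1) = v r ^ p * v r := by rw [Real.rpow_add_one (hv.pos r).ne']
    have e2 : u r ^ (q + 1) = u r ^ q * u r := by rw [Real.rpow_add_one (hu.pos r).ne']
    obtain ⟨k, rfl⟩ : ∃ k, n = k + 1 := ⟨n - 1, by omega⟩
    have e3 : β / ((k + 1 : ℕ) : ℝ) * (-(r * ψ r) * (p + 1) * v r ^ p)
        = -(r * ψ r) * v r ^ p := by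
      rw [show β / ((k + 1 : ℕ) : ℝ) * (-(r * ψ r) * (p + 1) * v r ^ p)
        = (β * (p + 1)) / ((k + 1 : ℕ) : ℝ) * (-(r * ψ r) * v r ^ p) by ring, hβ, div_self hn',
        one_mul]
    have e4 : α / ((k + 1 : ℕ) : ℝ) * (-(r * φ r) * (q + 1) * u r ^ q)
        = -(r * φ r) * u r ^ q := by
      rw [show α / ((k + 1 : ℕ) : ℝ) * (-(r * φ r) * (q + 1) * u r ^ q)
        = (α * (q + 1)) / ((k + 1 : ℕ) : ℝ) * (-(r * φ r) * u r ^ q) by ring, hα, div_self hn',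
        one_mul]
    simp only [e3, e4, Pi.add_apply, Pi.sub_apply, Pi.mul_apply, Pi.pow_apply, id, e1, e2]
    have hα' : α = k + 1 - 2 - β := by push_cast at hαβ; linarith
    have hk : (k : ℝ) + 1 ≠ 0 := by positivity
    simp only [Nat.add_sub_cancel, hα', pow_succ]
    push_cast
    field_simp
    ring
  have hcont : Continuous fun r ↦ r ^ n * Q r := by fun_prop
  have h1 := antitoneOn_Ici_of_hasDerivAt_nonpos (a := 0) hcont.continuousOn hd (fun _ _ ↦ le_rfl)
    (Set.mem_Ici.2 le_rfl) (Set.mem_Ici.2 hr.le) hr.le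
  have h2 := monotoneOn_Ici_of_hasDerivAt_nonneg (a := 0) hcont.continuousOn hd (fun _ _ ↦ le_rfl)
    (Set.mem_Ici.2 le_rfl) (Set.mem_Ici.2 hr.le) hr.le
  have h0 : (0 : ℝ) ^ n = 0 := zero_pow (by omega)
  simp only [h0, zero_mul] at h1 h2
  have h3 : r ^ n * Q r = 0 := le_antisymm h1 h2
  have h4 : Q r = 0 := by
    rcases mul_eq_zero.1 h3 with h | h
    · exact absurd h (pow_pos hr n).ne'
    · exact h
  rw [← h4, hQ]
  simp only [Real.rpow_add_one (hv.pos r).ne', Real.rpow_add_one (hu.pos r).ne']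

end RadialProfile

/-- The algebraic core of the logistic inequality for the sum of the logarithmic slopes. -/
lemma logistic_le {n a b A B α β : ℝ} (hn : 3 ≤ n) (ha : 0 ≤ a) (hb : 0 ≤ b) (hA : 0 ≤ A)
    (hB : 0 ≤ B) (hAa : A ≤ n * a) (hBb : B ≤ n * b) (hαβ : α + β = n - 2)
    (hβ : |β - (n - 2) / 2| ≤ 1 / (80 * n))
    (hpoh : β * A + α * B = n * (β * a + α * b - a * b)) :
    (a + b) * (2 * (n - 2) - 1 / 20 - (a + b)) ≤
      (n - 2) * (A + B - (n - 2) * (a + b) + a ^ 2 + b ^ 2) := by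
  obtain ⟨h, rfl⟩ : ∃ h, β = (n - 2) / 2 + h := ⟨β - (n - 2) / 2, by ring⟩
  obtain rfl : α = (n - 2) / 2 - h := by linarith
  have hh : |h| ≤ 1 / (80 * n) := by simpa using hβ
  have hid : (n - 2) * (A + B) = n * (n - 2) * (a + b) - 2 * n * (a * b)
      + h * (2 * n * (a - b) - 2 * (A - B)) := by linarith
  have herr : -(1 / 20 * (a + b)) ≤ h * (2 * n * (a - b) - 2 * (A - B)) := by
    have h1 : |2 * n * (a - b) - 2 * (A - B)| ≤ 4 * n * (a + b) := by
      have : 0 ≤ n * a := by positivity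
      have : 0 ≤ n * b := by positivity
      rw [abs_le]; constructor <;> nlinarith
    have h2 : |h * (2 * n * (a - b) - 2 * (A - B))| ≤ 1 / (80 * n) * (4 * n * (a + b)) := by
      rw [abs_mul]
      gcongr
    have h3 : 1 / (80 * n) * (4 * n * (a + b)) = 1 / 20 * (a + b) := by
      field_simp; ring
    rw [h3] at h2
    exact (abs_le.1 h2).1
  nlinarith [mul_nonneg (by linarith : 0 ≤ n - 1) (sq_nonneg (a - b))]

namespace RadialProfile

variable {n : ℕ} {p q : ℝ} {u φ v ψ : ℝ → ℝ}

lemma hasDerivAt_log_slope (h : RadialProfile n p u φ v) {r : ℝ} (hr : 0 < r) :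
    HasDerivAt (fun r ↦ r ^ 2 * φ r / u r)
      ((r ^ 2 * v r ^ p / u r - (n - 2) * (r ^ 2 * φ r / u r) + (r ^ 2 * φ r / u r) ^ 2) / r) r := by
  have := (h.hasDerivAt_sq_mul_slope hr).div (h.hasDerivAt r hr) (h.pos r).ne'
  refine this.congr_deriv ?_
  have := (h.pos r).ne'
  field_simp
  ring

/-- Along a critical pair the sum of the logarithmic slopes of `u` and `v` at radius `r` is at
least the value prescribed by the logistic equation. -/
lemma antitoneOn_logistic (hu : RadialProfile n p u φ v) (hv : RadialProfile n q v ψ u)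
    (hn : 3 ≤ n) {α β : ℝ} (hβ : β * (p + 1) = n) (hα : α * (q + 1) = n)
    (hαβ : α + β = n - 2) (hβ' : |β - ((n : ℝ) - 2) / 2| ≤ 1 / (80 * n)) {r₀ : ℝ} (hr₀ : 0 < r₀) :
    AntitoneOn (fun r ↦ r ^ ((2 * ((n : ℝ) - 2) - 1 / 20) / (n - 2)) *
      ((r ^ 2 * φ r / u r + r ^ 2 * ψ r / v r)⁻¹ - (2 * ((n : ℝ) - 2) - 1 / 20)⁻¹))
      (Set.Ici r₀) := by
  have hn3 : (3 : ℝ) ≤ n := by exact_mod_cast hn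
  set N : ℝ := (n : ℝ) - 2 with hN
  have hN1 : 1 ≤ N := by linarith
  set K : ℝ := 2 * N - 1 / 20 with hK
  have hK0 : 0 < K := by linarith
  set σ : ℝ → ℝ := fun r ↦ r ^ 2 * φ r / u r + r ^ 2 * ψ r / v r with hσ
  set σ' : ℝ → ℝ := fun r ↦
    (r ^ 2 * v r ^ p / u r - N * (r ^ 2 * φ r / u r) + (r ^ 2 * φ r / u r) ^ 2) / r +
    (r ^ 2 * u r ^ q / v r - N * (r ^ 2 * ψ r / v r) + (r ^ 2 * ψ r / v r) ^ 2) / r with hσ'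
  have hσpos : ∀ r, 0 < r → 0 < σ r := by
    intro r hr
    have := hu.slope_pos hn hv.pos hr.le
    have := hv.slope_pos hn hu.pos hr.le
    have := hu.pos r
    have := hv.pos r
    simp only [hσ]; positivity
  have hσd : ∀ r, 0 < r → HasDerivAt σ (σ' r) r := fun r hr ↦
    (hu.hasDerivAt_log_slope hr).add (hv.hasDerivAt_log_slope hr)
  have hineq : ∀ r, 0 < r → σ r * (K - σ r) ≤ N * (r * σ' r) := by
    intro r hr
    have hφ := hu.slope_pos hn hv.pos hr.le
    have hψ := hv.slope_pos hn hu.pos hr.le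
    have hu0 := hu.pos r
    have hv0 := hv.pos r
    have hvp := Real.rpow_pos_of_pos hv0 p
    have huq := Real.rpow_pos_of_pos hu0 q
    have hn0 : (0 : ℝ) < n := by linarith
    have key := logistic_le (n := n) (a := r ^ 2 * φ r / u r) (b := r ^ 2 * ψ r / v r)
      (A := r ^ 2 * v r ^ p / u r) (B := r ^ 2 * u r ^ q / v r) (α := α) (β := β) hn3
      (by positivity) (by positivity) (by positivity) (by positivity)
      (by
        rw [← mul_div_assoc, mul_left_comm]
        have := hu.le_slope r hr.le
        rw [div_le_iff₀ hn0] at this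
        gcongr; linarith)
      (by
        rw [← mul_div_assoc, mul_left_comm]
        have := hv.le_slope r hr.le
        rw [div_le_iff₀ hn0] at this
        gcongr; linarith) hαβ hβ'
      (by
        have := hu.pohozaev hv hn hβ hα hαβ hr
        field_simp at this ⊢
        linear_combination this)
    have e : r * σ' r = r ^ 2 * v r ^ p / u r + r ^ 2 * u r ^ q / v r
        - N * (r ^ 2 * φ r / u r + r ^ 2 * ψ r / v r) + (r ^ 2 * φ r / u r) ^ 2
        + (r ^ 2 * ψ r / v r) ^ 2 := by
      simp only [hσ']
      field_simp
      ring
    rw [e]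
    exact key
  have hd : ∀ r, 0 < r → HasDerivAt (fun r ↦ r ^ (K / N) * ((σ r)⁻¹ - K⁻¹))
      (K / N * r ^ (K / N - 1) * ((σ r)⁻¹ - K⁻¹) + r ^ (K / N) * (-σ' r / σ r ^ 2)) r := by
    intro r hr
    exact (Real.hasDerivAt_rpow_const (Or.inl hr.ne')).mul
      (((hσd r hr).inv (hσpos r hr).ne').sub_const _)
  refine antitoneOn_Ici_of_hasDerivAt_nonpos ?_ (fun r hr ↦ hd r (hr₀.trans hr)) ?_
  · exact fun r hr ↦ (hd r (hr₀.trans_le hr)).continuousAt.continuousWithinAt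
  · intro r hr
    have hr := hr₀.trans hr
    have hs := hσpos r hr
    have h1 := hineq r hr
    have e : r ^ (K / N) = r ^ (K / N - 1) * r := by
      rw [← Real.rpow_add_one hr.ne']; simp
    have e2 : K / N * r ^ (K / N - 1) * ((σ r)⁻¹ - K⁻¹) + r ^ (K / N) * (-σ' r / σ r ^ 2)
        = r ^ (K / N - 1) / (N * σ r ^ 2) * (σ r * (K - σ r) - N * (r * σ' r)) := by
      rw [e]
      have : N ≠ 0 := by positivity
      field_simp
      ring
    rw [e2]
    refine mul_nonpos_of_nonneg_of_nonpos ?_ (by linarith)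
    positivity

/-- Uniform lower bound for the logarithmic slopes outside a large ball. -/
lemma le_log_slope (hu : RadialProfile n p u φ v) (hv : RadialProfile n q v ψ u)
    (hn : 3 ≤ n) {α β : ℝ} (hβ : β * (p + 1) = n) (hα : α * (q + 1) = n)
    (hαβ : α + β = n - 2) (hβ' : |β - ((n : ℝ) - 2) / 2| ≤ 1 / (80 * n)) {s : ℝ} (hs : 0 < s)
    (hs' : s ≤ (1 / 8) ^ 2 * φ (1 / 8) / u (1 / 8) + (1 / 8) ^ 2 * ψ (1 / 8) / v (1 / 8))
    {r : ℝ} (hr8 : 1 / 8 ≤ r) (hr : 10 * ((n : ℝ) - 2) ^ 2 / s ≤ r) :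
    (n : ℝ) - 2 - 1 / 10 ≤ r ^ 2 * φ r / u r ∧ (n : ℝ) - 2 - 1 / 10 ≤ r ^ 2 * ψ r / v r := by
  have hn3 : (3 : ℝ) ≤ n := by exact_mod_cast hn
  have hanti := hu.antitoneOn_logistic hv hn hβ hα hαβ hβ' (r₀ := 1 / 8) (by norm_num)
    (Set.mem_Ici.2 le_rfl) (Set.mem_Ici.2 hr8) hr8
  have hr0 : 0 < r := by linarith
  have ha : r ^ 2 * φ r / u r ≤ n - 2 := by
    rw [div_le_iff₀ (hu.pos r)]; exact hu.sq_mul_slope_le hn hv.pos hr0.le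
  have hb : r ^ 2 * ψ r / v r ≤ n - 2 := by
    rw [div_le_iff₀ (hv.pos r)]; exact hv.sq_mul_slope_le hn hu.pos hr0.le
  have hσpos : 0 < r ^ 2 * φ r / u r + r ^ 2 * ψ r / v r := by
    have := hu.slope_pos hn hv.pos hr0.le
    have := hv.slope_pos hn hu.pos hr0.le
    have := hu.pos r
    have := hv.pos r
    positivity
  simp only at hanti
  set σ := r ^ 2 * φ r / u r + r ^ 2 * ψ r / v r with hσ
  set σ₀ := (1 / 8) ^ 2 * φ (1 / 8) / u (1 / 8) + (1 / 8) ^ 2 * ψ (1 / 8) / v (1 / 8) with hσ₀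
  set N : ℝ := (n : ℝ) - 2 with hN
  have hN1 : 1 ≤ N := by linarith
  set K : ℝ := 2 * N - 1 / 20 with hK
  have hK0 : 0 < K := by linarith
  have hfin : 2 * N - 1 / 10 ≤ σ := by
    by_contra! hlt
    have hκ : 1 ≤ K / N := by rw [le_div_iff₀ (by linarith)]; linarith
    have h1 : σ⁻¹ - K⁻¹ ≤ (1 / 8 / r) ^ (K / N) * (σ₀⁻¹ - K⁻¹) := by
      rw [Real.div_rpow (by norm_num) hr0.le, div_mul_eq_mul_div, le_div_iff₀ (by positivity)]
      linarith
    have h2 : σ₀⁻¹ - K⁻¹ ≤ s⁻¹ := by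
      have : σ₀⁻¹ ≤ s⁻¹ := inv_anti₀ hs hs'
      have : 0 < K⁻¹ := by positivity
      linarith
    have h3 : (1 / 8 / r) ^ (K / N) ≤ 1 / 8 / r := by
      have : 1 / 8 / r ≤ 1 := by rw [div_le_one hr0]; exact hr8
      calc (1 / 8 / r) ^ (K / N) ≤ (1 / 8 / r) ^ (1 : ℝ) :=
            Real.rpow_le_rpow_of_exponent_ge (by positivity) this hκ
        _ = 1 / 8 / r := Real.rpow_one _
    have h4 : σ⁻¹ - K⁻¹ ≤ 1 / (80 * N ^ 2) := by
      calc σ⁻¹ - K⁻¹ ≤ (1 / 8 / r) ^ (K / N) * s⁻¹ :=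
            h1.trans (mul_le_mul_of_nonneg_left h2 (by positivity))
        _ ≤ 1 / 8 / r * s⁻¹ := mul_le_mul_of_nonneg_right h3 (by positivity)
        _ ≤ 1 / (80 * N ^ 2) := by
            rw [div_le_iff₀ hs] at hr
            rw [← div_eq_mul_inv, div_div, div_div, div_le_div_iff₀ (by positivity) (by positivity)]
            linarith
    have h5 : (2 * N - 1 / 10)⁻¹ < σ⁻¹ := inv_strictAnti₀ hσpos hlt
    have h6 : 1 / (80 * N ^ 2) ≤ (2 * N - 1 / 10)⁻¹ - K⁻¹ := by
      rw [inv_sub_inv (by linarith) hK0.ne', div_le_div_iff₀ (by positivity)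
        (mul_pos (by linarith) hK0), hK]
      nlinarith
    linarith
  constructor <;> linarith

/-- Decay of a profile whose logarithmic slope is bounded below outside a ball. -/
lemma le_rpow_of_le_log_slope (h : RadialProfile n p u φ v) {m R M : ℝ} (hm : 0 ≤ m) (hR : 1 ≤ R)
    (hM : u 0 ≤ M) (hslope : ∀ r, R ≤ r → m ≤ r ^ 2 * φ r / u r) {r : ℝ} (hr : 0 ≤ r) :
    u r ≤ M * (2 * R) ^ m * (1 + r) ^ (-m) := by
  have hM0 : 0 < M := (h.pos 0).trans_le hM
  have hanti : AntitoneOn (fun r ↦ r ^ m * u r) (Set.Ici R) := by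
    refine antitoneOn_Ici_of_hasDerivAt_nonpos
      (f' := fun r ↦ m * r ^ (m - 1) * u r + r ^ m * (-(r * φ r))) ?_ ?_ ?_
    · exact (continuousOn_id.rpow_const fun x _ ↦ Or.inr hm).mul h.cont.continuousOn
    · intro r hr
      have hr0 : 0 < r := by linarith
      exact (Real.hasDerivAt_rpow_const (Or.inl hr0.ne')).mul (h.hasDerivAt r hr0)
    · intro r hr
      have hr0 : 0 < r := by linarith
      have h1 := hslope r hr.le
      rw [le_div_iff₀ (h.pos r)] at h1
      have e : r ^ m = r ^ (m - 1) * r := by rw [← Real.rpow_add_one hr0.ne']; simp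
      rw [e, show m * r ^ (m - 1) * u r + r ^ (m - 1) * r * (-(r * φ r))
        = r ^ (m - 1) * (m * u r - r ^ 2 * φ r) by ring]
      exact mul_nonpos_of_nonneg_of_nonpos (by positivity) (by linarith)
  rw [Real.rpow_neg (by positivity), ← div_eq_mul_inv, le_div_iff₀ (by positivity)]
  have huM : ∀ s, 0 ≤ s → u s ≤ M := fun s hs ↦ (h.le_zero hs).trans hM
  rcases le_total r R with hrR | hrR
  · have : (1 + r) ^ m ≤ (2 * R) ^ m := Real.rpow_le_rpow (by linarith) (by linarith) hm
    exact mul_le_mul (huM r hr) this (by positivity) hM0.le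
  · have h1 := hanti (Set.mem_Ici.2 le_rfl) (Set.mem_Ici.2 hrR) hrR
    simp only at h1
    calc u r * (1 + r) ^ m ≤ u r * (2 * r) ^ m := by
          have := (h.pos r).le
          gcongr; linarith
      _ = 2 ^ m * (r ^ m * u r) := by rw [Real.mul_rpow (by norm_num) hr]; ring
      _ ≤ 2 ^ m * (R ^ m * M) := by
          have := huM R (by linarith)
          refine mul_le_mul_of_nonneg_left (h1.trans ?_) (by positivity)
          gcongr
      _ = M * (2 * R) ^ m := by rw [Real.mul_rpow (by norm_num) (by linarith)]; ring

/-- Bounds for the central value of the second profile when the first one starts at `1`. -/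
lemma center_le (hu : RadialProfile n p u φ v) (hv : RadialProfile n q v ψ u) (hn : 3 ≤ n)
    (hp : 0 ≤ p) (h1 : u 0 = 1) : v 0 ≤ 2 := by
  by_contra! hlt
  have hn0 : (0 : ℝ) < n := by positivity
  have hR : 0 ≤ √(n * v 0) := Real.sqrt_nonneg _
  have hR2 : √(n * v 0) ^ 2 = n * v 0 := Real.sq_sqrt (by positivity)
  have h2 := hv.sub_le hR
  rw [h1, Real.one_rpow, hR2] at h2
  have h3 : v 0 / 2 ≤ v √(n * v 0) := by
    have : 1 * (n * v 0) / (2 * n) = v 0 / 2 := by field_simp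
    linarith
  have h4 := hu.le_sub hv.anti hp hR (by linarith) h3
  rw [hR2, h1] at h4
  have h5 : (v 0 / 2) ^ p * (n * v 0) / (2 * n) = (v 0 / 2) ^ p * (v 0 / 2) := by field_simp
  have h6 : 1 ≤ (v 0 / 2) ^ p := Real.one_le_rpow (by linarith) hp
  have := hu.pos √(n * v 0)
  nlinarith

lemma le_center (hu : RadialProfile n p u φ v) (hv : RadialProfile n q v ψ u) (hn : 3 ≤ n)
    (hp : 0 ≤ p) (hq : 0 ≤ q) (hqp : q ≤ 2 * p) (h1 : u 0 = 1) : 1 / 4 ≤ v 0 := by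
  by_contra! hlt
  have hn0 : (0 : ℝ) < n := by positivity
  set R := √(n * 4 ^ p) with hRdef
  have hR : 0 ≤ R := Real.sqrt_nonneg _
  have hR2 : R ^ 2 = n * 4 ^ p := Real.sq_sqrt (by positivity)
  have h2 := hu.sub_le hR
  have h3 : v 0 ^ p * 4 ^ p ≤ 1 := by
    rw [← Real.mul_rpow (hv.pos 0).le (by norm_num)]
    exact Real.rpow_le_one (by have := hv.pos 0; positivity) (by linarith) hp
  have h4 : 1 / 2 ≤ u R := by
    have : v 0 ^ p * R ^ 2 / (2 * n) = v 0 ^ p * 4 ^ p / 2 := by rw [hR2]; field_simp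
    rw [this, h1] at h2
    linarith
  have h5 := hv.le_sub hu.anti hq hR (by norm_num) h4
  have h6 : (1 / 2 : ℝ) ^ q * R ^ 2 / (2 * n) = (1 / 2 : ℝ) ^ q * 4 ^ p / 2 := by
    rw [hR2]; field_simp
  have h7 : 1 ≤ (1 / 2 : ℝ) ^ q * 4 ^ p := by
    rw [show (4 : ℝ) = 2 ^ (2 : ℝ) by norm_num, ← Real.rpow_mul (by norm_num), one_div,
      Real.inv_rpow (by norm_num), ← Real.rpow_neg (by norm_num), ← Real.rpow_add (by norm_num)]
    exact Real.one_le_rpow (by norm_num) (by linarith)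
  have := hv.pos R
  rw [h6] at h5
  linarith

/-- A profile that is at least `1 / 8` at radius `1 / 8` is bounded below on the unit ball. -/
lemma le_of_le_one (h : RadialProfile n p u φ v) (hn : 3 ≤ n) (hv : ∀ r, 0 < v r)
    (h8 : 1 / 8 ≤ u (1 / 8)) {r : ℝ} (hr : 0 ≤ r) (hr1 : r ≤ 1) : (1 / 8) ^ n ≤ u r := by
  have h1 : (1 / 8 : ℝ) ^ n ≤ (1 / 8) ^ (n - 2) * (1 / 8) := by
    rw [← pow_succ]
    exact pow_le_pow_of_le_one (by norm_num) (by norm_num) (by omega)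
  rcases le_total r (1 / 8) with h | hle
  · have h2 := ‹RadialProfile n p u φ v›.anti hr (by norm_num : (0 : ℝ) ≤ 1 / 8) h
    have : (1 / 8 : ℝ) ^ n ≤ 1 / 8 := by
      calc (1 / 8 : ℝ) ^ n ≤ (1 / 8) ^ 1 :=
            pow_le_pow_of_le_one (by norm_num) (by norm_num) (by omega)
        _ = 1 / 8 := pow_one _
    linarith
  · have h2 := h.monotoneOn_pow_mul hn hv (by norm_num : (0 : ℝ) ≤ 1 / 8) hr hle
    simp only at h2
    have h3 : r ^ (n - 2) * u r ≤ u r :=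
      mul_le_of_le_one_left (h.pos r).le (pow_le_one₀ hr hr1)
    have h4 : (1 / 8 : ℝ) ^ (n - 2) * (1 / 8) ≤ (1 / 8) ^ (n - 2) * u (1 / 8) := by gcongr
    linarith

end RadialProfile

/-- Uniform bounds for critical pairs of radial profiles close to the diagonal. -/
theorem exists_profile_bounds (n : ℕ) (hn : 3 ≤ n) :
    ∃ C c : ℝ, 1 ≤ C ∧ 0 < c ∧ ∀ (p q α β : ℝ) (u φ v ψ : ℝ → ℝ),
      RadialProfile n p u φ v → RadialProfile n q v ψ u → 1 ≤ p → 1 ≤ q → p ≤ 6 → q ≤ 2 * p →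
      β * (p + 1) = n → α * (q + 1) = n → α + β = n - 2 →
      |β - ((n : ℝ) - 2) / 2| ≤ 1 / (80 * n) → u 0 = 1 →
      (∀ r, 0 ≤ r → u r ≤ C * (1 + r) ^ (-((n : ℝ) - 2 - 1 / 10))) ∧
      (∀ r, 0 ≤ r → v r ≤ C * (1 + r) ^ (-((n : ℝ) - 2 - 1 / 10))) ∧
      (∀ r, 0 ≤ r → r ≤ 1 → c ≤ u r) ∧ (∀ r, 0 ≤ r → r ≤ 1 → c ≤ v r) := by
  have hn3 : (3 : ℝ) ≤ n := by exact_mod_cast hn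
  set s : ℝ := (1 / 8) ^ 2 * ((1 / 8) ^ (6 : ℝ) / n) / 2 with hs
  have hs0 : 0 < s := by positivity
  set R : ℝ := 1 + 10 * ((n : ℝ) - 2) ^ 2 / s with hR
  have hR1 : 1 ≤ R := by
    have : 0 ≤ 10 * ((n : ℝ) - 2) ^ 2 / s := by positivity
    linarith
  set m : ℝ := (n : ℝ) - 2 - 1 / 10 with hm
  have hm0 : 0 ≤ m := by linarith
  refine ⟨2 * (2 * R) ^ m, (1 / 8) ^ n, ?_, by positivity, ?_⟩
  · have : 1 ≤ (2 * R) ^ m := Real.one_le_rpow (by linarith) hm0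
    linarith
  intro p q α β u φ v ψ hu hv hp1 hq1 hp6 hqp hβ hα hαβ hβ' hu0
  have hv2 : v 0 ≤ 2 := hu.center_le hv hn (by linarith) hu0
  have hv4 : 1 / 4 ≤ v 0 := hu.le_center hv hn (by linarith) (by linarith) hqp hu0
  have hu8 : 1 / 8 ≤ u (1 / 8) := by
    have h1 := hu.sub_le (r := 1 / 8) (by norm_num)
    have h2 : v 0 ^ p ≤ 64 := by
      calc v 0 ^ p ≤ 2 ^ p := Real.rpow_le_rpow (hv.pos 0).le hv2 (by linarith)
        _ ≤ 2 ^ (6 : ℝ) := Real.rpow_le_rpow_of_exponent_le (by norm_num) hp6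
        _ = 64 := by norm_num
    have h3 : v 0 ^ p * (1 / 8) ^ 2 / (2 * n) ≤ 64 * (1 / 8) ^ 2 / (2 * 3) := by gcongr
    norm_num at h3 ⊢
    norm_num [hu0] at h1
    linarith
  have hv8 : 1 / 8 ≤ v (1 / 8) := by
    have h1 := hv.sub_le (r := 1 / 8) (by norm_num)
    rw [hu0, Real.one_rpow] at h1
    have h3 : (1 : ℝ) * (1 / 8) ^ 2 / (2 * n) ≤ 1 * (1 / 8) ^ 2 / (2 * 3) := by gcongr
    norm_num at h3 ⊢
    norm_num at h1
    linarith
  have hs' : s ≤ (1 / 8) ^ 2 * φ (1 / 8) / u (1 / 8) + (1 / 8) ^ 2 * ψ (1 / 8) / v (1 / 8) := by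
    have h1 : (1 / 8 : ℝ) ^ (6 : ℝ) / n ≤ φ (1 / 8) := by
      refine le_trans ?_ (hu.le_slope _ (by norm_num))
      gcongr
      calc (1 / 8 : ℝ) ^ (6 : ℝ) ≤ (1 / 8) ^ p :=
            Real.rpow_le_rpow_of_exponent_ge (by norm_num) (by norm_num) hp6
        _ ≤ v (1 / 8) ^ p := Real.rpow_le_rpow (by norm_num) hv8 (by linarith)
    have h2 : 0 ≤ (1 / 8) ^ 2 * ψ (1 / 8) / v (1 / 8) := by
      have := hv.slope_pos hn hu.pos (r := 1 / 8) (by norm_num)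
      have := hv.pos (1 / 8)
      positivity
    have h3 : s ≤ (1 / 8) ^ 2 * φ (1 / 8) / u (1 / 8) := by
      have := hu.pos (1 / 8)
      have := hu.slope_pos hn hv.pos (r := 1 / 8) (by norm_num)
      have : u (1 / 8) ≤ 2 := by
        have := hu.le_zero (r := 1 / 8) (by norm_num)
        linarith
      rw [hs]
      gcongr
    linarith
  have hslope : ∀ r, R ≤ r → m ≤ r ^ 2 * φ r / u r ∧ m ≤ r ^ 2 * ψ r / v r := fun r hr ↦
    hu.le_log_slope hv hn hβ hα hαβ hβ' hs0 hs' (by linarith) (by linarith)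
  exact ⟨fun r hr ↦ hu.le_rpow_of_le_log_slope hm0 hR1 (by linarith) (fun r hr ↦ (hslope r hr).1) hr,
    fun r hr ↦ hv.le_rpow_of_le_log_slope hm0 hR1 hv2 (fun r hr ↦ (hslope r hr).2) hr,
    fun r hr hr1 ↦ hu.le_of_le_one hn hv.pos hu8 hr hr1,
    fun r hr hr1 ↦ hv.le_of_le_one hn hu.pos hv8 hr hr1⟩

/-! ### Radial means and iterated radial derivatives -/

section RadialMean

variable {E : Type*} [NormedAddCommGroup E] [InnerProductSpace ℝ E]

/-- The weighted mean `∫₀¹ t ^ k f(t x) dt` along the segment from the origin to `x`. -/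
noncomputable def radialMean (k : ℕ) (f : E → ℝ) (x : E) : ℝ :=
  ∫ t in (0 : ℝ)..1, t ^ k * f (t • x)

lemma continuous_radialMean (k : ℕ) {f : E → ℝ} (hf : Continuous f) :
    Continuous (radialMean k f) := by
  refine intervalIntegral.continuous_parametric_intervalIntegral_of_continuous'
    (f := fun x t ↦ t ^ k * f (t • x)) ?_ 0 1
  unfold Function.uncurry
  fun_prop

lemma hasFDerivAt_radialMean [ProperSpace E] (k : ℕ) {f g : E → ℝ} (hg : Continuous g)
    (hf : ∀ x, HasFDerivAt f (-(g x) • innerSL ℝ x) x) (x : E) :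
    HasFDerivAt (radialMean k f) (-(radialMean (k + 2) g x) • innerSL ℝ x) x := by
  have hfc : Continuous f := continuous_iff_continuousAt.2 fun x ↦ (hf x).continuousAt
  obtain ⟨M, hM⟩ := (isCompact_closedBall (0 : E) (‖x‖ + 1)).exists_bound_of_continuousOn
    hg.continuousOn
  have key := intervalIntegral.hasFDerivAt_integral_of_dominated_of_fderiv_le (𝕜 := ℝ)
    (μ := volume) (a := 0) (b := 1) (s := Metric.ball x 1)
    (F := fun x t ↦ t ^ k * f (t • x))
    (F' := fun x t ↦ (-(t ^ (k + 2) * g (t • x))) • innerSL ℝ x)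
    (bound := fun _ ↦ M * (‖x‖ + 1)) (x₀ := x) (Metric.ball_mem_nhds x one_pos)
    (Eventually.of_forall fun y ↦ Continuous.aestronglyMeasurable (by fun_prop))
    (Continuous.intervalIntegrable (by fun_prop) _ _)
    (Continuous.aestronglyMeasurable (by fun_prop))
    (Eventually.of_forall fun t ht y hy ↦ ?_) (by simp)
    (Eventually.of_forall fun t ht y hy ↦ ?_)
  · rw [intervalIntegral.integral_smul_const, intervalIntegral.integral_neg] at key
    exact key
  · rw [Set.uIoc_of_le zero_le_one] at ht
    have hy' : ‖y‖ ≤ ‖x‖ + 1 := by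
      have h1 : ‖y - x‖ < 1 := by simpa [dist_eq_norm] using hy
      have h2 := norm_le_insert' y x
      linarith
    have h1 : ‖g (t • y)‖ ≤ M := by
      refine hM _ ?_
      rw [mem_closedBall_zero_iff, norm_smul, Real.norm_of_nonneg ht.1.le]
      nlinarith [norm_nonneg y, ht.2]
    have h2 : t ^ (k + 2) ≤ 1 := pow_le_one₀ ht.1.le ht.2
    have h3 : (0 : ℝ) ≤ t ^ (k + 2) := pow_nonneg ht.1.le _
    rw [norm_smul, innerSL_apply_norm, norm_neg, norm_mul, Real.norm_of_nonneg h3]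
    refine mul_le_mul ?_ hy' (norm_nonneg _) ((norm_nonneg _).trans h1)
    nlinarith [norm_nonneg (g (t • y))]
  · have h1 : HasFDerivAt (fun y : E ↦ t • y) (t • ContinuousLinearMap.id ℝ E) y :=
      (hasFDerivAt_id y).const_smul t
    have h2 := ((hf (t • y)).comp y h1).const_mul (t ^ k)
    refine h2.congr_fderiv ?_
    ext z
    simp
    ring

lemma integral_one_div_one_add_mul_sq {r : ℝ} (hr : 0 ≤ r) :
    ∫ t in (0 : ℝ)..1, 1 / (1 + t * r) ^ 2 = 1 / (1 + r) := by
  have hpos : ∀ t ∈ Set.uIcc (0 : ℝ) 1, 0 < 1 + t * r := by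
    intro t ht
    rw [Set.uIcc_of_le zero_le_one] at ht
    have := mul_nonneg ht.1 hr
    linarith
  have h := intervalIntegral.integral_eq_sub_of_hasDerivAt (a := 0) (b := 1)
    (f := fun t ↦ t / (1 + t * r)) (f' := fun t ↦ 1 / (1 + t * r) ^ 2) (fun t ht ↦ ?_) ?_
  · rw [h]; simp
  · have hd : HasDerivAt (fun t : ℝ ↦ 1 + t * r) r t := by
      simpa using ((hasDerivAt_id t).mul_const r).const_add 1
    refine ((hasDerivAt_id t).div hd (hpos t ht).ne').congr_deriv ?_
    simp
  · refine ContinuousOn.intervalIntegrable ?_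
    refine continuousOn_const.div (by fun_prop) fun t ht ↦ ?_
    exact pow_ne_zero _ (hpos t ht).ne'

lemma abs_radialMean_le (k : ℕ) {f : E → ℝ} {K : ℝ}
    (hf : ∀ x, |f x| ≤ K / (1 + ‖x‖) ^ (k + 2)) (x : E) :
    |radialMean k f x| ≤ K / (1 + ‖x‖) ^ (k + 1) := by
  have hK : 0 ≤ K := by
    have := (abs_nonneg _).trans (hf 0)
    simpa using this
  have hr := norm_nonneg x
  have hint : IntervalIntegrable
      (fun t : ℝ ↦ K / (1 + ‖x‖) ^ k * (1 / (1 + t * ‖x‖) ^ 2)) volume 0 1 := by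
    refine ContinuousOn.intervalIntegrable ?_
    refine continuousOn_const.mul (continuousOn_const.div (by fun_prop) fun t ht ↦ ?_)
    rw [Set.uIcc_of_le zero_le_one] at ht
    have := mul_nonneg ht.1 hr
    positivity
  have h := intervalIntegral.norm_integral_le_of_norm_le zero_le_one (μ := volume)
    (f := fun t : ℝ ↦ t ^ k * f (t • x)) (Eventually.of_forall fun t ht ↦ ?_) hint
  · rw [intervalIntegral.integral_const_mul, integral_one_div_one_add_mul_sq hr] at h
    refine (le_of_eq_of_le (by rfl) h).trans (le_of_eq ?_)
    rw [pow_succ]; field_simp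
  · have ht0 : 0 ≤ t * ‖x‖ := mul_nonneg ht.1.le hr
    have h1 := hf (t • x)
    rw [norm_smul, Real.norm_of_nonneg ht.1.le] at h1
    rw [Real.norm_eq_abs, abs_mul, abs_of_nonneg (pow_nonneg ht.1.le k)]
    calc t ^ k * |f (t • x)| ≤ t ^ k * (K / (1 + t * ‖x‖) ^ (k + 2)) :=
          mul_le_mul_of_nonneg_left h1 (pow_nonneg ht.1.le k)
      _ ≤ ((1 + t * ‖x‖) / (1 + ‖x‖)) ^ k * (K / (1 + t * ‖x‖) ^ (k + 2)) := by
          have : t ≤ (1 + t * ‖x‖) / (1 + ‖x‖) := by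
            rw [le_div_iff₀ (by positivity)]; nlinarith [ht.2]
          have := ht.1.le
          gcongr
      _ = K / (1 + ‖x‖) ^ k * (1 / (1 + t * ‖x‖) ^ 2) := by
          rw [div_pow, pow_add]
          have : 0 < 1 + t * ‖x‖ := by linarith
          field_simp

/-- `f` admits `m` continuous iterated radial derivatives: `∇f(x) = -g(x) x`, where `g` is again of
this kind. -/
def IsRadialDiff : ℕ → (E → ℝ) → Prop
  | 0, f => Continuous f
  | m + 1, f => ∃ g : E → ℝ, IsRadialDiff m g ∧ ∀ x, HasFDerivAt f (-(g x) • innerSL ℝ x) x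

namespace IsRadialDiff

lemma continuous : ∀ {m : ℕ} {f : E → ℝ}, IsRadialDiff m f → Continuous f
  | 0, _, h => h
  | _ + 1, _, ⟨_, _, h⟩ => continuous_iff_continuousAt.2 fun x ↦ (h x).continuousAt

lemma of_succ : ∀ {m : ℕ} {f : E → ℝ}, IsRadialDiff (m + 1) f → IsRadialDiff m f
  | 0, _, h => h.continuous
  | _ + 1, _, ⟨g, hg, h⟩ => ⟨g, of_succ hg, h⟩

lemma contDiff : ∀ {m : ℕ} {f : E → ℝ}, IsRadialDiff m f → ContDiff ℝ m f
  | 0, _, h => contDiff_zero.2 h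
  | m + 1, f, ⟨g, hg, h⟩ => by
    push_cast
    refine contDiff_succ_iff_hasFDerivAt.2 ⟨fun x ↦ -(g x) • innerSL ℝ x, ?_, h⟩
    exact hg.contDiff.neg.smul (innerSL ℝ).contDiff

lemma add : ∀ {m : ℕ} {f₁ f₂ : E → ℝ}, IsRadialDiff m f₁ → IsRadialDiff m f₂ →
    IsRadialDiff m fun x ↦ f₁ x + f₂ x
  | 0, _, _, h₁, h₂ => Continuous.add h₁ h₂
  | _ + 1, _, _, ⟨g₁, hg₁, h₁⟩, ⟨g₂, hg₂, h₂⟩ =>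
    ⟨fun x ↦ g₁ x + g₂ x, hg₁.add hg₂, fun x ↦ ((h₁ x).add (h₂ x)).congr_fderiv (by
      rw [← add_smul]; congr 1; ring)⟩

lemma mul : ∀ {m : ℕ} {f₁ f₂ : E → ℝ}, IsRadialDiff m f₁ → IsRadialDiff m f₂ →
    IsRadialDiff m fun x ↦ f₁ x * f₂ x
  | 0, _, _, h₁, h₂ => Continuous.mul h₁ h₂
  | _ + 1, f₁, f₂, h₁', h₂' => by
    have k₁ := h₁'.of_succ
    have k₂ := h₂'.of_succ
    obtain ⟨g₁, hg₁, h₁⟩ := h₁'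
    obtain ⟨g₂, hg₂, h₂⟩ := h₂'
    refine ⟨fun x ↦ f₁ x * g₂ x + f₂ x * g₁ x,
      (k₁.mul hg₂).add (k₂.mul hg₁), fun x ↦ ((h₁ x).mul (h₂ x)).congr_fderiv ?_⟩
    rw [smul_smul, smul_smul, ← add_smul]; congr 1; ring

lemma const (c : ℝ) : ∀ m : ℕ, IsRadialDiff m fun _ : E ↦ c
  | 0 => continuous_const
  | m + 1 => ⟨fun _ ↦ 0, const 0 m, fun x ↦ by simpa using hasFDerivAt_const c x⟩

lemma radialMean [ProperSpace E] : ∀ {m : ℕ} (k : ℕ) {f : E → ℝ}, IsRadialDiff m f →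
    IsRadialDiff m (radialMean k f)
  | 0, k, _, h => continuous_radialMean k h
  | _ + 1, k, _, ⟨_, hg, h⟩ =>
    ⟨_, hg.radialMean (k + 2), hasFDerivAt_radialMean k hg.continuous h⟩

end IsRadialDiff

lemma hasFDerivAt_rpow_of_radial {f g : E → ℝ} (hpos : ∀ x, 0 < f x)
    (h : ∀ x, HasFDerivAt f (-(g x) • innerSL ℝ x) x) (s : ℝ) (x : E) :
    HasFDerivAt (fun x ↦ f x ^ s) (-(s * f x ^ (s - 1) * g x) • innerSL ℝ x) x := by
  refine ((h x).rpow_const (p := s) (Or.inl (hpos x).ne')).congr_fderiv ?_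
  rw [smul_smul]; congr 1; ring

lemma IsRadialDiff.rpow_const : ∀ {m : ℕ} {f : E → ℝ}, IsRadialDiff m f → (∀ x, 0 < f x) →
    ∀ s : ℝ, IsRadialDiff m fun x ↦ f x ^ s
  | 0, _, h, hpos, _ => Continuous.rpow_const h fun x ↦ Or.inl (hpos x).ne'
  | _ + 1, _, h', hpos, s => by
    have k := h'.of_succ
    obtain ⟨g, hg, h⟩ := h'
    exact ⟨_, ((IsRadialDiff.const s _).mul (k.rpow_const hpos (s - 1))).mul hg,
      hasFDerivAt_rpow_of_radial hpos h s⟩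

end RadialMean

/-! ### Norms of the first derivatives of radial functions -/

section IteratedFDeriv

variable {E : Type*} [NormedAddCommGroup E] [InnerProductSpace ℝ E]

lemma norm_iteratedFDeriv_one_innerSL_le (x : E) :
    ‖iteratedFDeriv ℝ 1 (fun y : E ↦ innerSL ℝ y) x‖ ≤ 1 := by
  rw [norm_iteratedFDeriv_one]
  have : fderiv ℝ (fun y : E ↦ innerSL ℝ y) x = innerSL ℝ := (innerSL ℝ).fderiv
  rw [this]
  exact norm_innerSL_le ℝ

lemma norm_iteratedFDeriv_two_innerSL (x : E) :
    ‖iteratedFDeriv ℝ 2 (fun y : E ↦ innerSL ℝ y) x‖ = 0 := by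
  rw [← norm_iteratedFDeriv_fderiv]
  have : fderiv ℝ (fun y : E ↦ innerSL ℝ y) = fun _ ↦ innerSL ℝ := by
    ext1 x; exact (innerSL ℝ).fderiv
  rw [this, iteratedFDeriv_succ_const]
  simp

variable {f g : E → ℝ}

lemma fderiv_eq_of_radial (h : ∀ x, HasFDerivAt f (-(g x) • innerSL ℝ x) x) :
    fderiv ℝ f = fun x ↦ (-g x) • innerSL ℝ x :=
  funext fun x ↦ (h x).fderiv

lemma norm_iteratedFDeriv_one_le_of_radial
    (h : ∀ x, HasFDerivAt f (-(g x) • innerSL ℝ x) x) (x : E) :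
    ‖iteratedFDeriv ℝ 1 f x‖ ≤ |g x| * ‖x‖ := by
  rw [norm_iteratedFDeriv_one, fderiv_eq_of_radial h, norm_smul, innerSL_apply_norm]
  simp

lemma norm_iteratedFDeriv_two_le_of_radial (hg : ContDiff ℝ 1 g)
    (h : ∀ x, HasFDerivAt f (-(g x) • innerSL ℝ x) x) (x : E) :
    ‖iteratedFDeriv ℝ 2 f x‖ ≤ |g x| + ‖iteratedFDeriv ℝ 1 g x‖ * ‖x‖ := by
  rw [← norm_iteratedFDeriv_fderiv, fderiv_eq_of_radial h]
  have h1 := norm_iteratedFDeriv_smul_le (f := fun x ↦ -g x) (g := fun x : E ↦ innerSL ℝ x)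
    (N := 1) hg.neg (innerSL ℝ).contDiff x (n := 1) (by norm_cast)
  have h2 := norm_iteratedFDeriv_one_innerSL_le x
  have e : (fun x ↦ -g x) = -g := rfl
  refine h1.trans ?_
  simp only [Finset.sum_range_succ, Finset.sum_range_zero, e, iteratedFDeriv_neg_apply, norm_neg,
    norm_iteratedFDeriv_zero, Nat.sub_zero, Nat.choose_self, Nat.choose_zero_right, Nat.cast_one,
    one_mul, zero_add, Real.norm_eq_abs]
  have h3 := mul_le_of_le_one_right (abs_nonneg (g x)) h2
  simp only [Nat.reduceSub, norm_iteratedFDeriv_zero, innerSL_apply_norm]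
  linarith

lemma norm_iteratedFDeriv_three_le_of_radial (hg : ContDiff ℝ 2 g)
    (h : ∀ x, HasFDerivAt f (-(g x) • innerSL ℝ x) x) (x : E) :
    ‖iteratedFDeriv ℝ 3 f x‖ ≤
      2 * ‖iteratedFDeriv ℝ 1 g x‖ + ‖iteratedFDeriv ℝ 2 g x‖ * ‖x‖ := by
  rw [← norm_iteratedFDeriv_fderiv, fderiv_eq_of_radial h]
  have h1 := norm_iteratedFDeriv_smul_le (f := fun x ↦ -g x) (g := fun x : E ↦ innerSL ℝ x)
    (N := 2) hg.neg (innerSL ℝ).contDiff x (n := 2) (by norm_cast)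
  have h2 := norm_iteratedFDeriv_one_innerSL_le x
  have h3 := norm_iteratedFDeriv_two_innerSL x
  have e : (fun x ↦ -g x) = -g := rfl
  refine h1.trans ?_
  simp only [Finset.sum_range_succ, Finset.sum_range_zero, e, iteratedFDeriv_neg_apply, norm_neg,
    norm_iteratedFDeriv_zero, innerSL_apply_norm, Nat.sub_zero, Nat.choose_self,
    Nat.choose_one_right, Nat.choose_zero_right, Nat.cast_one, one_mul, zero_add, h3, mul_zero,
    Nat.cast_ofNat, Nat.reduceSub]
  have h4 := mul_le_of_le_one_right (norm_nonneg (iteratedFDeriv ℝ 1 g x)) h2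
  linarith

/-- Decay of the first three derivatives of a radial function from the decay of its iterated
radial derivatives. -/
lemma norm_iteratedFDeriv_le_of_radial {f₁ f₂ f₃ : E → ℝ} (hf₃ : Continuous f₃)
    (h₁ : ∀ x, HasFDerivAt f (-(f₁ x) • innerSL ℝ x) x)
    (h₂ : ∀ x, HasFDerivAt f₁ (-(f₂ x) • innerSL ℝ x) x)
    (h₃ : ∀ x, HasFDerivAt f₂ (-(f₃ x) • innerSL ℝ x) x) {n : ℕ} {K : ℝ}
    (b₁ : ∀ x, |f₁ x| ≤ K / (1 + ‖x‖) ^ n) (b₂ : ∀ x, |f₂ x| ≤ K / (1 + ‖x‖) ^ (n + 2))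
    (b₃ : ∀ x, |f₃ x| ≤ K / (1 + ‖x‖) ^ (n + 4)) (x : E) :
    ‖iteratedFDeriv ℝ 1 f x‖ * (1 + ‖x‖) ^ n ≤ K * (1 + ‖x‖) ∧
    ‖iteratedFDeriv ℝ 2 f x‖ * (1 + ‖x‖) ^ n ≤ 2 * K ∧
    ‖iteratedFDeriv ℝ 3 f x‖ * (1 + ‖x‖) ^ (n + 1) ≤ 4 * K := by
  have hd₂ : IsRadialDiff 1 f₂ := ⟨f₃, hf₃, h₃⟩
  have hd₁ : IsRadialDiff 2 f₁ := ⟨f₂, hd₂, h₂⟩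
  have d1 := norm_iteratedFDeriv_one_le_of_radial h₁ x
  have d2 := norm_iteratedFDeriv_two_le_of_radial hd₁.of_succ.contDiff h₁ x
  have d3 := norm_iteratedFDeriv_three_le_of_radial hd₁.contDiff h₁ x
  have e1 := norm_iteratedFDeriv_one_le_of_radial h₂ x
  have e2 := norm_iteratedFDeriv_two_le_of_radial hd₂.contDiff h₂ x
  have e3 := norm_iteratedFDeriv_one_le_of_radial h₃ x
  have c1 := b₁ x
  have c2 := b₂ x
  have c3 := b₃ x
  have hr := norm_nonneg x
  set r := ‖x‖
  set w := (1 + r) ^ n with hw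
  have hw0 : 0 < w := by positivity
  rw [le_div_iff₀ (by positivity)] at c1 c2 c3
  rw [pow_add, ← hw] at c2 c3
  rw [pow_succ, ← hw]
  have hK : 0 ≤ K := le_trans (by positivity) c1
  have a1 := abs_nonneg (f₁ x)
  have a2 := abs_nonneg (f₂ x)
  have a3 := abs_nonneg (f₃ x)
  have k2 : |f₂ x| * r ^ 2 * w ≤ K := by
    refine le_trans ?_ c2
    have : r ^ 2 ≤ (1 + r) ^ 2 := by gcongr; linarith
    nlinarith [mul_nonneg a2 hw0.le]
  have k2' : |f₂ x| * r * (w * (1 + r)) ≤ K := by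
    refine le_trans ?_ c2
    have : r * (1 + r) ≤ (1 + r) ^ 2 := by nlinarith
    nlinarith [mul_nonneg a2 hw0.le]
  have k3 : |f₃ x| * r ^ 3 * (w * (1 + r)) ≤ K := by
    refine le_trans ?_ c3
    have h1 : r ^ 3 ≤ (1 + r) ^ 3 := by gcongr; linarith
    have h2 : r ^ 3 * (1 + r) ≤ (1 + r) ^ 4 := by
      calc r ^ 3 * (1 + r) ≤ (1 + r) ^ 3 * (1 + r) := by gcongr
        _ = (1 + r) ^ 4 := by ring
    nlinarith [mul_nonneg a3 hw0.le]
  refine ⟨?_, ?_, ?_⟩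
  · calc _ ≤ |f₁ x| * r * w := by gcongr
      _ = |f₁ x| * w * r := by ring
      _ ≤ K * r := by gcongr
      _ ≤ K * (1 + r) := by gcongr; linarith
  · calc _ ≤ (|f₁ x| + |f₂ x| * r * r) * w := by
          refine mul_le_mul_of_nonneg_right (d2.trans ?_) hw0.le
          gcongr
      _ = |f₁ x| * w + |f₂ x| * r ^ 2 * w := by ring
      _ ≤ 2 * K := by linarith
  · calc _ ≤ (2 * (|f₂ x| * r) + (|f₂ x| + |f₃ x| * r * r) * r) * (w * (1 + r)) := by
          refine mul_le_mul_of_nonneg_right (d3.trans ?_) (by positivity)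
          have : ‖iteratedFDeriv ℝ 2 f₁ x‖ ≤ |f₂ x| + |f₃ x| * r * r := e2.trans (by gcongr)
          gcongr
      _ = 3 * (|f₂ x| * r * (w * (1 + r))) + |f₃ x| * r ^ 3 * (w * (1 + r)) := by ring
      _ ≤ 4 * K := by linarith

end IteratedFDeriv

/-! ### Derivatives of radial functions -/

section Radial

variable {E : Type*} [NormedAddCommGroup E] [InnerProductSpace ℝ E] {f : E → ℝ}

lemma norm_cos_smul_add_sin_smul {x y : E} (hy : ‖y‖ = ‖x‖) (hxy : inner ℝ x y = 0) (t : ℝ) :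
    ‖Real.cos t • x + Real.sin t • y‖ = ‖x‖ := by
  have h : ‖Real.cos t • x + Real.sin t • y‖ ^ 2 = ‖x‖ ^ 2 := by
    rw [norm_add_sq_real, norm_smul, norm_smul, inner_smul_left, inner_smul_right, hxy, hy,
      mul_pow, mul_pow, Real.norm_eq_abs, Real.norm_eq_abs, sq_abs, sq_abs]
    linear_combination ‖x‖ ^ 2 * Real.cos_sq_add_sin_sq t
  exact (sq_eq_sq₀ (norm_nonneg _) (norm_nonneg _)).1 h

lemma hasDerivAt_cos_smul_add_sin_smul (x y : E) (t : ℝ) :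
    HasDerivAt (fun t ↦ Real.cos t • x + Real.sin t • y) (-Real.sin t • x + Real.cos t • y) t :=
  ((Real.hasDerivAt_cos t).smul_const x).add ((Real.hasDerivAt_sin t).smul_const y)

/-- A radial function is constant along circles centred at the origin. -/
lemma fderiv_circle_eq_zero (hf : Differentiable ℝ f) (hrad : ∀ x y, ‖x‖ = ‖y‖ → f x = f y)
    {x y : E} (hy : ‖y‖ = ‖x‖) (hxy : inner ℝ x y = 0) (t : ℝ) :
    fderiv ℝ f (Real.cos t • x + Real.sin t • y) (-Real.sin t • x + Real.cos t • y) = 0 := by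
  have h := (hf (Real.cos t • x + Real.sin t • y)).hasFDerivAt.comp_hasDerivAt t
    (hasDerivAt_cos_smul_add_sin_smul x y t)
  refine h.unique ((hasDerivAt_const t (f x)).congr_of_eventuallyEq ?_)
  exact Eventually.of_forall fun s ↦ hrad _ _ (norm_cos_smul_add_sin_smul hy hxy s)

lemma fderiv_eq_zero_of_inner_eq_zero (hf : Differentiable ℝ f)
    (hrad : ∀ x y, ‖x‖ = ‖y‖ → f x = f y) {x y : E} (hx : x ≠ 0) (hxy : inner ℝ x y = 0) :
    fderiv ℝ f x y = 0 := by
  rcases eq_or_ne y 0 with rfl | hy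
  · simp
  have hx' := norm_ne_zero_iff.2 hx
  have hy' := norm_ne_zero_iff.2 hy
  have h := fderiv_circle_eq_zero hf hrad (x := x) (y := (‖x‖ / ‖y‖) • y)
    (by rw [norm_smul, norm_div, norm_norm, norm_norm]; field_simp)
    (by rw [inner_smul_right, hxy, mul_zero]) 0
  simpa [hx', hy'] using h

/-- The gradient of a radial function points in the radial direction. -/
lemma fderiv_radial (hf : Differentiable ℝ f) (hrad : ∀ x y, ‖x‖ = ‖y‖ → f x = f y) {x : E}
    (hx : x ≠ 0) : fderiv ℝ f x = (fderiv ℝ f x x / ‖x‖ ^ 2) • innerSL ℝ x := by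
  have hx' := norm_ne_zero_iff.2 hx
  ext y
  have h := fderiv_eq_zero_of_inner_eq_zero hf hrad (y := y - (inner ℝ x y / ‖x‖ ^ 2) • x) hx
    (by rw [inner_sub_right, inner_smul_right, real_inner_self_eq_norm_sq]; field_simp; simp)
  rw [map_sub, map_smul, sub_eq_zero] at h
  rw [h]
  simp only [smul_eq_mul, smul_apply, innerSL_apply_apply]
  ring

lemma fderiv_zero_of_radial (hf : Differentiable ℝ f) (hrad : ∀ x y, ‖x‖ = ‖y‖ → f x = f y) :
    fderiv ℝ f 0 = 0 := by
  have h1 : HasFDerivAt f (fderiv ℝ f 0) (-(0 : E)) := by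
    rw [neg_zero]; exact (hf 0).hasFDerivAt
  have h2 : HasFDerivAt (fun y ↦ f (-y)) (fderiv ℝ f 0 ∘L (-ContinuousLinearMap.id ℝ E)) 0 :=
    h1.comp (0 : E) (hasFDerivAt_id (0 : E)).neg
  have h3 : (fun y ↦ f (-y)) = f := funext fun y ↦ hrad _ _ (norm_neg y)
  rw [h3] at h2
  have h4 := h2.unique (hf 0).hasFDerivAt
  ext y
  have h5 := DFunLike.congr_fun h4 y
  simp at h5
  simp
  linarith

/-- The tangential second derivative of a radial function. -/
lemma fderiv_fderiv_tangential (hf : ContDiff ℝ 2 f) (hrad : ∀ x y, ‖x‖ = ‖y‖ → f x = f y)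
    {x y : E} (hy : ‖y‖ = ‖x‖) (hxy : inner ℝ x y = 0) :
    fderiv ℝ (fderiv ℝ f) x y y = fderiv ℝ f x x := by
  have hd : Differentiable ℝ f := hf.differentiable (by norm_num)
  have hd' : Differentiable ℝ (fderiv ℝ f) :=
    (hf.fderiv_right (m := 1) (by norm_num)).differentiable (by norm_num)
  have h1 : HasDerivAt (fun t ↦ Real.cos t • x + Real.sin t • y) y 0 := by
    simpa using hasDerivAt_cos_smul_add_sin_smul x y 0
  have h2 : HasDerivAt (fun t ↦ -Real.sin t • x + Real.cos t • y) (-x) 0 := by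
    refine (((Real.hasDerivAt_sin 0).neg.smul_const x).add
      ((Real.hasDerivAt_cos 0).smul_const y)).congr_deriv ?_
    simp
  have h3 : HasFDerivAt (fderiv ℝ f) (fderiv ℝ (fderiv ℝ f) x)
      (Real.cos 0 • x + Real.sin 0 • y) := by
    simpa using (hd' x).hasFDerivAt
  have h4 : HasDerivAt (fun t ↦ fderiv ℝ f (Real.cos t • x + Real.sin t • y))
      (fderiv ℝ (fderiv ℝ f) x y) 0 := h3.comp_hasDerivAt (0 : ℝ) h1
  have h5 := h4.clm_apply h2
  simp only [fderiv_circle_eq_zero hd hrad hy hxy] at h5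
  have h6 := h5.unique (hasDerivAt_const (0 : ℝ) (0 : ℝ))
  rw [Real.cos_zero, Real.sin_zero, one_smul, zero_smul, add_zero, map_neg] at h6
  simp only [neg_zero, zero_smul, one_smul, zero_add] at h6
  linarith

end Radial

/-! ### The radial Laplacian -/

section Laplacian

variable {n : ℕ} {f g : EuclideanSpace ℝ (Fin n) → ℝ}

lemma lap_radial (hf : ContDiff ℝ 2 f) (hrad : ∀ x y, ‖x‖ = ‖y‖ → f x = f y) (i₀ : Fin n)
    {r : ℝ} (hr : 0 < r) :
    lap f (r • EuclideanSpace.single i₀ 1) =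
      fderiv ℝ (fderiv ℝ f) (r • EuclideanSpace.single i₀ 1) (EuclideanSpace.single i₀ 1)
        (EuclideanSpace.single i₀ 1) +
      (n - 1) * (fderiv ℝ f (r • EuclideanSpace.single i₀ 1) (EuclideanSpace.single i₀ 1) / r) := by
  unfold lap
  rw [← Finset.add_sum_erase _ _ (Finset.mem_univ i₀)]
  congr 1
  have hn : 1 ≤ n := by have := i₀.2; omega
  rw [Finset.sum_congr rfl (g := fun _ ↦
    fderiv ℝ f (r • EuclideanSpace.single i₀ 1) (EuclideanSpace.single i₀ 1) / r)]
  · simp [Finset.card_erase_of_mem, Nat.cast_sub hn]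
  · intro i hi
    have hne : i ≠ i₀ := Finset.ne_of_mem_erase hi
    have h := fderiv_fderiv_tangential hf hrad
      (x := r • EuclideanSpace.single i₀ 1) (y := r • EuclideanSpace.single i 1)
      (by simp [norm_smul]) (by simp [inner_smul_left, inner_smul_right, EuclideanSpace.inner_single_left, hne.symm])
    simp only [map_smul, smul_eq_mul, smul_apply] at h
    field_simp
    rw [mul_comm]
    exact mul_left_cancel₀ hr.ne' h

variable {h : EuclideanSpace ℝ (Fin n) → ℝ}

lemma hasDerivAt_ray {E : Type*} [NormedAddCommGroup E] [NormedSpace ℝ E] {F : Type*}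
    [NormedAddCommGroup F] [NormedSpace ℝ F] {f : E → F} (hf : Differentiable ℝ f) (e : E) (r : ℝ) :
    HasDerivAt (fun r : ℝ ↦ f (r • e)) (fderiv ℝ f (r • e) e) r := by
  have h1 : HasDerivAt (fun r : ℝ ↦ r • e) e r := by
    simpa using (hasDerivAt_id r).smul_const e
  exact (hf (r • e)).hasFDerivAt.comp_hasDerivAt r h1

/-- The radial form of the equation `-Δf = h`. -/
lemma hasDerivAt_fderiv_ray (hf : ContDiff ℝ 2 f) (hrad : ∀ x y, ‖x‖ = ‖y‖ → f x = f y)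
    (hlap : ∀ x, -lap f x = h x) (i₀ : Fin n) {r : ℝ} (hr : 0 < r) :
    HasDerivAt
      (fun r : ℝ ↦ fderiv ℝ f (r • EuclideanSpace.single i₀ 1) (EuclideanSpace.single i₀ 1))
      (-h (r • EuclideanSpace.single i₀ 1) - (n - 1) *
        (fderiv ℝ f (r • EuclideanSpace.single i₀ 1) (EuclideanSpace.single i₀ 1) / r)) r := by
  have hd' : Differentiable ℝ (fderiv ℝ f) :=
    (hf.fderiv_right (m := 1) (by norm_num)).differentiable (by norm_num)
  have h1 := (hasDerivAt_ray hd' (EuclideanSpace.single i₀ 1) r).clm_apply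
    (hasDerivAt_const r (EuclideanSpace.single i₀ (1 : ℝ)))
  refine h1.congr_deriv ?_
  have h2 := lap_radial hf hrad i₀ hr
  have h3 := hlap (r • EuclideanSpace.single i₀ 1)
  rw [map_zero, add_zero]
  linarith

/-- The radial derivative of a radial solution of `-Δf = h`. -/
lemma fderiv_ray_eq (hf : ContDiff ℝ 2 f) (hrad : ∀ x y, ‖x‖ = ‖y‖ → f x = f y)
    (hh : Continuous h) (hlap : ∀ x, -lap f x = h x) (hn : 2 ≤ n) (i₀ : Fin n) {r : ℝ}
    (hr : 0 < r) :
    fderiv ℝ f (r • EuclideanSpace.single i₀ 1) (EuclideanSpace.single i₀ 1) =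
      -(r * radialMean (n - 1) h (r • EuclideanSpace.single i₀ 1)) := by
  set e : EuclideanSpace ℝ (Fin n) := EuclideanSpace.single i₀ 1
  obtain ⟨k, rfl⟩ : ∃ k, n = k + 2 := ⟨n - 2, by omega⟩
  have hd' : Continuous (fderiv ℝ f) :=
    (hf.fderiv_right (m := 1) (by norm_num)).continuous
  have key := intervalIntegral.integral_eq_sub_of_hasDerivAt_of_le hr.le
    (f := fun s ↦ s ^ (k + 1) * fderiv ℝ f (s • e) e) (f' := fun s ↦ -(s ^ (k + 1) * h (s • e)))
    (Continuous.continuousOn (by fun_prop)) (fun s hs ↦ ?_)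
    (Continuous.intervalIntegrable (by fun_prop) _ _)
  · have hsub := intervalIntegral.mul_integral_comp_mul_left
      (f := fun s ↦ s ^ (k + 1) * h (s • e)) (a := 0) (b := 1) r
    simp only [mul_zero, mul_one] at hsub
    rw [intervalIntegral.integral_neg, ← hsub] at key
    have hm : ∫ t in (0 : ℝ)..1, (r * t) ^ (k + 1) * h ((r * t) • e) =
        r ^ (k + 1) * radialMean (k + 1) h (r • e) := by
      rw [radialMean, ← intervalIntegral.integral_const_mul]
      refine intervalIntegral.integral_congr fun t _ ↦ ?_
      simp only [smul_smul, mul_comm t r]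
      ring
    rw [hm] at key
    simp only [ne_eq, Nat.add_eq_zero_iff, one_ne_zero, and_false, not_false_eq_true, zero_pow,
      zero_mul, sub_zero] at key
    have hr0 : r ^ (k + 1) ≠ 0 := by positivity
    refine mul_left_cancel₀ hr0 ?_
    rw [← key]
    simp only [show k + 2 - 1 = k + 1 from rfl]
    ring
  · have h1 := ((hasDerivAt_id s).pow (k + 1)).mul (hasDerivAt_fderiv_ray hf hrad hlap i₀ hs.1)
    refine h1.congr_deriv ?_
    have hs0 := hs.1.ne'
    simp only [id, Pi.pow_apply, Nat.add_sub_cancel]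
    push_cast
    field_simp
    ring

lemma radialMean_radial {k : ℕ} (hrad : ∀ x y, ‖x‖ = ‖y‖ → h x = h y)
    (x y : EuclideanSpace ℝ (Fin n)) (hxy : ‖x‖ = ‖y‖) :
    radialMean k h x = radialMean k h y := by
  refine intervalIntegral.integral_congr fun t _ ↦ ?_
  rw [hrad (t • x) (t • y) (by rw [norm_smul, norm_smul, hxy])]

/-- The gradient of a radial solution of `-Δf = h`. -/
lemma hasFDerivAt_of_lap (hf : ContDiff ℝ 2 f) (hrad : ∀ x y, ‖x‖ = ‖y‖ → f x = f y)
    (hh : Continuous h) (hhrad : ∀ x y, ‖x‖ = ‖y‖ → h x = h y) (hlap : ∀ x, -lap f x = h x)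
    (hn : 2 ≤ n) (x : EuclideanSpace ℝ (Fin n)) :
    HasFDerivAt f (-(radialMean (n - 1) h x) • innerSL ℝ x) x := by
  have hd : Differentiable ℝ f := hf.differentiable (by norm_num)
  refine (hd x).hasFDerivAt.congr_fderiv ?_
  rcases eq_or_ne x 0 with rfl | hx
  · rw [fderiv_zero_of_radial hd hrad]; simp
  have hx' : 0 < ‖x‖ := norm_pos_iff.2 hx
  rw [fderiv_radial hd hrad hx]
  congr 1
  set e : EuclideanSpace ℝ (Fin n) := EuclideanSpace.single ⟨0, by omega⟩ 1 with he
  have hne : ‖e‖ = 1 := by simp [he]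
  have h1 := hasDerivAt_ray hd x 1
  rw [one_smul] at h1
  have h2 : HasDerivAt (fun r : ℝ ↦ f ((r * ‖x‖) • e)) (fderiv ℝ f (‖x‖ • e) e * ‖x‖) 1 := by
    have h3 := hasDerivAt_ray hd e (1 * ‖x‖)
    rw [one_mul] at h3
    have h4 : HasDerivAt (fun r : ℝ ↦ r * ‖x‖) ‖x‖ 1 := by
      simpa using (hasDerivAt_id (1 : ℝ)).mul_const ‖x‖
    have h5 := HasDerivAt.comp (1 : ℝ) (by rw [one_mul]; exact h3) h4
    exact h5
  have h6 : (fun r : ℝ ↦ f ((r * ‖x‖) • e)) = fun r : ℝ ↦ f (r • x) :=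
    funext fun r ↦ hrad _ _ (by rw [norm_smul, norm_smul, hne, norm_mul, norm_norm, mul_one])
  rw [h6] at h2
  rw [h1.unique h2, fderiv_ray_eq hf hrad hh hlap hn _ hx',
    radialMean_radial hhrad (‖x‖ • e) x (by rw [norm_smul, hne, norm_norm, mul_one])]
  field_simp

end Laplacian

lemma integral_pow_sub_one {n : ℕ} (hn : 1 ≤ n) (c : ℝ) :
    ∫ t in (0 : ℝ)..1, t ^ (n - 1) * c = c / n := by
  obtain ⟨k, rfl⟩ : ∃ k, n = k + 1 := ⟨n - 1, by omega⟩
  rw [intervalIntegral.integral_mul_const, integral_pow]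
  simp
  ring

/-- The radial profile of a positive decreasing solution of `-ΔU = V ^ p`. -/
lemma radialProfile_of_lap {n : ℕ} (hn : 3 ≤ n) {p : ℝ} (hp : 0 < p)
    {U V : EuclideanSpace ℝ (Fin n) → ℝ} (hU : ContDiff ℝ 2 U) (hV : Continuous V)
    (hUpos : ∀ x, 0 < U x) (hVpos : ∀ x, 0 < V x) (hlap : ∀ x, -lap U x = V x ^ p)
    (hUanti : ∀ x y, ‖x‖ ≤ ‖y‖ → U y ≤ U x) (hVanti : ∀ x y, ‖x‖ ≤ ‖y‖ → V y ≤ V x)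
    (hlim : Tendsto U (cocompact _) (𝓝 0)) (i₀ : Fin n) :
    RadialProfile n p (fun r ↦ U (r • EuclideanSpace.single i₀ 1))
      (fun r ↦ radialMean (n - 1) (fun x ↦ V x ^ p) (r • EuclideanSpace.single i₀ 1))
      (fun r ↦ V (r • EuclideanSpace.single i₀ 1)) := by
  set e : EuclideanSpace ℝ (Fin n) := EuclideanSpace.single i₀ 1 with he
  have hne : ‖e‖ = 1 := by simp [he]
  have hUrad : ∀ x y, ‖x‖ = ‖y‖ → U x = U y := fun x y h ↦
    le_antisymm (hUanti y x h.ge) (hUanti x y h.le)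
  have hVp : Continuous fun x ↦ V x ^ p := hV.rpow_const fun x ↦ Or.inl (hVpos x).ne'
  have hd : Differentiable ℝ U := hU.differentiable (by norm_num)
  have hcont : Continuous (radialMean (n - 1) fun x ↦ V x ^ p) := continuous_radialMean _ hVp
  have hUc : Continuous U := hU.continuous
  have hi : ∀ x, IntervalIntegrable (fun t : ℝ ↦ t ^ (n - 1) * V (t • x) ^ p) volume 0 1 := fun x ↦
    Continuous.intervalIntegrable
      ((continuous_id.pow _).mul (hVp.comp (continuous_id.smul continuous_const))) _ _
  have hc : ∀ c : ℝ, IntervalIntegrable (fun t : ℝ ↦ t ^ (n - 1) * c) volume 0 1 := fun c ↦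
    Continuous.intervalIntegrable (by fun_prop) _ _
  refine ⟨fun r ↦ hUpos _, ?_, by fun_prop, by fun_prop, ?_, ?_, ?_, ?_, ?_⟩
  · intro r hr s hs hrs
    refine hUanti _ _ ?_
    rw [norm_smul, norm_smul, hne, Real.norm_of_nonneg hr, Real.norm_of_nonneg hs]
    simpa using hrs
  · refine hlim.comp ?_
    refine tendsto_cocompact_of_tendsto_dist_comp_atTop 0 ?_
    simp only [dist_zero_right, norm_smul, hne, mul_one]
    exact tendsto_norm_atTop_atTop
  · intro r hr
    rw [← fderiv_ray_eq hU hUrad hVp hlap (by omega) i₀ hr]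
    exact hasDerivAt_ray hd e r
  · intro r hr
    have h1 := (hasDerivAt_fderiv_ray hU hUrad hlap i₀ hr).div (hasDerivAt_id r) hr.ne'
    have h2 : (fun r ↦ radialMean (n - 1) (fun x ↦ V x ^ p) (r • e)) =ᶠ[𝓝 r]
        fun r ↦ -(fderiv ℝ U (r • e) e / id r) := by
      filter_upwards [lt_mem_nhds hr] with s hs
      rw [fderiv_ray_eq hU hUrad hVp hlap (by omega) i₀ hs]
      simp only [id, ← he]
      field_simp
    refine (h1.neg.congr_of_eventuallyEq h2).congr_deriv ?_
    rw [fderiv_ray_eq hU hUrad hVp hlap (by omega) i₀ hr]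
    simp only [id]
    field_simp
    ring
  · intro r hr
    rw [← integral_pow_sub_one (by omega)]
    refine intervalIntegral.integral_mono_on zero_le_one (hc _) (hi _) fun t ht ↦ ?_
    have h1 : V (r • e) ≤ V (t • r • e) := by
      refine hVanti _ _ ?_
      rw [norm_smul t, Real.norm_of_nonneg ht.1]
      exact mul_le_of_le_one_left (norm_nonneg _) ht.2
    have := (hVpos (r • e)).le
    exact mul_le_mul_of_nonneg_left (Real.rpow_le_rpow this h1 hp.le) (pow_nonneg ht.1 _)
  · intro r hr
    rw [← integral_pow_sub_one (by omega)]
    refine intervalIntegral.integral_mono_on zero_le_one (hi _) (hc _) fun t ht ↦ ?_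
    have h1 : V (t • r • e) ≤ V ((0 : ℝ) • e) := hVanti _ _ (by simp)
    have := (hVpos (t • r • e)).le
    exact mul_le_mul_of_nonneg_left (Real.rpow_le_rpow this h1 hp.le) (pow_nonneg ht.1 _)

/-! ### Decay for radial systems -/

lemma rpow_le_div_pow_of_le {a C w m s : ℝ} {k : ℕ} (ha : 0 ≤ a) (hle : a ≤ C * w ^ (-m))
    (hC : 1 ≤ C) (hw : 1 ≤ w) (hs : 0 ≤ s) (hs' : s ≤ 6) (hk : (k : ℝ) ≤ m * s) :
    a ^ s ≤ C ^ 6 / w ^ k := by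
  have hw0 : 0 < w := by linarith
  calc a ^ s ≤ (C * w ^ (-m)) ^ s := Real.rpow_le_rpow ha hle hs
    _ = C ^ s * w ^ (-(m * s)) := by
        rw [Real.mul_rpow (by linarith) (by positivity), ← Real.rpow_mul hw0.le, neg_mul]
    _ ≤ C ^ (6 : ℝ) * w ^ (-(k : ℝ)) := by
        gcongr
    _ = C ^ 6 / w ^ k := by
        rw [Real.rpow_neg hw0.le, Real.rpow_natCast, div_eq_mul_inv]
        norm_cast

section RadialSystem

variable {E : Type*} [NormedAddCommGroup E] [InnerProductSpace ℝ E]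
  {U V : E → ℝ} {k : ℕ} {p q : ℝ}

lemma radialMean_nonneg {f : E → ℝ} (hf : ∀ x, 0 ≤ f x) (x : E) : 0 ≤ radialMean k f x :=
  intervalIntegral.integral_nonneg zero_le_one fun _ ht ↦ mul_nonneg (pow_nonneg ht.1 k) (hf _)

/-- Decay of the second radial derivative. -/
lemma abs_radialMean_mul_rpow_le {g : E → ℝ} {C m : ℝ} (hV : ∀ x, 0 < V x) (hp : 1 ≤ p)
    (hp6 : p ≤ 6) (hC : 1 ≤ C) (hm : 3 ≤ m * (p - 1))
    (hVC : ∀ x, V x ≤ C * (1 + ‖x‖) ^ (-m)) (hg : ∀ x, |g x| ≤ C ^ 6 / (1 + ‖x‖) ^ (k + 1)) (x : E) :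
    |radialMean (k + 2) (fun y ↦ p * V y ^ (p - 1) * g y) x| ≤
      6 * C ^ 12 / (1 + ‖x‖) ^ (k + 3) := by
  refine abs_radialMean_le (k + 2) (fun x ↦ ?_) x
  have h1 : V x ^ (p - 1) ≤ C ^ 6 / (1 + ‖x‖) ^ 3 :=
    rpow_le_div_pow_of_le (hV x).le (hVC x) hC (by linarith [norm_nonneg x]) (by linarith)
      (by linarith) (by exact_mod_cast hm)
  have h0 : 0 ≤ V x ^ (p - 1) := Real.rpow_nonneg (hV x).le _
  rw [abs_mul, abs_mul, abs_of_nonneg h0, abs_of_nonneg (by linarith : 0 ≤ p)]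
  calc p * V x ^ (p - 1) * |g x|
      ≤ 6 * (C ^ 6 / (1 + ‖x‖) ^ 3) * (C ^ 6 / (1 + ‖x‖) ^ (k + 1)) := by
        gcongr
        exact hg x
    _ = 6 * C ^ 12 / (1 + ‖x‖) ^ (k + 2 + 2) := by
        rw [show k + 2 + 2 = 3 + (k + 1) by ring, pow_add _ 3]
        field_simp

variable [ProperSpace E]

lemma isRadialDiff_system (hU : ∀ x, 0 < U x) (hV : ∀ x, 0 < V x)
    (hΦ : ∀ x, HasFDerivAt U (-(radialMean k (fun y ↦ V y ^ p) x) • innerSL ℝ x) x)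
    (hΨ : ∀ x, HasFDerivAt V (-(radialMean k (fun y ↦ U y ^ q) x) • innerSL ℝ x) x) :
    ∀ m, IsRadialDiff m U ∧ IsRadialDiff m V
  | 0 => ⟨continuous_iff_continuousAt.2 fun x ↦ (hΦ x).continuousAt,
      continuous_iff_continuousAt.2 fun x ↦ (hΨ x).continuousAt⟩
  | m + 1 => by
    have ih := isRadialDiff_system hU hV hΦ hΨ m
    exact ⟨⟨_, (ih.2.rpow_const hV p).radialMean k, hΦ⟩,
      ⟨_, (ih.1.rpow_const hU q).radialMean k, hΨ⟩⟩

lemma contDiff_system (hU : ∀ x, 0 < U x) (hV : ∀ x, 0 < V x)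
    (hΦ : ∀ x, HasFDerivAt U (-(radialMean k (fun y ↦ V y ^ p) x) • innerSL ℝ x) x)
    (hΨ : ∀ x, HasFDerivAt V (-(radialMean k (fun y ↦ U y ^ q) x) • innerSL ℝ x) x) :
    ContDiff ℝ (⊤ : ℕ∞) U ∧ ContDiff ℝ (⊤ : ℕ∞) V :=
  ⟨contDiff_infty.2 fun m ↦ (isRadialDiff_system hU hV hΦ hΨ m).1.contDiff,
    contDiff_infty.2 fun m ↦ (isRadialDiff_system hU hV hΦ hΨ m).2.contDiff⟩

/-- Decay of the first three derivatives of the first component of a radial system. -/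
lemma norm_iteratedFDeriv_system_le {C L m : ℝ} (hU : ∀ x, 0 < U x) (hV : ∀ x, 0 < V x)
    (hΦ : ∀ x, HasFDerivAt U (-(radialMean k (fun y ↦ V y ^ p) x) • innerSL ℝ x) x)
    (hΨ : ∀ x, HasFDerivAt V (-(radialMean k (fun y ↦ U y ^ q) x) • innerSL ℝ x) x)
    (hp : 1 ≤ p) (hp6 : p ≤ 6) (hq : 1 ≤ q) (hq6 : q ≤ 6) (hC : 1 ≤ C) (hL : 0 ≤ L)
    (hpm : 3 ≤ m * (p - 1)) (hqm : 3 ≤ m * (q - 1)) (hpk : (k : ℝ) + 2 ≤ m * p)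
    (hqk : (k : ℝ) + 2 ≤ m * q)
    (hUC : ∀ x, U x ≤ C * (1 + ‖x‖) ^ (-m)) (hVC : ∀ x, V x ≤ C * (1 + ‖x‖) ^ (-m))
    (hΨL : ∀ x, radialMean k (fun y ↦ U y ^ q) x ≤ L * V x / (1 + ‖x‖) ^ 2)
    {l : ℕ} (hl : 1 ≤ l) (hl3 : l ≤ 3) (x : E) :
    ‖iteratedFDeriv ℝ l U x‖ * (1 + ‖x‖) ^ (k + l) ≤
      4 * (36 * C ^ 18 + 30 * C ^ 12 * L) * (1 + ‖x‖) := by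
  have hUc : Continuous U := (isRadialDiff_system hU hV hΦ hΨ 0).1
  have hVc : Continuous V := (isRadialDiff_system hU hV hΦ hΨ 0).2
  have hw : ∀ x : E, 1 ≤ 1 + ‖x‖ := fun x ↦ by linarith [norm_nonneg x]
  have hrpow : ∀ {f : E → ℝ}, Continuous f → (∀ x, 0 < f x) → ∀ s : ℝ, Continuous fun x ↦ f x ^ s :=
    fun hf hf0 s ↦ hf.rpow_const fun x ↦ Or.inl (hf0 x).ne'
  set Φ := radialMean k fun y ↦ V y ^ p
  set Ψ := radialMean k fun y ↦ U y ^ q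
  have hΦc : Continuous Φ := continuous_radialMean k (hrpow hVc hV p)
  have hΨc : Continuous Ψ := continuous_radialMean k (hrpow hUc hU q)
  have hΨ0 : ∀ x, 0 ≤ Ψ x := radialMean_nonneg fun x ↦ Real.rpow_nonneg (hU x).le q
  have bΦ : ∀ x, |Φ x| ≤ C ^ 6 / (1 + ‖x‖) ^ (k + 1) := by
    refine abs_radialMean_le k fun x ↦ ?_
    rw [abs_of_nonneg (Real.rpow_nonneg (hV x).le p)]
    exact rpow_le_div_pow_of_le (hV x).le (hVC x) hC (hw x) (by linarith) hp6 (by exact_mod_cast hpk)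
  have bΨ : ∀ x, |Ψ x| ≤ C ^ 6 / (1 + ‖x‖) ^ (k + 1) := by
    refine abs_radialMean_le k fun x ↦ ?_
    rw [abs_of_nonneg (Real.rpow_nonneg (hU x).le q)]
    exact rpow_le_div_pow_of_le (hU x).le (hUC x) hC (hw x) (by linarith) hq6 (by exact_mod_cast hqk)
  have hVp := hrpow hVc hV (p - 1)
  have hUq := hrpow hUc hU (q - 1)
  have hVp' := hrpow hVc hV (p - 1 - 1)
  have hΦ' : ∀ x, HasFDerivAt Φ
      (-(radialMean (k + 2) (fun y ↦ p * V y ^ (p - 1) * Ψ y) x) • innerSL ℝ x) x :=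
    hasFDerivAt_radialMean k (by fun_prop) (hasFDerivAt_rpow_of_radial hV hΨ p)
  have hΨ' : ∀ x, HasFDerivAt Ψ
      (-(radialMean (k + 2) (fun y ↦ q * U y ^ (q - 1) * Φ y) x) • innerSL ℝ x) x :=
    hasFDerivAt_radialMean k (by fun_prop) (hasFDerivAt_rpow_of_radial hU hΦ q)
  set Φ₂ := radialMean (k + 2) fun y ↦ p * V y ^ (p - 1) * Ψ y
  set Ψ₂ := radialMean (k + 2) fun y ↦ q * U y ^ (q - 1) * Φ y
  have hΨ₂c : Continuous Ψ₂ := continuous_radialMean _ (by fun_prop)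
  have bΦ₂ : ∀ x, |Φ₂ x| ≤ 6 * C ^ 12 / (1 + ‖x‖) ^ (k + 3) :=
    abs_radialMean_mul_rpow_le hV hp hp6 hC hpm hVC bΨ
  have bΨ₂ : ∀ x, |Ψ₂ x| ≤ 6 * C ^ 12 / (1 + ‖x‖) ^ (k + 3) :=
    abs_radialMean_mul_rpow_le hU hq hq6 hC hqm hUC bΦ
  set G : E → ℝ := fun y ↦
    p * V y ^ (p - 1) * Ψ₂ y + Ψ y * (p * ((p - 1) * V y ^ (p - 1 - 1) * Ψ y))
  have hGc : Continuous G := by fun_prop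
  have hG : ∀ x, HasFDerivAt (fun y ↦ p * V y ^ (p - 1) * Ψ y) (-(G x) • innerSL ℝ x) x := by
    intro x
    refine (((hasFDerivAt_rpow_of_radial hV hΨ (p - 1) x).const_mul p).mul (hΨ' x)).congr_fderiv ?_
    rw [smul_smul, smul_smul, smul_smul, ← add_smul]
    congr 1
    simp only [G]
    ring
  have hΦ₂ := hasFDerivAt_radialMean (k + 2) hGc hG
  have bG : ∀ x, |G x| ≤ (36 * C ^ 18 + 30 * C ^ 12 * L) / (1 + ‖x‖) ^ (k + 4 + 2) := by
    intro x
    have hx := hw x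
    have h1 : V x ^ (p - 1) ≤ C ^ 6 / (1 + ‖x‖) ^ 3 :=
      rpow_le_div_pow_of_le (hV x).le (hVC x) hC hx (by linarith) (by linarith)
        (by exact_mod_cast hpm)
    have h0 : 0 ≤ V x ^ (p - 1) := Real.rpow_nonneg (hV x).le _
    have hp0 : 0 ≤ p := by linarith
    have hp1 : 0 ≤ p - 1 := by linarith
    have hp5 : p - 1 ≤ 5 := by linarith
    have h2 : |p * V x ^ (p - 1) * Ψ₂ x| ≤ 36 * C ^ 18 / (1 + ‖x‖) ^ (k + 4 + 2) := by
      rw [abs_mul, abs_of_nonneg (mul_nonneg hp0 h0)]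
      calc p * V x ^ (p - 1) * |Ψ₂ x|
          ≤ 6 * (C ^ 6 / (1 + ‖x‖) ^ 3) * (6 * C ^ 12 / (1 + ‖x‖) ^ (k + 3)) := by
            gcongr
            exact bΨ₂ x
        _ = 36 * C ^ 18 / (1 + ‖x‖) ^ (k + 4 + 2) := by
            rw [show k + 4 + 2 = 3 + (k + 3) by ring, pow_add _ 3]
            field_simp
            ring
    have h3 : |Ψ x * (p * ((p - 1) * V x ^ (p - 1 - 1) * Ψ x))| ≤
        30 * C ^ 12 * L / (1 + ‖x‖) ^ (k + 4 + 2) := by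
      have hV0 := hV x
      have h4 : Ψ x / V x ≤ L / (1 + ‖x‖) ^ 2 := by
        rw [div_le_iff₀ hV0]
        exact (hΨL x).trans_eq (by ring)
      have h5 : 0 ≤ Ψ x / V x := div_nonneg (hΨ0 x) hV0.le
      have h6 : Ψ x ≤ C ^ 6 / (1 + ‖x‖) ^ (k + 1) := (le_abs_self _).trans (bΨ x)
      have h7 := hΨ0 x
      rw [Real.rpow_sub_one hV0.ne' (p - 1)]
      have e : Ψ x * (p * ((p - 1) * (V x ^ (p - 1) / V x) * Ψ x)) =
          p * (p - 1) * V x ^ (p - 1) * Ψ x * (Ψ x / V x) := by ring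
      rw [e, abs_of_nonneg (by positivity)]
      calc p * (p - 1) * V x ^ (p - 1) * Ψ x * (Ψ x / V x)
          ≤ 6 * 5 * (C ^ 6 / (1 + ‖x‖) ^ 3) * (C ^ 6 / (1 + ‖x‖) ^ (k + 1)) *
            (L / (1 + ‖x‖) ^ 2) := by gcongr
        _ = 30 * C ^ 12 * L / (1 + ‖x‖) ^ (k + 4 + 2) := by
            rw [show k + 4 + 2 = 3 + (k + 1) + 2 by ring, pow_add _ (3 + (k + 1)) 2,
              pow_add _ 3 (k + 1)]
            field_simp
            ring
    refine (abs_add_le _ _).trans ((add_le_add h2 h3).trans_eq ?_)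
    rw [add_div]
  have bΦ₃ := abs_radialMean_le (k + 4) bG
  set K := 36 * C ^ 18 + 30 * C ^ 12 * L with hK
  have hKL : 0 ≤ 30 * C ^ 12 * L := by positivity
  have hC6 : C ^ 6 ≤ C ^ 18 := pow_le_pow_right₀ hC (by norm_num)
  have hC12 : C ^ 12 ≤ C ^ 18 := pow_le_pow_right₀ hC (by norm_num)
  have hC0 : 0 ≤ C ^ 6 := by positivity
  have key := norm_iteratedFDeriv_le_of_radial (f := U) (n := k + 1) (K := K)
    (continuous_radialMean (k + 2 + 2) hGc) hΦ hΦ' hΦ₂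
    (fun x ↦ (bΦ x).trans (by gcongr; linarith)) (fun x ↦ (bΦ₂ x).trans (by gcongr; linarith))
    bΦ₃ x
  have hx := hw x
  have hK0 : 0 ≤ K := by linarith
  interval_cases l
  · refine key.1.trans ?_
    gcongr
    linarith
  · rw [show k + 2 = k + 1 + 1 by ring, pow_succ, ← mul_assoc]
    exact mul_le_mul_of_nonneg_right (key.2.1.trans (by linarith)) (by linarith)
  · rw [show k + 3 = k + 1 + 1 + 1 by ring, pow_succ, ← mul_assoc]
    exact mul_le_mul_of_nonneg_right key.2.2 (by linarith)

end RadialSystem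

/-! ### Exponents close to the critical one -/

/-- Near the diagonal, both exponents on the critical hyperbola are controlled. -/
lemma critical_hyperbola_bounds {n p q : ℝ} (hn : 3 ≤ n) (hp : 0 < p) (hq : 0 < q)
    (hpq : 1 / (p + 1) + 1 / (q + 1) = (n - 2) / n)
    (hε : |p - (n + 2) / (n - 2)| ≤ 1 / (160 * n ^ 2)) :
    n / (q + 1) + n / (p + 1) = n - 2 ∧ |n / (p + 1) - (n - 2) / 2| ≤ 1 / (80 * n) ∧
      |(n - 2) * (p - 1) - 4| ≤ 1 / 10 ∧ |(n - 2) * (q - 1) - 4| ≤ 1 / 10 := by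
  have hn0 : 0 < n := by linarith
  have hN : 1 ≤ n - 2 := by linarith
  have hsum : n / (q + 1) + n / (p + 1) = n - 2 := by
    have := congrArg (n * ·) hpq
    rw [mul_add, mul_div_cancel₀ _ hn0.ne'] at this
    rw [← this]; ring
  have hβ : n / (p + 1) * (p + 1) = n := div_mul_cancel₀ _ (by positivity)
  have hα : n / (q + 1) * (q + 1) = n := div_mul_cancel₀ _ (by positivity)
  have hβ0 : 0 < n / (p + 1) := by positivity
  have hβn : n / (p + 1) ≤ n := div_le_self hn0.le (by linarith)
  set β := n / (p + 1)
  set α := n / (q + 1)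
  set d := (n - 2) * (p - 1) - 4 with hd
  have hd' : |d| ≤ 1 / (160 * n) := by
    have e : d = (n - 2) * (p - (n + 2) / (n - 2)) := by rw [hd]; field_simp; ring
    rw [e, abs_mul, abs_of_pos (by linarith : 0 < n - 2)]
    calc (n - 2) * |p - (n + 2) / (n - 2)| ≤ n * (1 / (160 * n ^ 2)) := by gcongr; linarith
      _ = 1 / (160 * n) := by field_simp
  have hsmall : 1 / (160 * n) ≤ 1 / 480 := by gcongr; linarith
  have h1 : 2 * n * (β - (n - 2) / 2) = -(β * d) := by
    rw [hd]; linear_combination (n - 2) * hβ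
  have h2 : |β - (n - 2) / 2| ≤ 1 / (320 * n) := by
    have h3 : 2 * n * |β - (n - 2) / 2| ≤ n * (1 / (160 * n)) := by
      rw [← abs_of_pos (by linarith : 0 < 2 * n), ← abs_mul, h1, abs_neg, abs_mul, abs_of_pos hβ0]
      gcongr
    have e : n * (1 / (160 * n)) = 2 * n * (1 / (320 * n)) := by field_simp; norm_num
    rw [e] at h3
    exact le_of_mul_le_mul_left h3 (by linarith)
  have hsmall2 : 1 / (320 * n) ≤ 1 / 960 := by gcongr; linarith
  refine ⟨hsum, h2.trans (by gcongr; norm_num), hd'.trans (by linarith), ?_⟩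
  set D := (n - 2) * (q - 1) - 4 with hD
  have h4 : α * D = 2 * n * (β - (n - 2) / 2) := by
    rw [hD]; linear_combination (n - 2) * hα - 2 * n * hsum
  have hα1 : 49 / 100 ≤ α := by
    have := (abs_le.1 h2).2
    linarith
  have h5 : α * |D| ≤ 1 / 160 := by
    rw [← abs_of_pos (by linarith : 0 < α), ← abs_mul, h4, abs_mul,
      abs_of_pos (by linarith : 0 < 2 * n)]
    calc 2 * n * |β - (n - 2) / 2| ≤ 2 * n * (1 / (320 * n)) := by gcongr
      _ = 1 / 160 := by field_simp; norm_num
  nlinarith [abs_nonneg D]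

/-- The slope of a profile is controlled by the profile. -/
lemma RadialProfile.slope_le_mul_div {n : ℕ} {p C c : ℝ} {u φ v : ℝ → ℝ}
    (h : RadialProfile n p u φ v) (hn : 3 ≤ n) (hv : ∀ r, 0 < v r) (hp : 0 ≤ p) (hp6 : p ≤ 6)
    (hC : 1 ≤ C) (hc : 0 < c) (hv0 : v 0 ≤ C) (hcu : ∀ r, 0 ≤ r → r ≤ 1 → c ≤ u r) {r : ℝ}
    (hr : 0 ≤ r) : φ r ≤ 4 * (n + C ^ 6 / c) * u r / (1 + r) ^ 2 := by
  have hn1 : (3 : ℝ) ≤ n := by exact_mod_cast hn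
  have hu := h.pos r
  have hφ := (h.slope_pos hn hv hr).le
  rw [le_div_iff₀ (by positivity)]
  have hC6 : 0 < C ^ 6 / c := by positivity
  rcases le_total r 1 with hr1 | hr1
  · have h1 : φ r ≤ C ^ 6 := by
      refine (h.slope_le r hr).trans ((div_le_self (Real.rpow_nonneg (hv 0).le _)
        (by linarith)).trans ?_)
      calc v 0 ^ p ≤ C ^ p := Real.rpow_le_rpow (hv 0).le hv0 hp
        _ ≤ C ^ (6 : ℝ) := Real.rpow_le_rpow_of_exponent_le hC hp6
        _ = C ^ 6 := by norm_cast
    have h2 : C ^ 6 ≤ C ^ 6 / c * u r := by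
      rw [div_mul_eq_mul_div, le_div_iff₀ hc]
      exact mul_le_mul_of_nonneg_left (hcu r hr hr1) (by positivity)
    have h3 : (1 + r) ^ 2 ≤ 4 := by nlinarith
    calc φ r * (1 + r) ^ 2 ≤ (C ^ 6 / c * u r) * 4 := by
          gcongr
          exact h1.trans h2
      _ ≤ 4 * (n + C ^ 6 / c) * u r := by nlinarith
  · have h1 := h.sq_mul_slope_le hn hv hr
    have h3 : (1 + r) ^ 2 ≤ 4 * r ^ 2 := by nlinarith
    calc φ r * (1 + r) ^ 2 ≤ φ r * (4 * r ^ 2) := by gcongr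
      _ = 4 * (r ^ 2 * φ r) := by ring
      _ ≤ 4 * ((n - 2) * u r) := by gcongr
      _ ≤ 4 * (n + C ^ 6 / c) * u r := by nlinarith

lemma le_div_one_add_rpow {a K r : ℝ} {n l : ℕ} (hn : 3 ≤ n) (ha : 0 ≤ a) (hr : 0 ≤ r)
    (h : a * (1 + r) ^ (n - 1 + l) ≤ K * (1 + r)) :
    a ≤ 2 * K / (1 + r ^ ((n : ℝ) - 2 + l)) := by
  obtain ⟨k, rfl⟩ : ∃ k, n = k + 2 := ⟨n - 2, by omega⟩
  have e : ((k + 2 : ℕ) : ℝ) - 2 + l = ((k + l : ℕ) : ℝ) := by push_cast; ring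
  rw [e, Real.rpow_natCast, le_div_iff₀ (by positivity)]
  rw [show k + 2 - 1 + l = k + l + 1 by omega, pow_succ, ← mul_assoc] at h
  have h1 := le_of_mul_le_mul_right h (by linarith)
  have h2 : r ^ (k + l) ≤ (1 + r) ^ (k + l) := by gcongr; linarith
  have h3 : 1 ≤ (1 + r) ^ (k + l) := one_le_pow₀ (by linarith)
  nlinarith

theorem uniform_derivative_bounds_near_critical (n : ℕ) (hn : 3 ≤ n) :
    ∃ ε₂ : ℝ, 0 < ε₂ ∧ ∃ C : ℝ, 0 < C ∧
      ∀ p q : ℝ, 0 < p → 0 < q →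
        1 / (p + 1) + 1 / (q + 1) = ((n : ℝ) - 2) / n →
        |p - ((n : ℝ) + 2) / ((n : ℝ) - 2)| ≤ ε₂ →
        ∀ U V : EuclideanSpace ℝ (Fin n) → ℝ, IsGroundState n p q U V →
          ContDiff ℝ (⊤ : ℕ∞) U ∧ ContDiff ℝ (⊤ : ℕ∞) V ∧
          ∀ l : ℕ, 1 ≤ l → l ≤ 3 → ∀ x,
            ‖iteratedFDeriv ℝ l U x‖ + ‖iteratedFDeriv ℝ l V x‖ ≤
              C / (1 + ‖x‖ ^ ((n : ℝ) - 2 + l)) := by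
  obtain ⟨C, c, hC, hc, hbounds⟩ := exists_profile_bounds n hn
  have hn3 : (3 : ℝ) ≤ n := by exact_mod_cast hn
  set L : ℝ := 4 * (n + C ^ 6 / c) with hL
  have hL0 : 0 ≤ L := by positivity
  set K : ℝ := 4 * (36 * C ^ 18 + 30 * C ^ 12 * L) with hK
  have hK0 : 0 < K := by positivity
  refine ⟨1 / (160 * (n : ℝ) ^ 2), by positivity, 4 * K, by positivity, ?_⟩
  intro p q hp hq hpq hε U V hUV
  obtain ⟨hU2, hV2, hU, hV, hlapU, hlapV, hUanti, hVanti, hUlim, hVlim, hU0⟩ := hUV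
  obtain ⟨hsum, hβ, hpN, hqN⟩ := critical_hyperbola_bounds hn3 hp hq hpq hε
  rw [abs_le] at hpN hqN
  have hp1 : 1 ≤ p := by nlinarith
  have hq1 : 1 ≤ q := by nlinarith
  have hp6 : p ≤ 6 := by nlinarith
  have hq6 : q ≤ 6 := by nlinarith
  have hq2p : q ≤ 2 * p := by nlinarith
  set m : ℝ := n - 2 - 1 / 10 with hm
  have hpm : 3.2 ≤ m * (p - 1) := by rw [hm]; nlinarith
  have hqm : 3.2 ≤ m * (q - 1) := by rw [hm]; nlinarith
  have hn1 : ((n - 1 : ℕ) : ℝ) = n - 1 := by rw [Nat.cast_sub (by omega)]; norm_num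
  have hpk : ((n - 1 : ℕ) : ℝ) + 2 ≤ m * p := by rw [hn1]; linarith
  have hqk : ((n - 1 : ℕ) : ℝ) + 2 ≤ m * q := by rw [hn1]; linarith
  have hUrad : ∀ x y, ‖x‖ = ‖y‖ → U x = U y := fun x y h ↦
    le_antisymm (hUanti y x h.ge) (hUanti x y h.le)
  have hVrad : ∀ x y, ‖x‖ = ‖y‖ → V x = V y := fun x y h ↦
    le_antisymm (hVanti y x h.ge) (hVanti x y h.le)
  have hUrad' : ∀ x y, ‖x‖ = ‖y‖ → U x ^ q = U y ^ q := fun x y h ↦ by rw [hUrad x y h]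
  have hVrad' : ∀ x y, ‖x‖ = ‖y‖ → V x ^ p = V y ^ p := fun x y h ↦ by rw [hVrad x y h]
  have hΦ := hasFDerivAt_of_lap hU2 hUrad
    (hV2.continuous.rpow_const fun x ↦ Or.inl (hV x).ne') hVrad' hlapU (by omega)
  have hΨ := hasFDerivAt_of_lap hV2 hVrad
    (hU2.continuous.rpow_const fun x ↦ Or.inl (hU x).ne') hUrad' hlapV (by omega)
  let i₀ : Fin n := ⟨0, by omega⟩
  have hprofU := radialProfile_of_lap hn hp hU2 hV2.continuous hU hV hlapU hUanti hVanti hUlim i₀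
  have hprofV := radialProfile_of_lap hn hq hV2 hU2.continuous hV hU hlapV hVanti hUanti hVlim i₀
  obtain ⟨hUC, hVC, hcU, hcV⟩ := hbounds p q (n / (q + 1)) (n / (p + 1)) _ _ _ _ hprofU hprofV hp1
    hq1 hp6 hq2p (div_mul_cancel₀ _ (by positivity)) (div_mul_cancel₀ _ (by positivity)) hsum hβ
    (by simpa using hU0)
  have hnorm : ∀ x : EuclideanSpace ℝ (Fin n),
      ‖‖x‖ • (EuclideanSpace.single i₀ 1 : EuclideanSpace ℝ (Fin n))‖ = ‖x‖ := fun x ↦ by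
    simp [norm_smul]
  have hUC' : ∀ x, U x ≤ C * (1 + ‖x‖) ^ (-m) := fun x ↦ by
    rw [hUrad _ _ (hnorm x).symm]
    exact hUC _ (norm_nonneg x)
  have hVC' : ∀ x, V x ≤ C * (1 + ‖x‖) ^ (-m) := fun x ↦ by
    rw [hVrad _ _ (hnorm x).symm]
    exact hVC _ (norm_nonneg x)
  have hΦL : ∀ x, radialMean (n - 1) (fun y ↦ V y ^ p) x ≤ L * U x / (1 + ‖x‖) ^ 2 := fun x ↦ by
    rw [hUrad _ _ (hnorm x).symm, radialMean_radial hVrad' _ _ (hnorm x).symm]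
    exact hprofU.slope_le_mul_div hn (fun r ↦ hV _) hp.le hp6 hC hc
      (by simpa using hVC 0 le_rfl) hcU (norm_nonneg x)
  have hΨL : ∀ x, radialMean (n - 1) (fun y ↦ U y ^ q) x ≤ L * V x / (1 + ‖x‖) ^ 2 := fun x ↦ by
    rw [hVrad _ _ (hnorm x).symm, radialMean_radial hUrad' _ _ (hnorm x).symm]
    exact hprofV.slope_le_mul_div hn (fun r ↦ hU _) hq.le hq6 hC hc
      (by simpa using hUC 0 le_rfl) hcV (norm_nonneg x)
  have hsmooth := contDiff_system hU hV hΦ hΨ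
  refine ⟨hsmooth.1, hsmooth.2, fun l hl hl3 x ↦ ?_⟩
  have h1 := le_div_one_add_rpow hn (norm_nonneg _) (norm_nonneg x)
    (norm_iteratedFDeriv_system_le hU hV hΦ hΨ hp1 hp6 hq1 hq6 hC hL0 (by linarith) (by linarith)
      hpk hqk hUC' hVC' hΨL hl hl3 x)
  have h2 := le_div_one_add_rpow hn (norm_nonneg _) (norm_nonneg x)
    (norm_iteratedFDeriv_system_le hV hU hΨ hΦ hq1 hq6 hp1 hp6 hC hL0 (by linarith) (by linarith)
      hqk hpk hVC' hUC' hΦL hl hl3 x)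
  rw [← hK] at h1 h2
  refine (add_le_add h1 h2).trans_eq ?_
  ring
end

section
/- Let n ≥ 3, let δ > 0, ξ ∈ ℝⁿ, and let u(x) = c_n^* (δ/(δ² + |x − ξ|²))^{(n−2)/2} with c_n^* = [n(n−2)]^{(n−2)/4}, a positive solution of −Δu = u^{(n+2)/(n−2)} on ℝⁿ. Then every smooth function φ on ℝⁿ with φ(x) → 0 as |x| → ∞ and ∫_{ℝⁿ} |∇φ|² < ∞ that satisfies the linearized equation −Δφ = ((n+2)/(n−2)) u^{4/(n−2)} φ on ℝⁿ is a linear combination of the n+1 functions ∂u/∂x_1, …, ∂u/∂x_n and x·∇u + ((n−2)/2) u. -/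
open Filter MeasureTheory Topology

section PartialDerivatives

variable {n : ℕ} {f g : EuclideanSpace ℝ (Fin n) → ℝ}

/-- The partial derivative in the `i`-th coordinate direction. -/
noncomputable def pd (i : Fin n) (f : EuclideanSpace ℝ (Fin n) → ℝ)
    (x : EuclideanSpace ℝ (Fin n)) : ℝ :=
  fderiv ℝ f x (EuclideanSpace.single i 1)

/-- Smooth real functions on Euclidean space. -/
abbrev Smooth (f : EuclideanSpace ℝ (Fin n) → ℝ) : Prop := ContDiff ℝ (⊤ : ℕ∞) f

lemma Smooth.differentiable (hf : Smooth f) : Differentiable ℝ f :=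
  ContDiff.differentiable hf (by simp)

lemma Smooth.pd (hf : Smooth f) (i : Fin n) : Smooth (pd i f) :=
  (hf.fderiv_right (m := (⊤ : ℕ∞)) (by simp)).clm_apply contDiff_const

lemma pd_add (hf : Smooth f) (hg : Smooth g) (i : Fin n) (x : EuclideanSpace ℝ (Fin n)) :
    pd i (fun x => f x + g x) x = pd i f x + pd i g x := by
  simp [pd, fderiv_fun_add (hf.differentiable x) (hg.differentiable x)]

lemma pd_sub (hf : Smooth f) (hg : Smooth g) (i : Fin n) (x : EuclideanSpace ℝ (Fin n)) :
    pd i (fun x => f x - g x) x = pd i f x - pd i g x := by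
  simp [pd, fderiv_fun_sub (hf.differentiable x) (hg.differentiable x)]

lemma pd_mul (hf : Differentiable ℝ f) (hg : Differentiable ℝ g) (i : Fin n)
    (x : EuclideanSpace ℝ (Fin n)) :
    pd i (fun x => f x * g x) x = f x * pd i g x + g x * pd i f x := by
  simp [pd, fderiv_fun_mul (hf x) (hg x)]

lemma pd_const_mul (hf : Smooth f) (c : ℝ) (i : Fin n) (x : EuclideanSpace ℝ (Fin n)) :
    pd i (fun x => c * f x) x = c * pd i f x := by
  simp [pd, fderiv_const_mul (hf.differentiable x)]

lemma pd_sum {ι : Type*} {s : Finset ι} {F : ι → EuclideanSpace ℝ (Fin n) → ℝ}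
    (hF : ∀ k, Smooth (F k)) (i : Fin n) (x : EuclideanSpace ℝ (Fin n)) :
    pd i (fun x => ∑ k ∈ s, F k x) x = ∑ k ∈ s, pd i (F k) x := by
  simp [pd, fderiv_fun_sum (fun k _ => (hF k).differentiable x)]

lemma pd_comp {h : ℝ → ℝ} {h' : ℝ} {x : EuclideanSpace ℝ (Fin n)}
    (hh : HasDerivAt h h' (f x)) (hf : Differentiable ℝ f) (i : Fin n) :
    pd i (fun x => h (f x)) x = h' * pd i f x := by
  have := hh.comp_hasFDerivAt x (hf x).hasFDerivAt
  have e : fderiv ℝ (fun x => h (f x)) x = h' • fderiv ℝ f x := this.fderiv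
  simp [pd, e]

lemma fderiv_fderiv_apply (hf : Smooth f) (x v w : EuclideanSpace ℝ (Fin n)) :
    fderiv ℝ (fun x => fderiv ℝ f x v) x w = fderiv ℝ (fderiv ℝ f) x w v := by
  have h : DifferentiableAt ℝ (fderiv ℝ f) x :=
    (hf.fderiv_right (m := (⊤ : ℕ∞)) (by simp)).differentiable (by simp) x
  rw [fderiv_clm_apply h (differentiableAt_const v)]
  simp

lemma pd_comm (hf : Smooth f) (i j : Fin n) (x : EuclideanSpace ℝ (Fin n)) :
    pd i (pd j f) x = pd j (pd i f) x := by
  have h : IsSymmSndFDerivAt ℝ f x :=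
    ContDiffAt.isSymmSndFDerivAt hf.contDiffAt (by
      rw [minSmoothness_of_isRCLikeNormedField]; exact WithTop.coe_le_coe.2 (le_top : (2 : ℕ∞) ≤ ⊤))
  unfold pd
  rw [fderiv_fderiv_apply hf, fderiv_fderiv_apply hf]
  exact h _ _

lemma lap_eq_sum_pd (hf : Smooth f) (x : EuclideanSpace ℝ (Fin n)) :
    lap f x = ∑ i, pd i (pd i f) x := by
  unfold lap pd
  exact Finset.sum_congr rfl fun i _ => (fderiv_fderiv_apply hf _ _ _).symm

lemma fderiv_apply_eq_sum_pd (x w : EuclideanSpace ℝ (Fin n)) :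
    fderiv ℝ f x w = ∑ i, w i * pd i f x := by
  have hw : w = ∑ i, w i • EuclideanSpace.single i (1 : ℝ) := by
    ext j; simp [Finset.sum_apply, Pi.single_apply]
  conv_lhs => rw [hw]
  simp [pd]

lemma sum_sq_pd_le (x : EuclideanSpace ℝ (Fin n)) :
    ∑ i, pd i f x ^ 2 ≤ ‖fderiv ℝ f x‖ ^ 2 := by
  set w : EuclideanSpace ℝ (Fin n) := WithLp.toLp 2 fun i => pd i f x with hw
  have h1 : ∑ i, pd i f x ^ 2 = ‖w‖ ^ 2 := by
    rw [EuclideanSpace.real_norm_sq_eq]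
  have h2 : fderiv ℝ f x w = ‖w‖ ^ 2 := by
    rw [fderiv_apply_eq_sum_pd, ← h1]
    exact Finset.sum_congr rfl fun i _ => by rw [hw]; ring
  have h3 := (fderiv ℝ f x).le_opNorm w
  rw [h2, Real.norm_of_nonneg (by positivity)] at h3
  rw [h1]
  rcases (norm_nonneg w).eq_or_lt with h | h
  · rw [← h]; simp
  · have : ‖w‖ ≤ ‖fderiv ℝ f x‖ := by nlinarith
    gcongr

lemma integral_pd_eq_zero (hf : ContDiff ℝ 1 f) (hc : HasCompactSupport f) (i : Fin n) :
    ∫ x, pd i f x = 0 := by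
  have hd : Continuous fun x => fderiv ℝ f x (EuclideanSpace.single i 1) :=
    (hf.continuous_fderiv (by simp)).clm_apply continuous_const
  have hcd : HasCompactSupport fun x => fderiv ℝ f x (EuclideanSpace.single i 1) :=
    hc.fderiv_apply (𝕜 := ℝ) _
  have := integral_mul_fderiv_eq_neg_fderiv_mul_of_integrable (μ := volume)
    (f := fun _ : EuclideanSpace ℝ (Fin n) => (1 : ℝ)) (g := f) (v := EuclideanSpace.single i 1)
    (by simp) (by simpa using hd.integrable_of_hasCompactSupport hcd)
    (by simpa using hf.continuous.integrable_of_hasCompactSupport hc)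
    (by fun_prop) (fun x _ => hf.differentiable (by simp) x)
  simpa [pd] using this

end PartialDerivatives

section ConformalHessian

variable {n : ℕ} {δ : ℝ} {ξ : EuclideanSpace ℝ (Fin n)}

/-- The reciprocal of the conformal factor of the stereographic projection. -/
noncomputable def quad (δ : ℝ) (ξ x : EuclideanSpace ℝ (Fin n)) : ℝ := δ ^ 2 + ‖x - ξ‖ ^ 2

lemma quad_eq_sum (x : EuclideanSpace ℝ (Fin n)) :
    quad δ ξ x = δ ^ 2 + ∑ i, (x i - ξ i) ^ 2 := by
  simp [quad, EuclideanSpace.real_norm_sq_eq]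

lemma quad_pos (hδ : 0 < δ) (x : EuclideanSpace ℝ (Fin n)) : 0 < quad δ ξ x := by
  unfold quad; positivity

lemma smooth_quad : Smooth (quad δ ξ) := by
  unfold quad
  exact contDiff_const.add ((contDiff_id.sub contDiff_const).norm_sq ℝ)

lemma smooth_coord (i : Fin n) : Smooth fun x : EuclideanSpace ℝ (Fin n) => x i - ξ i := by
  unfold Smooth; fun_prop

lemma pd_coord (i j : Fin n) (x : EuclideanSpace ℝ (Fin n)) :
    pd j (fun x => x i - ξ i) x = if i = j then 1 else 0 := by
  have h : HasFDerivAt (fun x : EuclideanSpace ℝ (Fin n) => x i - ξ i)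
      (EuclideanSpace.proj i : EuclideanSpace ℝ (Fin n) →L[ℝ] ℝ) x :=
    (EuclideanSpace.proj i : EuclideanSpace ℝ (Fin n) →L[ℝ] ℝ).hasFDerivAt.sub_const _
  simp [pd, h.fderiv]

lemma pd_quad (j : Fin n) (x : EuclideanSpace ℝ (Fin n)) :
    pd j (quad δ ξ) x = 2 * (x j - ξ j) := by
  have h : quad δ ξ = fun x => (fun _ => δ ^ 2) x + ∑ i, (x i - ξ i) * (x i - ξ i) := by
    funext x; rw [quad_eq_sum]; simp [sq]
  rw [h, pd_add contDiff_const (ContDiff.sum fun i _ => (smooth_coord i).mul (smooth_coord i)),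
    pd_sum fun i => (smooth_coord i).mul (smooth_coord i)]
  simp_rw [pd_mul (smooth_coord _).differentiable (smooth_coord _).differentiable, pd_coord,
    Finset.sum_add_distrib]
  simp [pd]
  ring

variable {v m : EuclideanSpace ℝ (Fin n) → ℝ}

/-- The Hessian of `v` minus `m` times the identity. -/
noncomputable def tfHess (v m : EuclideanSpace ℝ (Fin n) → ℝ) (i j : Fin n)
    (x : EuclideanSpace ℝ (Fin n)) : ℝ :=
  pd j (pd i v) x - if i = j then m x else 0

/-- The squared norm of `tfHess`. -/
noncomputable def tfHessSq (v m : EuclideanSpace ℝ (Fin n) → ℝ)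
    (x : EuclideanSpace ℝ (Fin n)) : ℝ :=
  ∑ i, ∑ j, tfHess v m i j x ^ 2

/-- Up to a factor, the function `|∇ψ|² + ψ²` of the sphere in stereographic coordinates. -/
noncomputable def disc (v m : EuclideanSpace ℝ (Fin n) → ℝ)
    (x : EuclideanSpace ℝ (Fin n)) : ℝ :=
  ∑ i, pd i v x * pd i v x - 2 * (v x * m x)

lemma tfHess_symm (hv : Smooth v) (i j : Fin n) (x : EuclideanSpace ℝ (Fin n)) :
    tfHess v m i j x = tfHess v m j i x := by
  unfold tfHess
  rw [pd_comm hv]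
  simp [eq_comm]

lemma smooth_disc (hv : Smooth v) (hm : Smooth m) : Smooth (disc v m) :=
  (ContDiff.sum fun i _ => (hv.pd i).mul (hv.pd i)).sub (contDiff_const.mul (hv.mul hm))

lemma continuous_tfHessSq (hv : Smooth v) (hm : Smooth m) : Continuous (tfHessSq v m) := by
  unfold tfHessSq tfHess
  refine continuous_finsetSum _ fun i _ => continuous_finsetSum _ fun j _ => ?_
  refine (((hv.pd i).pd j).continuous.sub ?_).pow 2
  split_ifs
  · exact hm.continuous
  · exact continuous_const

lemma tfHessSq_nonneg (x : EuclideanSpace ℝ (Fin n)) : 0 ≤ tfHessSq v m x := by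
  unfold tfHessSq; positivity

lemma sum_tfHess_mul (a : Fin n → ℝ) (j : Fin n) (x : EuclideanSpace ℝ (Fin n)) :
    ∑ i, tfHess v m i j x * a i = ∑ i, a i * pd j (pd i v) x - a j * m x := by
  simp only [tfHess, sub_mul, Finset.sum_sub_distrib, ite_mul, zero_mul, Finset.sum_ite_eq',
    Finset.mem_univ, if_true]
  congr 1
  · exact Finset.sum_congr rfl fun i _ => mul_comm _ _
  · ring

lemma tfHessSq_eq (htr : ∀ x, ∑ i, pd i (pd i v) x = n * m x) (x : EuclideanSpace ℝ (Fin n)) :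
    tfHessSq v m x = ∑ i, ∑ j, pd j (pd i v) x ^ 2 - n * m x ^ 2 := by
  have h : ∀ i j, tfHess v m i j x ^ 2 = pd j (pd i v) x ^ 2
      - (if i = j then 2 * m x * pd j (pd i v) x - m x ^ 2 else 0) := by
    intro i j
    unfold tfHess
    split_ifs <;> ring
  simp only [tfHessSq, h, Finset.sum_sub_distrib, Finset.sum_ite_eq, Finset.mem_univ, if_true,
    ← Finset.mul_sum, htr]
  simp
  ring

lemma quad_mul_pd_factor (hv : Smooth v) (hm : Smooth m)
    (heq : ∀ x, quad δ ξ x * m x = 2 * (∑ i, (x i - ξ i) * pd i v x - v x))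
    (j : Fin n) (x : EuclideanSpace ℝ (Fin n)) :
    quad δ ξ x * pd j m x + 2 * ((x j - ξ j) * m x)
      = 2 * ∑ i, (x i - ξ i) * pd j (pd i v) x := by
  have hs : ∀ i, Smooth fun x => (x i - ξ i) * pd i v x := fun i =>
    (smooth_coord i).mul (hv.pd i)
  have h : pd j (fun x => quad δ ξ x * m x) x
      = pd j (fun x => 2 * (∑ i, (x i - ξ i) * pd i v x - v x)) x := by
    rw [funext heq]
  rw [pd_mul smooth_quad.differentiable hm.differentiable, pd_quad,
    pd_const_mul ((ContDiff.sum fun i _ => hs i).sub hv),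
    pd_sub (ContDiff.sum fun i _ => hs i) hv, pd_sum hs] at h
  simp_rw [pd_mul (smooth_coord _).differentiable (hv.pd _).differentiable, pd_coord,
    Finset.sum_add_distrib] at h
  simp at h
  linarith

lemma quad_mul_pd_factor_eq_sum (hv : Smooth v) (hm : Smooth m)
    (heq : ∀ x, quad δ ξ x * m x = 2 * (∑ i, (x i - ξ i) * pd i v x - v x))
    (j : Fin n) (x : EuclideanSpace ℝ (Fin n)) :
    quad δ ξ x * pd j m x = 2 * ∑ i, tfHess v m i j x * (x i - ξ i) := by
  rw [sum_tfHess_mul]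
  linarith [quad_mul_pd_factor hv hm heq j x]

lemma sum_pd_pd_pd (hv : Smooth v) (hm : Smooth m)
    (htr : ∀ x, ∑ i, pd i (pd i v) x = n * m x) (i : Fin n) (x : EuclideanSpace ℝ (Fin n)) :
    ∑ j, pd j (pd j (pd i v)) x = n * pd i m x := by
  have h : pd i (fun x => ∑ j, pd j (pd j v) x) x = pd i (fun x => (n : ℝ) * m x) x := by
    rw [funext htr]
  rw [pd_sum fun j => (hv.pd j).pd j, pd_const_mul hm] at h
  rw [← h]
  refine Finset.sum_congr rfl fun j _ => ?_
  rw [← pd_comm (hv.pd j)]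
  congr 1
  funext y
  exact pd_comm hv j i y

lemma quad_mul_lap_factor (hv : Smooth v) (hm : Smooth m)
    (htr : ∀ x, ∑ i, pd i (pd i v) x = n * m x)
    (heq : ∀ x, quad δ ξ x * m x = 2 * (∑ i, (x i - ξ i) * pd i v x - v x))
    (x : EuclideanSpace ℝ (Fin n)) :
    quad δ ξ x * ∑ j, pd j (pd j m) x = (2 * n - 4) * ∑ j, (x j - ξ j) * pd j m x := by
  have hs : ∀ i j, Smooth fun x => (x i - ξ i) * pd j (pd i v) x := fun i j =>
    (smooth_coord i).mul ((hv.pd i).pd j)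
  have h : ∀ j, quad δ ξ x * pd j (pd j m) x + 4 * ((x j - ξ j) * pd j m x) + 2 * m x
      = 2 * (∑ i, (x i - ξ i) * pd j (pd j (pd i v)) x + pd j (pd j v) x) := by
    intro j
    have h : pd j (fun x => quad δ ξ x * pd j m x + 2 * ((x j - ξ j) * m x)) x
        = pd j (fun x => 2 * ∑ i, (x i - ξ i) * pd j (pd i v) x) x := by
      rw [funext (quad_mul_pd_factor hv hm heq j)]
    rw [pd_add (smooth_quad.mul (hm.pd j)) (contDiff_const.mul ((smooth_coord j).mul hm)),
      pd_mul smooth_quad.differentiable (hm.pd j).differentiable, pd_quad,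
      pd_const_mul ((smooth_coord j).mul hm),
      pd_mul (smooth_coord j).differentiable hm.differentiable, pd_coord,
      pd_const_mul (ContDiff.sum fun i _ => hs i j), pd_sum fun i => hs i j] at h
    simp_rw [pd_mul (smooth_coord _).differentiable ((hv.pd _).pd j).differentiable, pd_coord,
      Finset.sum_add_distrib] at h
    simp at h
    linarith
  have h2 := Finset.sum_congr (rfl : (Finset.univ : Finset (Fin n)) = Finset.univ)
    fun j _ => h j
  simp only [Finset.sum_add_distrib, ← Finset.mul_sum, htr] at h2
  rw [Finset.sum_comm] at h2
  simp only [← Finset.mul_sum, sum_pd_pd_pd hv hm htr] at h2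
  have h3 : ∑ i, (x i - ξ i) * (n * pd i m x) = n * ∑ i, (x i - ξ i) * pd i m x := by
    rw [Finset.mul_sum]
    exact Finset.sum_congr rfl fun i _ => by ring
  rw [h3] at h2
  simp at h2
  linarith

lemma pd_disc (hv : Smooth v) (hm : Smooth m) (j : Fin n) (x : EuclideanSpace ℝ (Fin n)) :
    pd j (disc v m) x
      = 2 * ∑ i, pd i v x * pd j (pd i v) x - 2 * (v x * pd j m x + m x * pd j v x) := by
  unfold disc
  rw [pd_sub (ContDiff.sum fun i _ => (hv.pd i).mul (hv.pd i)) (contDiff_const.mul (hv.mul hm)),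
    pd_sum fun i => (hv.pd i).mul (hv.pd i), pd_const_mul (hv.mul hm),
    pd_mul hv.differentiable hm.differentiable]
  simp_rw [pd_mul (hv.pd _).differentiable (hv.pd _).differentiable, Finset.sum_add_distrib]
  ring

lemma quad_mul_pd_disc (hv : Smooth v) (hm : Smooth m)
    (heq : ∀ x, quad δ ξ x * m x = 2 * (∑ i, (x i - ξ i) * pd i v x - v x))
    (j : Fin n) (x : EuclideanSpace ℝ (Fin n)) :
    quad δ ξ x * pd j (disc v m) x
      = 2 * ∑ i, tfHess v m i j x * (quad δ ξ x * pd i v x - 2 * v x * (x i - ξ i)) := by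
  have h1 := quad_mul_pd_factor_eq_sum hv hm heq j x
  have h2 := sum_tfHess_mul (v := v) (m := m) (fun i => pd i v x) j x
  have h3 : ∑ i, tfHess v m i j x * (quad δ ξ x * pd i v x - 2 * v x * (x i - ξ i))
      = quad δ ξ x * ∑ i, tfHess v m i j x * pd i v x
        - 2 * v x * ∑ i, tfHess v m i j x * (x i - ξ i) := by
    rw [Finset.mul_sum, Finset.mul_sum, ← Finset.sum_sub_distrib]
    exact Finset.sum_congr rfl fun i _ => by ring
  rw [h3, h2, pd_disc hv hm]
  linear_combination (-2 * v x) * h1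

lemma lap_disc (hv : Smooth v) (hm : Smooth m)
    (htr : ∀ x, ∑ i, pd i (pd i v) x = n * m x) (x : EuclideanSpace ℝ (Fin n)) :
    ∑ j, pd j (pd j (disc v m)) x
      = 2 * tfHessSq v m x + 2 * (n - 2) * ∑ i, pd i v x * pd i m x
        - 2 * v x * ∑ j, pd j (pd j m) x := by
  have hs : ∀ i j, Smooth fun x => pd i v x * pd j (pd i v) x := fun i j =>
    (hv.pd i).mul ((hv.pd i).pd j)
  have h : ∀ j, pd j (pd j (disc v m)) x
      = 2 * (∑ i, pd i v x * pd j (pd j (pd i v)) x + ∑ i, pd j (pd i v) x ^ 2)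
        - 2 * (v x * pd j (pd j m) x + 2 * (pd j v x * pd j m x) + m x * pd j (pd j v) x) := by
    intro j
    rw [funext (pd_disc hv hm j),
      pd_sub (contDiff_const.mul (ContDiff.sum fun i _ => hs i j))
        (contDiff_const.mul ((hv.mul (hm.pd j)).add (hm.mul (hv.pd j)))),
      pd_const_mul (ContDiff.sum fun i _ => hs i j), pd_sum fun i => hs i j,
      pd_const_mul ((hv.mul (hm.pd j)).add (hm.mul (hv.pd j))),
      pd_add (hv.mul (hm.pd j)) (hm.mul (hv.pd j)),
      pd_mul hv.differentiable (hm.pd j).differentiable,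
      pd_mul hm.differentiable (hv.pd j).differentiable]
    simp_rw [pd_mul (hv.pd _).differentiable ((hv.pd _).pd j).differentiable,
      Finset.sum_add_distrib, sq]
    ring
  simp only [h, Finset.sum_sub_distrib, Finset.sum_add_distrib, ← Finset.mul_sum, htr]
  rw [Finset.sum_comm, tfHessSq_eq htr]
  simp only [← Finset.mul_sum, sum_pd_pd_pd hv hm htr]
  rw [Finset.sum_comm (f := fun j i => pd j (pd i v) x ^ 2)]
  have h3 : ∑ i, pd i v x * (n * pd i m x) = n * ∑ i, pd i v x * pd i m x := by
    rw [Finset.mul_sum]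
    exact Finset.sum_congr rfl fun i _ => by ring
  rw [h3]
  ring

/-- The Bochner identity for `disc`. -/
lemma quad_mul_lap_disc (hv : Smooth v) (hm : Smooth m)
    (htr : ∀ x, ∑ i, pd i (pd i v) x = n * m x)
    (heq : ∀ x, quad δ ξ x * m x = 2 * (∑ i, (x i - ξ i) * pd i v x - v x))
    (x : EuclideanSpace ℝ (Fin n)) :
    quad δ ξ x * ∑ j, pd j (pd j (disc v m)) x
      = 2 * quad δ ξ x * tfHessSq v m x
        + 2 * (n - 2) * ∑ j, (x j - ξ j) * pd j (disc v m) x := by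
  have h1 := quad_mul_lap_factor hv hm htr heq x
  have h2 : ∑ j, (x j - ξ j) * pd j (disc v m) x
      = quad δ ξ x * ∑ i, pd i v x * pd i m x - 2 * v x * ∑ j, (x j - ξ j) * pd j m x := by
    have h3 : ∀ j, (x j - ξ j) * pd j (disc v m) x
        = 2 * ∑ i, pd i v x * (tfHess v m j i x * (x j - ξ j))
          - 2 * v x * ((x j - ξ j) * pd j m x) := by
      intro j
      have h4 := sum_tfHess_mul (v := v) (m := m) (fun i => pd i v x) j x
      have h5 : ∑ i, pd i v x * (tfHess v m j i x * (x j - ξ j))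
          = (x j - ξ j) * ∑ i, tfHess v m i j x * pd i v x := by
        rw [Finset.mul_sum]
        exact Finset.sum_congr rfl fun i _ => by rw [tfHess_symm hv]; ring
      rw [h5, h4, pd_disc hv hm]
      ring
    simp only [h3, Finset.sum_sub_distrib, ← Finset.mul_sum]
    rw [Finset.sum_comm]
    simp only [← Finset.mul_sum]
    congr 1
    rw [Finset.mul_sum, Finset.mul_sum]
    refine Finset.sum_congr rfl fun i _ => ?_
    linear_combination (-pd i v x) * quad_mul_pd_factor_eq_sum hv hm heq i x
  rw [h2, lap_disc hv hm htr]
  linear_combination (-2 * v x) * h1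

lemma sum_sq_sub_add_eq_disc
    (heq : ∀ x, quad δ ξ x * m x = 2 * (∑ i, (x i - ξ i) * pd i v x - v x))
    (x : EuclideanSpace ℝ (Fin n)) :
    ∑ i, (quad δ ξ x * pd i v x - 2 * v x * (x i - ξ i)) ^ 2 + 4 * δ ^ 2 * v x ^ 2
      = quad δ ξ x ^ 2 * disc v m x := by
  have h : ∑ i, (quad δ ξ x * pd i v x - 2 * v x * (x i - ξ i)) ^ 2
      = quad δ ξ x ^ 2 * ∑ i, pd i v x * pd i v x
        - 4 * v x * quad δ ξ x * ∑ i, (x i - ξ i) * pd i v x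
        + 4 * v x ^ 2 * ∑ i, (x i - ξ i) ^ 2 := by
    rw [Finset.mul_sum, Finset.mul_sum, Finset.mul_sum, ← Finset.sum_sub_distrib,
      ← Finset.sum_add_distrib]
    exact Finset.sum_congr rfl fun i _ => by ring
  have hq := quad_eq_sum (δ := δ) (ξ := ξ) x
  rw [h, disc]
  linear_combination (2 * v x * quad δ ξ x) * heq x - 4 * v x ^ 2 * hq

lemma disc_nonneg (hδ : 0 < δ)
    (heq : ∀ x, quad δ ξ x * m x = 2 * (∑ i, (x i - ξ i) * pd i v x - v x))
    (x : EuclideanSpace ℝ (Fin n)) : 0 ≤ disc v m x := by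
  have h := sum_sq_sub_add_eq_disc heq x
  have hq := quad_pos (ξ := ξ) hδ x
  have h1 : 0 ≤ quad δ ξ x ^ 2 * disc v m x := by rw [← h]; positivity
  exact nonneg_of_mul_nonneg_right h1 (by positivity)

/-- The refined Kato inequality for a symmetric trace-free matrix. -/
lemma sum_sq_sum_mul_le {T : Fin n → Fin n → ℝ} (hsymm : ∀ i j, T i j = T j i)
    (htr : ∑ i, T i i = 0) (hn : 2 ≤ n) (a : Fin n → ℝ) :
    n * ∑ j, (∑ i, T i j * a i) ^ 2 ≤ (n - 1) * (∑ i, ∑ j, T i j ^ 2) * ∑ i, a i ^ 2 := by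
  set w : Fin n → ℝ := fun j => ∑ i, T i j * a i with hw
  set W := ∑ j, w j ^ 2 with hW
  set A := ∑ i, a i ^ 2 with hA
  set N := ∑ i, ∑ j, T i j ^ 2 with hN
  set d := ∑ i, a i * w i with hd
  have hn' : (2 : ℝ) ≤ n := by exact_mod_cast hn
  set B : Fin n → Fin n → ℝ := fun i j => a i * w j + a j * w i - if i = j then 2 * d / n else 0
    with hB
  have hTB : ∑ i, ∑ j, T i j * B i j = 2 * W := by
    have h1 : ∀ i j, T i j * B i j = (T i j * a i) * w j + (T j i * a j) * w i
        - if i = j then T i j * (2 * d / n) else 0 := by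
      intro i j
      simp only [hB]
      rw [hsymm j i]
      split_ifs <;> ring
    simp only [h1, Finset.sum_sub_distrib, Finset.sum_add_distrib]
    rw [Finset.sum_comm (f := fun i j => T i j * a i * w j)]
    simp only [← Finset.sum_mul, Finset.sum_ite_eq, Finset.mem_univ, if_true, htr]
    have : ∀ j, (∑ i, T i j * a i) * w j = w j ^ 2 := fun j => by simp only [hw]; ring
    simp only [this, ← hW]
    ring
  have hBB : ∑ i, ∑ j, B i j ^ 2 = 2 * A * W + 2 * d ^ 2 - 4 * d ^ 2 / n := by
    have h1 : ∀ i j, B i j ^ 2 = a i ^ 2 * w j ^ 2 + w i ^ 2 * a j ^ 2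
        + 2 * ((a i * w i) * (a j * w j))
        + if i = j then -(8 * d / n * (a i * w i)) + (2 * d / n) ^ 2 + 0 * w j else 0 := by
      intro i j
      simp only [hB]
      split_ifs with h
      · subst h; ring
      · ring
    simp only [h1, Finset.sum_add_distrib, ← Finset.mul_sum, ← Finset.sum_mul,
      Finset.sum_ite_eq, Finset.mem_univ, if_true, Finset.sum_neg_distrib]
    simp
    rw [← hA, ← hW, ← hd]
    field_simp
    ring
  have hcs : (2 * W) ^ 2 ≤ N * ∑ i, ∑ j, B i j ^ 2 := by
    have := Finset.sum_mul_sq_le_sq_mul_sq (Finset.univ : Finset (Fin n × Fin n))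
      (fun p => T p.1 p.2) (fun p => B p.1 p.2)
    simpa only [Fintype.sum_prod_type, hTB, ← hN] using this
  have hdle : d ^ 2 ≤ A * W := Finset.sum_mul_sq_le_sq_mul_sq _ _ _
  have hN0 : 0 ≤ N := by positivity
  have hA0 : 0 ≤ A := by positivity
  have hW0 : 0 ≤ W := by positivity
  have hBle : n * ∑ i, ∑ j, B i j ^ 2 ≤ 4 * (n - 1) * (A * W) := by
    rw [hBB]
    have : (n : ℝ) * (2 * A * W + 2 * d ^ 2 - 4 * d ^ 2 / n)
      = 2 * n * (A * W) + (2 * n - 4) * d ^ 2 := by field_simp; ring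
    rw [this]
    nlinarith
  have hfin : W * (n * W) ≤ W * ((n - 1) * N * A) := by
    have h1 : n * (2 * W) ^ 2 ≤ N * (4 * (n - 1) * (A * W)) := by
      calc n * (2 * W) ^ 2 ≤ n * (N * ∑ i, ∑ j, B i j ^ 2) := by gcongr
        _ = N * (n * ∑ i, ∑ j, B i j ^ 2) := by ring
        _ ≤ _ := by gcongr
    nlinarith
  rcases hW0.eq_or_lt with h | h
  · rw [← h, mul_zero]
    have : (0 : ℝ) ≤ n - 1 := by linarith
    positivity
  · exact le_of_mul_le_mul_left hfin h

lemma sum_sq_pd_disc_le (hn : 2 ≤ n) (hδ : 0 < δ) (hv : Smooth v) (hm : Smooth m)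
    (htr : ∀ x, ∑ i, pd i (pd i v) x = n * m x)
    (heq : ∀ x, quad δ ξ x * m x = 2 * (∑ i, (x i - ξ i) * pd i v x - v x))
    (x : EuclideanSpace ℝ (Fin n)) :
    n * ∑ j, pd j (disc v m) x ^ 2 ≤ 4 * (n - 1) * (tfHessSq v m x * disc v m x) := by
  have hq := quad_pos (ξ := ξ) hδ x
  have htr0 : ∑ i, tfHess v m i i x = 0 := by simp [tfHess, htr]
  have hK := sum_sq_sum_mul_le (T := fun i j => tfHess v m i j x)
    (fun i j => tfHess_symm hv i j x) htr0 hn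
    (fun i => quad δ ξ x * pd i v x - 2 * v x * (x i - ξ i))
  have h1 : ∑ i, (quad δ ξ x * pd i v x - 2 * v x * (x i - ξ i)) ^ 2
      ≤ quad δ ξ x ^ 2 * disc v m x := by
    rw [← sum_sq_sub_add_eq_disc heq x]
    have : 0 ≤ 4 * δ ^ 2 * v x ^ 2 := by positivity
    linarith
  have h2 : quad δ ξ x ^ 2 * ∑ j, pd j (disc v m) x ^ 2
      = 4 * ∑ j, (∑ i, tfHess v m i j x *
          (quad δ ξ x * pd i v x - 2 * v x * (x i - ξ i))) ^ 2 := by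
    rw [Finset.mul_sum, Finset.mul_sum]
    refine Finset.sum_congr rfl fun j _ => ?_
    rw [← mul_pow, quad_mul_pd_disc hv hm heq]
    ring
  have hn' : (0 : ℝ) ≤ n - 1 := by
    have : (2 : ℝ) ≤ n := by exact_mod_cast hn
    linarith
  have hT := tfHessSq_nonneg (v := v) (m := m) x
  have h3 : quad δ ξ x ^ 2 * (n * ∑ j, pd j (disc v m) x ^ 2)
      ≤ quad δ ξ x ^ 2 * (4 * (n - 1) * (tfHessSq v m x * disc v m x)) := by
    calc _ = 4 * (n * ∑ j, (∑ i, tfHess v m i j x *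
          (quad δ ξ x * pd i v x - 2 * v x * (x i - ξ i))) ^ 2) := by
            rw [mul_left_comm, h2]; ring
      _ ≤ 4 * ((n - 1) * tfHessSq v m x * (quad δ ξ x ^ 2 * disc v m x)) := by
            refine mul_le_mul_of_nonneg_left (hK.trans ?_) (by norm_num)
            exact mul_le_mul_of_nonneg_left h1 (mul_nonneg hn' hT)
      _ = _ := by ring
  exact le_of_mul_le_mul_left h3 (by positivity)

end ConformalHessian

section Hardy

lemma hasDerivAt_max_zero_sq (t : ℝ) :
    HasDerivAt (fun t : ℝ => max t 0 ^ 2) (2 * max t 0) t := by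
  rcases lt_trichotomy t 0 with h | h | h
  · have h1 : (fun t : ℝ => max t 0 ^ 2) =ᶠ[𝓝 t] fun _ => 0 := by
      filter_upwards [gt_mem_nhds h] with y hy
      simp [max_eq_right hy.le]
    simpa [max_eq_right h.le] using (hasDerivAt_const t (0 : ℝ)).congr_of_eventuallyEq h1
  · subst h
    rw [hasDerivAt_iff_isLittleO]
    have h2 : (fun y : ℝ => y ^ 2) =o[𝓝 0] fun y => y := by
      simpa using Asymptotics.isLittleO_pow_pow (𝕜 := ℝ) (m := 1) (n := 2) (by norm_num)
    simp only [max_self, sub_zero, mul_zero, smul_zero, ne_eq, OfNat.ofNat_ne_zero,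
      not_false_eq_true, zero_pow]
    refine Asymptotics.IsBigO.trans_isLittleO (Asymptotics.IsBigO.of_bound 1 ?_) h2
    refine Eventually.of_forall fun y => ?_
    rw [Real.norm_of_nonneg (by positivity), Real.norm_of_nonneg (by positivity), one_mul,
      ← sq_abs y]
    gcongr
    exact max_le (le_abs_self y) (abs_nonneg y)
  · have h1 : (fun t : ℝ => max t 0 ^ 2) =ᶠ[𝓝 t] fun t => t ^ 2 := by
      filter_upwards [lt_mem_nhds h] with y hy
      simp [max_eq_left hy.le]
    simpa [max_eq_left h.le] using (hasDerivAt_pow 2 t).congr_of_eventuallyEq h1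

lemma contDiff_max_zero_sq : ContDiff ℝ 1 fun t : ℝ => max t 0 ^ 2 := by
  rw [contDiff_one_iff_deriv]
  refine ⟨fun t => (hasDerivAt_max_zero_sq t).differentiableAt, ?_⟩
  rw [show deriv (fun t : ℝ => max t 0 ^ 2) = fun t => 2 * max t 0 from
    funext fun t => (hasDerivAt_max_zero_sq t).deriv]
  fun_prop

variable {n : ℕ} {δ : ℝ} {ξ : EuclideanSpace ℝ (Fin n)} {φ : EuclideanSpace ℝ (Fin n) → ℝ}

lemma hardy_truncated (hn : 3 ≤ n) (hδ : 0 < δ) (hφ : Smooth φ)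
    (hdecay : Tendsto φ (cocompact _) (𝓝 0))
    (hint : Integrable (fun x => ‖fderiv ℝ φ x‖ ^ 2)) {ε : ℝ} (hε : 0 < ε) :
    Integrable (fun x => max (φ x - ε) 0 ^ 2 / quad δ ξ x) ∧
      ∫ x, max (φ x - ε) 0 ^ 2 / quad δ ξ x ≤ 4 * ∫ x, ‖fderiv ℝ φ x‖ ^ 2 := by
  have hq : ∀ x, 0 < quad δ ξ x := quad_pos hδ
  have hqd : Smooth fun x => (quad δ ξ x)⁻¹ := smooth_quad.inv fun x => (hq x).ne'
  set K : EuclideanSpace ℝ (Fin n) → ℝ := fun x => max (φ x - ε) 0 ^ 2 with hK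
  have hKsupp : HasCompactSupport K := by
    have h1 : ∀ᶠ x in cocompact (EuclideanSpace ℝ (Fin n)), φ x < ε :=
      hdecay.eventually (gt_mem_nhds hε)
    obtain ⟨S, hS, hSs⟩ := mem_cocompact.1 h1
    refine HasCompactSupport.intro hS fun x hx => ?_
    have : φ x < ε := hSs hx
    simp [hK, max_eq_right (sub_nonpos.2 this.le)]
  have hK1 : ContDiff ℝ 1 K :=
    contDiff_max_zero_sq.comp ((hφ.of_le (by simp)).sub contDiff_const)
  have hKd : ∀ i x, pd i K x = 2 * max (φ x - ε) 0 * pd i φ x := fun i x =>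
    (pd_comp (h := fun t => max (t - ε) 0 ^ 2)
      (by simpa using (hasDerivAt_max_zero_sq (φ x - ε)).comp_sub_const (φ x) ε)
      hφ.differentiable i)
  have hKi : Integrable fun x => K x / quad δ ξ x := by
    refine Continuous.integrable_of_hasCompactSupport
      (hK1.continuous.div smooth_quad.continuous fun x => (hq x).ne') ?_
    simp_rw [div_eq_mul_inv]
    exact hKsupp.mul_right
  refine ⟨hKi, ?_⟩
  set F : Fin n → EuclideanSpace ℝ (Fin n) → ℝ :=
    fun i x => K x * ((x i - ξ i) * (quad δ ξ x)⁻¹) with hF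
  have hFs : ∀ i, HasCompactSupport (F i) := fun i => hKsupp.mul_right
  have hF1 : ∀ i, ContDiff ℝ 1 (F i) := fun i =>
    hK1.mul (((smooth_coord i).mul hqd).of_le (by simp))
  have hFint : ∀ i, Integrable (pd i (F i)) := fun i =>
    ((hF1 i).continuous_fderiv (by simp)).clm_apply continuous_const
      |>.integrable_of_hasCompactSupport ((hFs i).fderiv_apply (𝕜 := ℝ) _)
  have hdiv : ∫ x, ∑ i, pd i (F i) x = 0 := by
    rw [integral_finsetSum _ fun i _ => hFint i]
    exact Finset.sum_eq_zero fun i _ => integral_pd_eq_zero (hF1 i) (hFs i) i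
  have hpt : ∀ x, K x / quad δ ξ x - 4 * ‖fderiv ℝ φ x‖ ^ 2 ≤ 2 * ∑ i, pd i (F i) x := by
    intro x
    have hqx := hq x
    have hinv : ∀ i, pd i (fun x => (quad δ ξ x)⁻¹) x
        = -((quad δ ξ x) ^ 2)⁻¹ * (2 * (x i - ξ i)) := fun i => by
      rw [pd_comp (h := fun t => t⁻¹) (hasDerivAt_inv hqx.ne') smooth_quad.differentiable,
        pd_quad]
    have hFd : ∀ i, pd i (F i) x = K x * (quad δ ξ x)⁻¹
        - 2 * (K x * ((quad δ ξ x) ^ 2)⁻¹) * (x i - ξ i) ^ 2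
        + 2 * max (φ x - ε) 0 * (quad δ ξ x)⁻¹ * ((x i - ξ i) * pd i φ x) := fun i => by
      have hyq : Smooth fun x => (x i - ξ i) * (quad δ ξ x)⁻¹ := (smooth_coord i).mul hqd
      simp only [hF]
      rw [pd_mul (hK1.differentiable (by simp)) hyq.differentiable,
        pd_mul (smooth_coord i).differentiable hqd.differentiable, hinv, pd_coord, hKd]
      simp
      ring
    simp only [hFd, Finset.sum_add_distrib, Finset.sum_sub_distrib, ← Finset.mul_sum]
    have hr : ∑ i, (x i - ξ i) ^ 2 ≤ quad δ ξ x := by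
      rw [quad_eq_sum]; nlinarith [sq_nonneg δ]
    have hcs : (∑ i, (x i - ξ i) * pd i φ x) ^ 2 ≤ quad δ ξ x * ‖fderiv ℝ φ x‖ ^ 2 :=
      (Finset.sum_mul_sq_le_sq_mul_sq _ _ _).trans
        (mul_le_mul hr (sum_sq_pd_le x) (by positivity) hqx.le)
    set d := ∑ i, (x i - ξ i) * pd i φ x
    set r := ∑ i, (x i - ξ i) ^ 2
    set q := quad δ ξ x
    set p := max (φ x - ε) 0
    have hKx : K x = p ^ 2 := rfl
    have hn' : (3 : ℝ) ≤ n := by exact_mod_cast hn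
    have h1 : K x * (q ^ 2)⁻¹ * r ≤ p ^ 2 / q := by
      rw [hKx, mul_assoc, div_eq_mul_inv]
      have : (q ^ 2)⁻¹ * r ≤ q⁻¹ := by
        rw [inv_mul_le_iff₀ (by positivity), sq, mul_assoc, mul_inv_cancel₀ hqx.ne', mul_one]
        exact hr
      gcongr
    have h2 : -(p ^ 2 / q + 4 * ‖fderiv ℝ φ x‖ ^ 2) ≤ 4 * (p * q⁻¹ * d) := by
      have h3 : d ^ 2 / q ≤ ‖fderiv ℝ φ x‖ ^ 2 := by
        rw [div_le_iff₀ hqx, mul_comm]; exact hcs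
      have h4 : 0 ≤ (p + 2 * d) ^ 2 / q := by positivity
      have h5 : (p + 2 * d) ^ 2 / q = p ^ 2 / q + 4 * (p * q⁻¹ * d) + 4 * (d ^ 2 / q) := by
        field_simp; ring
      linarith
    simp only [Finset.sum_const, Finset.card_univ, Fintype.card_fin, nsmul_eq_mul]
    have h6 : K x * q⁻¹ = p ^ 2 / q := by rw [hKx, div_eq_mul_inv]
    have h7 : 3 * (p ^ 2 / q) ≤ n * (p ^ 2 / q) :=
      mul_le_mul_of_nonneg_right hn' (by positivity)
    rw [mul_left_comm, h6]
    rw [hKx]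
    rw [hKx] at h1
    linarith
  have h1 : Integrable fun x => K x / quad δ ξ x - 4 * ‖fderiv ℝ φ x‖ ^ 2 :=
    hKi.sub (hint.const_mul 4)
  have h2 := integral_mono h1 ((integrable_finsetSum _ fun i _ => hFint i).const_mul 2) hpt
  rw [integral_sub hKi (hint.const_mul 4), integral_const_mul, integral_const_mul, hdiv] at h2
  linarith

lemma integrable_posPart_sq_div_quad (hn : 3 ≤ n) (hδ : 0 < δ) (hφ : Smooth φ)
    (hdecay : Tendsto φ (cocompact _) (𝓝 0))
    (hint : Integrable (fun x => ‖fderiv ℝ φ x‖ ^ 2)) :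
    Integrable fun x => max (φ x) 0 ^ 2 / quad δ ξ x := by
  have hq : ∀ x, 0 < quad δ ξ x := quad_pos hδ
  have hc : Continuous fun x => max (φ x) 0 ^ 2 / quad δ ξ x :=
    ((hφ.continuous.max continuous_const).pow 2).div smooth_quad.continuous fun x => (hq x).ne'
  have hε : ∀ k : ℕ, (0 : ℝ) < 1 / (k + 1) := fun k => Nat.one_div_pos_of_nat
  have hT := fun k => hardy_truncated (ξ := ξ) hn hδ hφ hdecay hint (hε k)
  refine ⟨hc.aestronglyMeasurable, ?_⟩
  rw [hasFiniteIntegral_iff_ofReal (Eventually.of_forall fun x => by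
    have := hq x
    show 0 ≤ max (φ x) 0 ^ 2 / quad δ ξ x
    positivity)]
  have hlim : ∀ x, Tendsto (fun k : ℕ => ENNReal.ofReal
      (max (φ x - 1 / ((k : ℝ) + 1)) 0 ^ 2 / quad δ ξ x)) atTop
      (𝓝 (ENNReal.ofReal (max (φ x) 0 ^ 2 / quad δ ξ x))) := by
    intro x
    have hc : Continuous fun t : ℝ => ENNReal.ofReal (max (φ x - t) 0 ^ 2 / quad δ ξ x) := by
      exact ENNReal.continuous_ofReal.comp (by fun_prop)
    have := (hc.tendsto 0).comp (tendsto_one_div_add_atTop_nhds_zero_nat (𝕜 := ℝ))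
    simpa [Function.comp_def] using this
  calc ∫⁻ x, ENNReal.ofReal (max (φ x) 0 ^ 2 / quad δ ξ x)
      = ∫⁻ x, liminf (fun k : ℕ => ENNReal.ofReal
          (max (φ x - 1 / ((k : ℝ) + 1)) 0 ^ 2 / quad δ ξ x)) atTop :=
        lintegral_congr fun x => (hlim x).liminf_eq.symm
    _ ≤ liminf (fun k : ℕ => ∫⁻ x, ENNReal.ofReal
          (max (φ x - 1 / ((k : ℝ) + 1)) 0 ^ 2 / quad δ ξ x)) atTop :=
        lintegral_liminf_le' fun k => (hT k).1.aemeasurable.ennreal_ofReal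
    _ ≤ ENNReal.ofReal (4 * ∫ x, ‖fderiv ℝ φ x‖ ^ 2) := by
        refine liminf_le_of_frequently_le' (Frequently.of_forall fun k => ?_)
        rw [← ofReal_integral_eq_lintegral_ofReal (hT k).1 (Eventually.of_forall fun x => by
          have := hq x
          show 0 ≤ max (φ x - 1 / ((k : ℝ) + 1)) 0 ^ 2 / quad δ ξ x
          positivity)]
        exact ENNReal.ofReal_le_ofReal (hT k).2
    _ < ⊤ := ENNReal.ofReal_lt_top

/-- The Hardy inequality, in qualitative form. -/
lemma integrable_sq_div_quad (hn : 3 ≤ n) (hδ : 0 < δ) (hφ : Smooth φ)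
    (hdecay : Tendsto φ (cocompact _) (𝓝 0))
    (hint : Integrable (fun x => ‖fderiv ℝ φ x‖ ^ 2)) :
    Integrable fun x => φ x ^ 2 / quad δ ξ x := by
  have h1 := integrable_posPart_sq_div_quad (ξ := ξ) hn hδ hφ hdecay hint
  have h2 := integrable_posPart_sq_div_quad (φ := fun x => -φ x) (ξ := ξ) hn hδ hφ.neg
    (by simpa using hdecay.neg) (by simpa [fderiv_fun_neg] using hint)
  refine (h1.add h2).congr (Eventually.of_forall fun x => ?_)
  simp only [Pi.add_apply, ← add_div]
  congr 1
  rcases le_total (φ x) 0 with h | h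
  · rw [max_eq_right h, max_eq_left (neg_nonneg.2 h)]; ring
  · rw [max_eq_left h, max_eq_right (neg_nonpos.2 h)]; ring

end Hardy

section Energy

variable {n : ℕ} {δ : ℝ} {ξ : EuclideanSpace ℝ (Fin n)} {v m : EuclideanSpace ℝ (Fin n) → ℝ}

/-- The weight of the energy estimate. -/
noncomputable def energyWeight (δ : ℝ) (ξ : EuclideanSpace ℝ (Fin n))
    (x : EuclideanSpace ℝ (Fin n)) : ℝ :=
  quad δ ξ x ^ (2 - (n : ℝ))

lemma energyWeight_pos (hδ : 0 < δ) (x : EuclideanSpace ℝ (Fin n)) : 0 < energyWeight δ ξ x :=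
  Real.rpow_pos_of_pos (quad_pos hδ x) _

lemma smooth_rpow {f : EuclideanSpace ℝ (Fin n) → ℝ} (hf : Smooth f) (hpos : ∀ x, 0 < f x)
    (p : ℝ) : Smooth fun x => f x ^ p :=
  ContDiff.rpow_const_of_ne hf fun x => (hpos x).ne'

lemma pd_rpow {f : EuclideanSpace ℝ (Fin n) → ℝ} (hf : Smooth f) (hpos : ∀ x, 0 < f x)
    (p : ℝ) (i : Fin n) (x : EuclideanSpace ℝ (Fin n)) :
    pd i (fun x => f x ^ p) x = p * f x ^ (p - 1) * pd i f x :=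
  pd_comp (h := fun t => t ^ p) (Real.hasDerivAt_rpow_const (Or.inl (hpos x).ne'))
    hf.differentiable i

lemma divergence_lower_bound (hn : 2 ≤ n) (hδ : 0 < δ) (hv : Smooth v) (hm : Smooth m)
    (htr : ∀ x, ∑ i, pd i (pd i v) x = n * m x)
    (heq : ∀ x, quad δ ξ x * m x = 2 * (∑ i, (x i - ξ i) * pd i v x - v x))
    {γ ε : ℝ} (hγ : 0 ≤ γ) (hε : 0 < ε) {η : EuclideanSpace ℝ (Fin n) → ℝ} (hη : Smooth η)
    (x : EuclideanSpace ℝ (Fin n)) :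
    (2 - 4 * (n - 1) / n * (γ + ε)) * (η x ^ 2 * (energyWeight δ ξ x *
        ((disc v m x + 1) ^ (-γ) * tfHessSq v m x)))
      - ε⁻¹ * (energyWeight δ ξ x * ((disc v m x + 1) ^ (1 - γ) * ∑ j, pd j η x ^ 2))
    ≤ ∑ j, pd j (fun x => (η x * η x) * (energyWeight δ ξ x *
        ((disc v m x + 1) ^ (-γ) * pd j (disc v m) x))) x := by
  have hQ := smooth_disc hv hm
  have hQ0 := disc_nonneg hδ heq
  have hg : Smooth fun x => disc v m x + 1 := hQ.add contDiff_const
  have hgpos : ∀ x, 0 < disc v m x + 1 := fun x => by linarith [hQ0 x]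
  have hgd : ∀ j x, pd j (fun x => disc v m x + 1) x = pd j (disc v m) x := fun j x => by
    rw [pd_add hQ contDiff_const]; simp [pd]
  have hq : ∀ x, 0 < quad δ ξ x := quad_pos hδ
  have hw : Smooth (energyWeight δ ξ) := smooth_rpow smooth_quad hq _
  have hgγ := smooth_rpow hg hgpos (-γ)
  have hdiv : ∀ j, pd j (fun x => (η x * η x) * (energyWeight δ ξ x *
        ((disc v m x + 1) ^ (-γ) * pd j (disc v m) x))) x
      = η x ^ 2 * energyWeight δ ξ x * (disc v m x + 1) ^ (-γ) * pd j (pd j (disc v m)) x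
        - γ * η x ^ 2 * energyWeight δ ξ x * (disc v m x + 1) ^ (-γ - 1) *
          pd j (disc v m) x ^ 2
        - 2 * (n - 2) * η x ^ 2 * quad δ ξ x ^ (1 - (n : ℝ)) * (disc v m x + 1) ^ (-γ) *
          ((x j - ξ j) * pd j (disc v m) x)
        + 2 * η x * energyWeight δ ξ x * (disc v m x + 1) ^ (-γ) *
          (pd j η x * pd j (disc v m) x) := by
    intro j
    have h1 : Smooth fun x => (disc v m x + 1) ^ (-γ) * pd j (disc v m) x := hgγ.mul (hQ.pd j)
    have h2 : Smooth fun x => energyWeight δ ξ x *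
        ((disc v m x + 1) ^ (-γ) * pd j (disc v m) x) := hw.mul h1
    have h3 : Smooth fun x => η x * η x := hη.mul hη
    have h4 : pd j (energyWeight δ ξ) x
        = (2 - n) * quad δ ξ x ^ (1 - (n : ℝ)) * (2 * (x j - ξ j)) := by
      unfold energyWeight
      rw [pd_rpow smooth_quad hq, pd_quad]
      ring_nf
    rw [pd_mul h3.differentiable h2.differentiable, pd_mul hη.differentiable hη.differentiable,
      pd_mul hw.differentiable h1.differentiable,
      pd_mul hgγ.differentiable (hQ.pd j).differentiable, pd_rpow hg hgpos, hgd, h4]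
    ring
  simp only [hdiv, Finset.sum_add_distrib, Finset.sum_sub_distrib, ← Finset.mul_sum]
  have hboch := quad_mul_lap_disc hv hm htr heq x
  have hkato := sum_sq_pd_disc_le hn hδ hv hm htr heq x
  have hcs : (∑ j, pd j η x * pd j (disc v m) x) ^ 2
      ≤ (∑ j, pd j η x ^ 2) * ∑ j, pd j (disc v m) x ^ 2 :=
    Finset.sum_mul_sq_le_sq_mul_sq _ _ _
  have hwq : energyWeight δ ξ x = quad δ ξ x ^ (1 - (n : ℝ)) * quad δ ξ x := by
    rw [energyWeight, ← Real.rpow_add_one (hq x).ne']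
    ring_nf
  have hgg : (disc v m x + 1) ^ (-γ) = (disc v m x + 1) ^ (-γ - 1) * (disc v m x + 1) := by
    rw [← Real.rpow_add_one (hgpos x).ne']
    ring_nf
  have hggg : (disc v m x + 1) ^ (1 - γ)
      = (disc v m x + 1) ^ (-γ - 1) * (disc v m x + 1) ^ 2 := by
    rw [← Real.rpow_add_natCast (hgpos x).ne']
    congr 1
    push_cast
    ring
  have ha : 0 < (disc v m x + 1) ^ (-γ - 1) := Real.rpow_pos_of_pos (hgpos x) _
  have hs1 : 0 < quad δ ξ x ^ (1 - (n : ℝ)) := Real.rpow_pos_of_pos (hq x) _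
  have hqx := hq x
  have hgx := hgpos x
  have hT := tfHessSq_nonneg (v := v) (m := m) x
  have hQx := hQ0 x
  have hn' : (2 : ℝ) ≤ n := by exact_mod_cast hn
  rw [hggg, hgg, hwq]
  set a := (disc v m x + 1) ^ (-γ - 1)
  set s1 := quad δ ξ x ^ (1 - (n : ℝ))
  set q := quad δ ξ x
  set Q := disc v m x
  set T := tfHessSq v m x
  set G := ∑ j, pd j (disc v m) x ^ 2
  set H := ∑ j, pd j η x ^ 2
  set d := ∑ j, pd j η x * pd j (disc v m) x
  set Y := ∑ j, (x j - ξ j) * pd j (disc v m) x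
  set L := ∑ j, pd j (pd j (disc v m)) x
  set e := η x
  have hG0 : 0 ≤ G := by positivity
  have hH0 : 0 ≤ H := by positivity
  have hyoung : -(ε * e ^ 2 * G + ε⁻¹ * ((Q + 1) ^ 2 * H)) ≤ 2 * e * (Q + 1) * d := by
    have h1 : |e * (Q + 1) * d| ≤ Real.sqrt ((e ^ 2 * G) * ((Q + 1) ^ 2 * H)) := by
      apply Real.abs_le_sqrt
      have : 0 ≤ e ^ 2 * (Q + 1) ^ 2 := by positivity
      nlinarith [mul_le_mul_of_nonneg_left hcs this]
    have hA : 0 ≤ e ^ 2 * G := by positivity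
    have hB : 0 ≤ (Q + 1) ^ 2 * H := by positivity
    have h2 : 2 * Real.sqrt ((e ^ 2 * G) * ((Q + 1) ^ 2 * H))
        ≤ ε * (e ^ 2 * G) + ε⁻¹ * ((Q + 1) ^ 2 * H) := by
      have h3 : (e ^ 2 * G) * ((Q + 1) ^ 2 * H)
          ≤ ((ε * (e ^ 2 * G) + ε⁻¹ * ((Q + 1) ^ 2 * H)) / 2) ^ 2 := by
        have h4 : (e ^ 2 * G) * ((Q + 1) ^ 2 * H)
          = (ε * (e ^ 2 * G)) * (ε⁻¹ * ((Q + 1) ^ 2 * H)) := by field_simp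
        rw [h4]
        nlinarith [sq_nonneg (ε * (e ^ 2 * G) - ε⁻¹ * ((Q + 1) ^ 2 * H))]
      have := Real.sqrt_le_sqrt h3
      rw [Real.sqrt_sq (by positivity)] at this
      linarith
    have := neg_abs_le (e * (Q + 1) * d)
    linarith
  have hG : G ≤ 4 * (n - 1) / n * ((Q + 1) * T) := by
    rw [div_mul_eq_mul_div, le_div_iff₀ (by linarith), mul_comm]
    refine hkato.trans ?_
    have : 0 ≤ 4 * ((n : ℝ) - 1) := by linarith
    refine mul_le_mul_of_nonneg_left ?_ this
    nlinarith
  have hcore : (2 - 4 * (n - 1) / n * (γ + ε)) * (e ^ 2 * ((Q + 1) * T))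
      - ε⁻¹ * ((Q + 1) ^ 2 * H)
      ≤ 2 * e ^ 2 * ((Q + 1) * T) - γ * e ^ 2 * G + 2 * e * (Q + 1) * d := by
    have h1 : (γ + ε) * e ^ 2 * G ≤ (γ + ε) * e ^ 2 * (4 * (n - 1) / n * ((Q + 1) * T)) :=
      mul_le_mul_of_nonneg_left hG (by positivity)
    linarith
  have hfin := mul_le_mul_of_nonneg_left hcore (show 0 ≤ a * (s1 * q) by positivity)
  calc _ = a * (s1 * q) * ((2 - 4 * (n - 1) / n * (γ + ε)) * (e ^ 2 * ((Q + 1) * T))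
      - ε⁻¹ * ((Q + 1) ^ 2 * H)) := by ring
    _ ≤ _ := hfin
    _ = _ := by linear_combination (-(a * s1 * e ^ 2 * (Q + 1))) * hboch

lemma energy_inequality (hn : 2 ≤ n) (hδ : 0 < δ) (hv : Smooth v) (hm : Smooth m)
    (htr : ∀ x, ∑ i, pd i (pd i v) x = n * m x)
    (heq : ∀ x, quad δ ξ x * m x = 2 * (∑ i, (x i - ξ i) * pd i v x - v x))
    {γ ε : ℝ} (hγ : 0 ≤ γ) (hε : 0 < ε) {η : EuclideanSpace ℝ (Fin n) → ℝ} (hη : Smooth η)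
    (hηc : HasCompactSupport η) :
    (2 - 4 * (n - 1) / n * (γ + ε)) * ∫ x, η x ^ 2 * (energyWeight δ ξ x *
        ((disc v m x + 1) ^ (-γ) * tfHessSq v m x))
      ≤ ε⁻¹ * ∫ x, energyWeight δ ξ x * ((disc v m x + 1) ^ (1 - γ) * ∑ j, pd j η x ^ 2) := by
  have hQ := smooth_disc hv hm
  have hQ0 := disc_nonneg hδ heq
  have hg : Smooth fun x => disc v m x + 1 := hQ.add contDiff_const
  have hgpos : ∀ x, 0 < disc v m x + 1 := fun x => by linarith [hQ0 x]
  have hw : Smooth (energyWeight δ ξ) := smooth_rpow smooth_quad (quad_pos hδ) _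
  have hgγ := smooth_rpow hg hgpos
  set F : Fin n → EuclideanSpace ℝ (Fin n) → ℝ := fun j x => (η x * η x) *
    (energyWeight δ ξ x * ((disc v m x + 1) ^ (-γ) * pd j (disc v m) x)) with hF
  have hFs : ∀ j, HasCompactSupport (F j) := fun j => hηc.mul_right.mul_right
  have hF1 : ∀ j, ContDiff ℝ 1 (F j) := fun j =>
    ContDiff.of_le ((hη.mul hη).mul (hw.mul ((hgγ (-γ)).mul (hQ.pd j)))) (by simp)
  have hFint : ∀ j, Integrable (pd j (F j)) := fun j =>
    ((hF1 j).continuous_fderiv (by simp)).clm_apply continuous_const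
      |>.integrable_of_hasCompactSupport ((hFs j).fderiv_apply (𝕜 := ℝ) _)
  have hdiv : ∫ x, ∑ j, pd j (F j) x = 0 := by
    rw [integral_finsetSum _ fun i _ => hFint i]
    exact Finset.sum_eq_zero fun i _ => integral_pd_eq_zero (hF1 i) (hFs i) i
  have hA : Integrable fun x => η x ^ 2 * (energyWeight δ ξ x *
        ((disc v m x + 1) ^ (-γ) * tfHessSq v m x)) := by
    refine Continuous.integrable_of_hasCompactSupport ((hη.continuous.pow 2).mul
      (hw.continuous.mul ((hgγ (-γ)).continuous.mul (continuous_tfHessSq hv hm)))) ?_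
    simp_rw [sq (η _)]
    exact hηc.mul_right.mul_right
  have hB : Integrable fun x => energyWeight δ ξ x *
      ((disc v m x + 1) ^ (1 - γ) * ∑ j, pd j η x ^ 2) := by
    refine Continuous.integrable_of_hasCompactSupport (hw.continuous.mul
      ((hgγ (1 - γ)).continuous.mul
        (continuous_finsetSum _ fun j _ => (hη.pd j).continuous.pow 2))) ?_
    refine HasCompactSupport.mul_left (HasCompactSupport.mul_left ?_)
    refine HasCompactSupport.intro hηc.isCompact fun x hx => ?_
    refine Finset.sum_eq_zero fun j _ => ?_
    have : fderiv ℝ η x = 0 := by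
      by_contra h
      exact hx (support_fderiv_subset ℝ h)
    simp [pd, this]
  have h := integral_mono ((hA.const_mul _).sub (hB.const_mul _))
    (integrable_finsetSum _ fun i _ => hFint i)
    (divergence_lower_bound hn hδ hv hm htr heq hγ hε hη)
  rw [hdiv] at h
  simp only [Pi.sub_apply] at h
  rw [integral_sub (hA.const_mul _) (hB.const_mul _), integral_const_mul, integral_const_mul] at h
  linarith

end Energy

section Cutoff

variable {n : ℕ} {δ : ℝ} {ξ : EuclideanSpace ℝ (Fin n)} {v m : EuclideanSpace ℝ (Fin n) → ℝ}

lemma deriv_smoothTransition_eq_zero {t : ℝ} (ht : t ≤ 0 ∨ 1 ≤ t) :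
    deriv Real.smoothTransition t = 0 := by
  rcases ht with h | h
  · refine IsLocalMin.deriv_eq_zero (Eventually.of_forall fun y => ?_)
    rw [Real.smoothTransition.zero_of_nonpos h]
    exact Real.smoothTransition.nonneg y
  · refine IsLocalMax.deriv_eq_zero (Eventually.of_forall fun y => ?_)
    rw [Real.smoothTransition.one_of_one_le h]
    exact Real.smoothTransition.le_one y

lemma exists_deriv_smoothTransition_bound :
    ∃ B : ℝ, ∀ t, deriv Real.smoothTransition t ^ 2 ≤ B := by
  have hc : Continuous (deriv Real.smoothTransition) :=
    (Real.smoothTransition.contDiff (n := 1)).continuous_deriv (by simp)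
  obtain ⟨B, hB⟩ := (isCompact_Icc (a := (0 : ℝ)) (b := 1)).bddAbove_image (hc.pow 2).continuousOn
  refine ⟨max B 0, fun t => ?_⟩
  by_cases ht : t ≤ 0 ∨ 1 ≤ t
  · simp [deriv_smoothTransition_eq_zero ht]
  · push Not at ht
    exact le_max_of_le_left (hB ⟨t, ⟨ht.1.le, ht.2.le⟩, rfl⟩)

/-- A smooth cutoff equal to one where `quad ≤ R²` and to zero where `quad ≥ 2 R²`. -/
noncomputable def cutoff (δ : ℝ) (ξ : EuclideanSpace ℝ (Fin n)) (R : ℝ)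
    (x : EuclideanSpace ℝ (Fin n)) : ℝ :=
  Real.smoothTransition (2 - (R ^ 2)⁻¹ * quad δ ξ x)

lemma smooth_cutoff (R : ℝ) : Smooth (cutoff δ ξ R) :=
  Real.smoothTransition.contDiff.comp (contDiff_const.sub (contDiff_const.mul smooth_quad))

lemma hasCompactSupport_cutoff {R : ℝ} (hR : 0 < R) : HasCompactSupport (cutoff δ ξ R) := by
  refine HasCompactSupport.intro (isCompact_closedBall ξ (2 * R)) fun x hx => ?_
  refine Real.smoothTransition.zero_of_nonpos ?_
  rw [Metric.mem_closedBall, dist_eq_norm, not_le] at hx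
  have : 2 * R ^ 2 ≤ quad δ ξ x := by
    unfold quad; nlinarith [sq_nonneg δ]
  rw [sub_nonpos, inv_mul_eq_div, le_div_iff₀ (by positivity)]
  exact this

lemma sum_sq_pd_cutoff (R : ℝ) (x : EuclideanSpace ℝ (Fin n)) :
    ∑ j, pd j (cutoff δ ξ R) x ^ 2
      = deriv Real.smoothTransition (2 - (R ^ 2)⁻¹ * quad δ ξ x) ^ 2
        * (4 * ((R ^ 2)⁻¹) ^ 2 * ∑ j, (x j - ξ j) ^ 2) := by
  have h1 : Smooth fun x => (R ^ 2)⁻¹ * quad δ ξ x := contDiff_const.mul smooth_quad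
  have h2 : Smooth fun x => 2 - (R ^ 2)⁻¹ * quad δ ξ x := contDiff_const.sub h1
  have hd : ∀ j, pd j (cutoff δ ξ R) x
      = deriv Real.smoothTransition (2 - (R ^ 2)⁻¹ * quad δ ξ x)
        * (-((R ^ 2)⁻¹ * (2 * (x j - ξ j)))) := by
    intro j
    unfold cutoff
    rw [pd_comp (h := Real.smoothTransition)
      ((Real.smoothTransition.contDiff (n := 1)).differentiable (by simp) _).hasDerivAt
      h2.differentiable, pd_sub contDiff_const h1, pd_const_mul smooth_quad, pd_quad]
    simp [pd]
  simp only [hd, Finset.mul_sum]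
  exact Finset.sum_congr rfl fun j _ => by ring

lemma rpow_le_one_add {t p : ℝ} (ht : 0 ≤ t) (hp0 : 0 ≤ p) (hp1 : p ≤ 1) : t ^ p ≤ 1 + t := by
  rcases le_total t 1 with h | h
  · linarith [Real.rpow_le_one ht h hp0]
  · have := Real.rpow_le_rpow_of_exponent_le h hp1
    rw [Real.rpow_one] at this
    linarith

lemma cutoff_energy_bound (hn : 2 ≤ n) (hδ : 0 < δ) {g e : EuclideanSpace ℝ (Fin n) → ℝ}
    {C γ : ℝ} (hC : 0 ≤ C) (hγ0 : 0 ≤ γ) (hγ1 : γ ≤ 1) (hg : ∀ x, 0 ≤ g x) (he : ∀ x, 0 ≤ e x)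
    (hei : Integrable e) (hge : ∀ x, g x ≤ 1 + C * (quad δ ξ x ^ n * e x)) :
    ∃ C' : ℝ, ∀ R : ℝ, 1 ≤ R →
      ∫ x, energyWeight δ ξ x * (g x ^ (1 - γ) * ∑ j, pd j (cutoff δ ξ R) x ^ 2)
        ≤ C' * R ^ (2 - n * γ) := by
  obtain ⟨B, hB⟩ := exists_deriv_smoothTransition_bound
  have hB0 : 0 ≤ B := (sq_nonneg _).trans (hB 0)
  set V := volume.real (Metric.ball (0 : EuclideanSpace ℝ (Fin n)) 1)
  refine ⟨8 * B * 2 ^ n * (2 * V + C * ∫ x, e x), fun R hR => ?_⟩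
  have hR0 : 0 < R := by linarith
  set A : ℝ := 8 * B * R ^ (2 - n - n * γ) with hA
  have hA0 : 0 ≤ A := by positivity
  set S := Metric.closedBall ξ (2 * R) with hS
  set dom : EuclideanSpace ℝ (Fin n) → ℝ :=
    fun x => A * (S.indicator (fun _ => (2 : ℝ)) x + C * 2 ^ n * R ^ n * e x) with hdom
  have hSi : Integrable (S.indicator fun _ : EuclideanSpace ℝ (Fin n) => (2 : ℝ)) :=
    (integrable_indicator_iff Metric.isClosed_closedBall.measurableSet).2
      (integrableOn_const (isCompact_closedBall _ _).measure_lt_top.ne)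
  have hdomi : Integrable dom := (hSi.add (hei.const_mul _)).const_mul A
  have hle : ∀ x, energyWeight δ ξ x * (g x ^ (1 - γ) * ∑ j, pd j (cutoff δ ξ R) x ^ 2)
      ≤ dom x := by
    intro x
    have hind : 0 ≤ S.indicator (fun _ => (2 : ℝ)) x := Set.indicator_nonneg (by simp) x
    have hdom0 : 0 ≤ dom x := by
      have := he x
      simp only [hdom]; positivity
    rw [sum_sq_pd_cutoff]
    by_cases ht : 2 - (R ^ 2)⁻¹ * quad δ ξ x ≤ 0 ∨ 1 ≤ 2 - (R ^ 2)⁻¹ * quad δ ξ x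
    · rw [deriv_smoothTransition_eq_zero ht]
      simpa using hdom0
    push Not at ht
    have hq1 : R ^ 2 ≤ quad δ ξ x := by
      have : 1 ≤ (R ^ 2)⁻¹ * quad δ ξ x := by linarith [ht.2]
      rwa [inv_mul_eq_div, le_div_iff₀ (by positivity), one_mul] at this
    have hq2 : quad δ ξ x ≤ 2 * R ^ 2 := by
      have : (R ^ 2)⁻¹ * quad δ ξ x ≤ 2 := by linarith [ht.1]
      rwa [inv_mul_eq_div, div_le_iff₀ (by positivity)] at this
    have hxS : x ∈ S := by
      rw [hS, Metric.mem_closedBall, dist_eq_norm]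
      refine abs_le_of_sq_le_sq' ?_ (by positivity) |>.2
      have : ‖x - ξ‖ ^ 2 ≤ quad δ ξ x := by unfold quad; nlinarith [sq_nonneg δ]
      nlinarith
    have hq0 := quad_pos (ξ := ξ) hδ x
    have hr : ∑ j, (x j - ξ j) ^ 2 ≤ 2 * R ^ 2 := by
      rw [quad_eq_sum] at hq2; nlinarith [sq_nonneg δ]
    have hw : energyWeight δ ξ x ≤ R ^ (4 - 2 * (n : ℝ)) := by
      have hn' : (2 : ℝ) ≤ n := by exact_mod_cast hn
      calc energyWeight δ ξ x ≤ (R ^ 2) ^ (2 - (n : ℝ)) :=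
            Real.rpow_le_rpow_of_nonpos (by positivity) hq1 (by linarith)
        _ = R ^ (4 - 2 * (n : ℝ)) := by
            rw [← Real.rpow_natCast, ← Real.rpow_mul hR0.le]
            congr 1; push_cast; ring
    have hcut : deriv Real.smoothTransition (2 - (R ^ 2)⁻¹ * quad δ ξ x) ^ 2
        * (4 * ((R ^ 2)⁻¹) ^ 2 * ∑ j, (x j - ξ j) ^ 2) ≤ 8 * B * R ^ (-2 : ℝ) := by
      calc _ ≤ B * (4 * ((R ^ 2)⁻¹) ^ 2 * (2 * R ^ 2)) := by
            gcongr
            exact hB _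
        _ = 8 * B * R ^ (-2 : ℝ) := by
            rw [Real.rpow_neg hR0.le, Real.rpow_ofNat]
            field_simp
            ring
    have hgx : g x ^ (1 - γ) ≤ R ^ (n - n * γ) * (2 + C * 2 ^ n * R ^ n * e x) := by
      have hRn : (1 : ℝ) ≤ R ^ n := one_le_pow₀ hR
      have h1 : g x / R ^ n ≤ 1 + C * 2 ^ n * R ^ n * e x := by
        rw [div_le_iff₀ (by positivity)]
        have h2 : quad δ ξ x ^ n ≤ (2 * R ^ 2) ^ n := by gcongr
        have h3 : C * (quad δ ξ x ^ n * e x) ≤ C * ((2 * R ^ 2) ^ n * e x) := by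
          have := he x
          gcongr
        have h4 : C * ((2 * R ^ 2) ^ n * e x) = C * 2 ^ n * R ^ n * e x * R ^ n := by
          rw [mul_pow, ← pow_mul, mul_comm 2 n, pow_mul, sq]; ring
        linarith [hge x]
      calc g x ^ (1 - γ) = (R ^ n * (g x / R ^ n)) ^ (1 - γ) := by
            congr 1; field_simp
        _ = (R ^ n) ^ (1 - γ) * (g x / R ^ n) ^ (1 - γ) :=
            Real.mul_rpow (by positivity) (div_nonneg (hg x) (by positivity))
        _ ≤ (R ^ n) ^ (1 - γ) * (1 + g x / R ^ n) := by
            gcongr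
            exact rpow_le_one_add (div_nonneg (hg x) (by positivity)) (by linarith) (by linarith)
        _ ≤ (R ^ n) ^ (1 - γ) * (2 + C * 2 ^ n * R ^ n * e x) :=
            mul_le_mul_of_nonneg_left (by linarith) (by positivity)
        _ = _ := by
            rw [← Real.rpow_natCast R n, ← Real.rpow_mul hR0.le]
            congr 2; ring
    have hex := he x
    calc energyWeight δ ξ x * (g x ^ (1 - γ) *
          (deriv Real.smoothTransition (2 - (R ^ 2)⁻¹ * quad δ ξ x) ^ 2
            * (4 * ((R ^ 2)⁻¹) ^ 2 * ∑ j, (x j - ξ j) ^ 2)))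
        ≤ R ^ (4 - 2 * (n : ℝ)) * ((R ^ (n - n * γ) * (2 + C * 2 ^ n * R ^ n * e x)) *
          (8 * B * R ^ (-2 : ℝ))) := by
          have := Real.rpow_nonneg (hg x) (1 - γ)
          gcongr
      _ = 8 * B * (R ^ (4 - 2 * (n : ℝ)) * R ^ (n - n * γ) * R ^ (-2 : ℝ)) *
          (2 + C * 2 ^ n * R ^ n * e x) := by ring
      _ = dom x := by
          rw [← Real.rpow_add hR0, ← Real.rpow_add hR0]
          simp only [hdom, hA, Set.indicator_of_mem hxS]
          congr 3
          ring
  have hnn : ∀ x, 0 ≤ energyWeight δ ξ x * (g x ^ (1 - γ) * ∑ j, pd j (cutoff δ ξ R) x ^ 2) :=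
    fun x => by
      have := energyWeight_pos (ξ := ξ) hδ x
      have := Real.rpow_nonneg (hg x) (1 - γ)
      positivity
  refine (integral_mono_of_nonneg (Eventually.of_forall hnn) hdomi
    (Eventually.of_forall hle)).trans_eq ?_
  rw [hdom, integral_const_mul, integral_add hSi (hei.const_mul _), integral_const_mul,
    integral_indicator_const _ Metric.isClosed_closedBall.measurableSet,
    Measure.addHaar_real_closedBall _ _ (by positivity), finrank_euclideanSpace_fin]
  have hpow : R ^ (2 - n - n * γ) * R ^ n = R ^ (2 - n * γ) := by
    rw [← Real.rpow_natCast, ← Real.rpow_add hR0]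
    congr 1; ring
  rw [hA, ← hpow, mul_pow, smul_eq_mul]
  ring

lemma exists_exponents (hn : 3 ≤ n) : ∃ γ ε : ℝ, 2 < n * γ ∧ 0 ≤ γ ∧ γ ≤ 1 ∧ 0 < ε ∧
    0 < 2 - 4 * ((n : ℝ) - 1) / n * (γ + ε) := by
  have hn' : (3 : ℝ) ≤ n := by exact_mod_cast hn
  have hn1 : (0 : ℝ) < n - 1 := by linarith
  have hn2 : (0 : ℝ) < n - 2 := by linarith
  have hn0 : (0 : ℝ) < n := by linarith
  have hgap : 0 < ((n : ℝ) - 2) ^ 2 / (2 * n * (n - 1)) := by positivity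
  set b := ((n : ℝ) - 2) ^ 2 / (2 * n * (n - 1)) with hb
  have h1 : (n : ℝ) * (2 / n + b / 3) = 2 + n * b / 3 := by field_simp
  have h2 : 4 * ((n : ℝ) - 1) / n * (2 / n + b / 3 + b / 3)
      = 2 - 4 * ((n : ℝ) - 1) / n * (b / 3) := by
    rw [hb]; field_simp; ring
  have h3 : 0 < 4 * ((n : ℝ) - 1) / n * (b / 3) := by positivity
  refine ⟨2 / n + b / 3, b / 3, ?_, by positivity, ?_, by positivity, ?_⟩
  · rw [h1]
    have : 0 < n * b / 3 := by positivity
    linarith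
  · have h4 : 4 * ((n : ℝ) - 1) / n * (2 / n + b / 3) ≤ 2 := by
      rw [mul_add] at h2
      linarith
    have h5 : 2 ≤ 4 * ((n : ℝ) - 1) / n := by
      rw [le_div_iff₀ hn0]; linarith
    by_contra h
    push Not at h
    nlinarith
  · rw [h2]; linarith

lemma tfHessSq_eq_zero (hn : 3 ≤ n) (hδ : 0 < δ) (hv : Smooth v) (hm : Smooth m)
    (htr : ∀ x, ∑ i, pd i (pd i v) x = n * m x)
    (heq : ∀ x, quad δ ξ x * m x = 2 * (∑ i, (x i - ξ i) * pd i v x - v x))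
    {e : EuclideanSpace ℝ (Fin n) → ℝ} {C : ℝ} (hC : 0 ≤ C) (he : ∀ x, 0 ≤ e x)
    (hei : Integrable e) (hde : ∀ x, disc v m x ≤ C * (quad δ ξ x ^ n * e x))
    (x₀ : EuclideanSpace ℝ (Fin n)) : tfHessSq v m x₀ = 0 := by
  obtain ⟨γ, ε, hγ2, hγ0, hγ1, hε, hc⟩ := exists_exponents hn
  have hQ0 := disc_nonneg hδ heq
  have hgpos : ∀ x, 0 < disc v m x + 1 := fun x => by linarith [hQ0 x]
  obtain ⟨C', hC'⟩ := cutoff_energy_bound (by omega) hδ hC hγ0 hγ1 (fun x => (hgpos x).le) he hei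
    fun x => by linarith [hde x]
  set h : EuclideanSpace ℝ (Fin n) → ℝ := fun x => energyWeight δ ξ x *
    ((disc v m x + 1) ^ (-γ) * tfHessSq v m x) with hh
  have hpos : ∀ x, 0 < energyWeight δ ξ x * (disc v m x + 1) ^ (-γ) := fun x =>
    mul_pos (energyWeight_pos hδ x) (Real.rpow_pos_of_pos (hgpos x) _)
  have hh0 : ∀ x, 0 ≤ h x := fun x => by
    simp only [hh, ← mul_assoc]
    exact mul_nonneg (hpos x).le (tfHessSq_nonneg x)
  have hhc : Continuous h :=
    (smooth_rpow smooth_quad (quad_pos hδ) _).continuous.mul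
      ((smooth_rpow ((smooth_disc hv hm).add contDiff_const) hgpos _).continuous.mul
        (continuous_tfHessSq hv hm))
  have hfc : ∀ R, Continuous fun x => cutoff δ ξ R x ^ 2 * h x := fun R =>
    ((smooth_cutoff R).continuous.pow 2).mul hhc
  have hfs : ∀ R : ℝ, 0 < R → HasCompactSupport fun x => cutoff δ ξ R x ^ 2 * h x := by
    intro R hR
    simp_rw [sq (cutoff δ ξ R _)]
    exact (hasCompactSupport_cutoff hR).mul_right.mul_right
  have hbound : ∀ R : ℝ, 1 ≤ R → ∫ x, cutoff δ ξ R x ^ 2 * h x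
      ≤ (2 - 4 * ((n : ℝ) - 1) / n * (γ + ε))⁻¹ * (ε⁻¹ * (C' * R ^ (2 - n * γ))) := by
    intro R hR
    rw [le_inv_mul_iff₀ hc]
    refine (energy_inequality (by omega) hδ hv hm htr heq hγ0 hε (smooth_cutoff R)
      (hasCompactSupport_cutoff (by linarith))).trans ?_
    exact mul_le_mul_of_nonneg_left (hC' R hR) (by positivity)
  have hlim : Tendsto (fun R : ℝ => (2 - 4 * ((n : ℝ) - 1) / n * (γ + ε))⁻¹ *
      (ε⁻¹ * (C' * R ^ (2 - n * γ)))) atTop (𝓝 0) := by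
    have h1 : Tendsto (fun R : ℝ => R ^ (-(n * γ - 2))) atTop (𝓝 0) :=
      tendsto_rpow_neg_atTop (by linarith)
    simpa using ((h1.const_mul C').const_mul ε⁻¹).const_mul
      (2 - 4 * ((n : ℝ) - 1) / n * (γ + ε))⁻¹
  have hq0 := quad_pos (ξ := ξ) hδ x₀
  set r := Real.sqrt (quad δ ξ x₀) with hr
  have hr0 : 0 < r := Real.sqrt_pos.2 hq0
  have hrx : cutoff δ ξ r x₀ = 1 := by
    refine Real.smoothTransition.one_of_one_le ?_
    rw [hr, Real.sq_sqrt hq0.le, inv_mul_cancel₀ hq0.ne']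
    norm_num
  have hmono : ∀ R : ℝ, 2 * r ≤ R →
      ∫ x, cutoff δ ξ r x ^ 2 * h x ≤ ∫ x, cutoff δ ξ R x ^ 2 * h x := by
    intro R hR
    refine integral_mono ((hfc r).integrable_of_hasCompactSupport (hfs r hr0))
      ((hfc R).integrable_of_hasCompactSupport (hfs R (by linarith))) fun x => ?_
    refine mul_le_mul_of_nonneg_right ?_ (hh0 x)
    refine pow_le_pow_left₀ (Real.smoothTransition.nonneg _) ?_ 2
    refine Real.smoothTransition.monotone ?_
    have := quad_pos (ξ := ξ) hδ x
    have : r ≤ R := by linarith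
    gcongr
  have hzero : ∫ x, cutoff δ ξ r x ^ 2 * h x ≤ 0 :=
    ge_of_tendsto hlim (by
      filter_upwards [eventually_ge_atTop (2 * r), eventually_ge_atTop 1] with R h1 h2
      exact (hmono R h1).trans (hbound R h2))
  by_contra hne
  refine (Continuous.integral_pos_of_hasCompactSupport_nonneg_nonzero (μ := volume) (x := x₀)
    (hfc r) (hfs r hr0) (fun x => mul_nonneg (sq_nonneg _) (hh0 x)) ?_).not_ge hzero
  rw [hrx, one_pow, one_mul]
  simp only [hh, ← mul_assoc]
  exact mul_ne_zero (hpos x₀).ne' hne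

end Cutoff

section Classification

variable {n : ℕ} {δ : ℝ} {ξ : EuclideanSpace ℝ (Fin n)} {φ v m : EuclideanSpace ℝ (Fin n) → ℝ}

/-- The function `φ` rescaled by the power of `quad` that turns the kernel elements into
polynomials. -/
noncomputable def rescale (δ : ℝ) (ξ : EuclideanSpace ℝ (Fin n))
    (φ : EuclideanSpace ℝ (Fin n) → ℝ) (x : EuclideanSpace ℝ (Fin n)) : ℝ :=
  quad δ ξ x ^ ((n : ℝ) / 2) * φ x

lemma smooth_rescale (hδ : 0 < δ) (hφ : Smooth φ) : Smooth (rescale δ ξ φ) :=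
  (smooth_rpow smooth_quad (quad_pos hδ) _).mul hφ

lemma quad_mul_pd_rpow_quad (hδ : 0 < δ) (p : ℝ) (i : Fin n) (x : EuclideanSpace ℝ (Fin n)) :
    quad δ ξ x * pd i (fun x => quad δ ξ x ^ p) x
      = 2 * p * (x i - ξ i) * quad δ ξ x ^ p := by
  have hq := quad_pos (ξ := ξ) hδ x
  rw [pd_rpow smooth_quad (quad_pos hδ), pd_quad, Real.rpow_sub_one hq.ne']
  field_simp

lemma quad_mul_pd_rescale (hδ : 0 < δ) (hφ : Smooth φ) (i : Fin n)
    (x : EuclideanSpace ℝ (Fin n)) :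
    quad δ ξ x * pd i (rescale δ ξ φ) x
      = quad δ ξ x ^ ((n : ℝ) / 2) * (quad δ ξ x * pd i φ x)
        + n * ((x i - ξ i) * rescale δ ξ φ x) := by
  have h := quad_mul_pd_rpow_quad (ξ := ξ) hδ ((n : ℝ) / 2) i x
  unfold rescale
  rw [pd_mul (smooth_rpow smooth_quad (quad_pos hδ) _).differentiable hφ.differentiable]
  linear_combination φ x * h

lemma quad_mul_lap_rescale (hδ : 0 < δ) (hφ : Smooth φ)
    (hlap : ∀ x, quad δ ξ x ^ 2 * ∑ i, pd i (pd i φ) x = -(n * (n + 2) * δ ^ 2) * φ x)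
    (x : EuclideanSpace ℝ (Fin n)) :
    quad δ ξ x * ∑ i, pd i (pd i (rescale δ ξ φ)) x
      = 2 * n * (∑ i, (x i - ξ i) * pd i (rescale δ ξ φ) x - rescale δ ξ φ x) := by
  set v := rescale δ ξ φ with hv'
  have hv : Smooth v := smooth_rescale hδ hφ
  have hq := quad_pos (ξ := ξ) hδ x
  have hP : Smooth fun x => quad δ ξ x ^ ((n : ℝ) / 2) :=
    smooth_rpow smooth_quad (quad_pos hδ) _
  have h : ∀ i, quad δ ξ x * pd i (pd i v) x + 2 * ((x i - ξ i) * pd i v x)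
      = quad δ ξ x ^ ((n : ℝ) / 2) * (quad δ ξ x * pd i (pd i φ) x)
        + (n + 2) * (quad δ ξ x ^ ((n : ℝ) / 2) * ((x i - ξ i) * pd i φ x))
        + n * ((x i - ξ i) * pd i v x) + n * v x := by
    intro i
    have h1 : pd i (fun x => quad δ ξ x * pd i v x) x
        = pd i (fun x => quad δ ξ x ^ ((n : ℝ) / 2) * (quad δ ξ x * pd i φ x)
          + n * ((x i - ξ i) * v x)) x := by
      rw [funext (quad_mul_pd_rescale hδ hφ i)]
    rw [pd_mul smooth_quad.differentiable (hv.pd i).differentiable, pd_quad,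
      pd_add (hP.mul (smooth_quad.mul (hφ.pd i))) (contDiff_const.mul ((smooth_coord i).mul hv)),
      pd_mul hP.differentiable ((smooth_quad.mul (hφ.pd i)).differentiable (by simp)),
      pd_mul smooth_quad.differentiable (hφ.pd i).differentiable, pd_quad,
      pd_const_mul ((smooth_coord i).mul hv),
      pd_mul (smooth_coord i).differentiable hv.differentiable, pd_coord, if_pos rfl] at h1
    linear_combination h1 + pd i φ x * quad_mul_pd_rpow_quad (ξ := ξ) hδ ((n : ℝ) / 2) i x
  have h2 := Finset.sum_congr (rfl : (Finset.univ : Finset (Fin n)) = Finset.univ)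
    fun i _ => h i
  have h3 := Finset.sum_congr (rfl : (Finset.univ : Finset (Fin n)) = Finset.univ)
    fun i _ => congrArg (fun t => (x i - ξ i) * t) (quad_mul_pd_rescale (ξ := ξ) hδ hφ i x)
  have h3' : quad δ ξ x * ∑ i, (x i - ξ i) * pd i v x
      = quad δ ξ x * (quad δ ξ x ^ ((n : ℝ) / 2) * ∑ i, (x i - ξ i) * pd i φ x)
        + n * v x * ∑ i, (x i - ξ i) ^ 2 := by
    simp only [Finset.mul_sum]
    rw [← Finset.sum_add_distrib]
    refine Eq.trans (Finset.sum_congr rfl fun i _ => ?_)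
      (h3.trans (Finset.sum_congr rfl fun i _ => ?_))
    · ring
    · ring
  simp only [Finset.sum_add_distrib, ← Finset.mul_sum] at h2
  simp only [Finset.sum_const, Finset.card_univ, Fintype.card_fin, nsmul_eq_mul] at h2
  have hqs := quad_eq_sum (δ := δ) (ξ := ξ) x
  have hvx : v x = quad δ ξ x ^ ((n : ℝ) / 2) * φ x := rfl
  refine mul_left_cancel₀ hq.ne' ?_
  linear_combination quad δ ξ x * h2 + quad δ ξ x ^ ((n : ℝ) / 2) * hlap x - (n + 2) * h3'
    + (n * (n + 2) * v x) * hqs + (n * (n + 2) * δ ^ 2) * hvx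

lemma disc_rescale_le (hn : 3 ≤ n) (hδ : 0 < δ) (hφ : Smooth φ)
    (heq : ∀ x, quad δ ξ x * m x
      = 2 * (∑ i, (x i - ξ i) * pd i (rescale δ ξ φ) x - rescale δ ξ φ x))
    (x : EuclideanSpace ℝ (Fin n)) :
    disc (rescale δ ξ φ) m x ≤ (2 * (n - 2) ^ 2 + 4) *
      (quad δ ξ x ^ n * (‖fderiv ℝ φ x‖ ^ 2 + φ x ^ 2 / quad δ ξ x)) := by
  have hq := quad_pos (ξ := ξ) hδ x
  have hQ := sum_sq_sub_add_eq_disc heq x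
  set v := rescale δ ξ φ with hv
  set P := quad δ ξ x ^ ((n : ℝ) / 2) with hP
  have hP2 : P ^ 2 = quad δ ξ x ^ n := by
    rw [hP, ← Real.rpow_natCast, ← Real.rpow_mul hq.le, ← Real.rpow_natCast]
    congr 1; push_cast; ring
  have hvx : v x = P * φ x := rfl
  have h1 : ∀ i, (quad δ ξ x * pd i v x - 2 * v x * (x i - ξ i)) ^ 2
      ≤ P ^ 2 * (2 * quad δ ξ x ^ 2 * pd i φ x ^ 2
        + 2 * (n - 2) ^ 2 * φ x ^ 2 * (x i - ξ i) ^ 2) := by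
    intro i
    rw [quad_mul_pd_rescale hδ hφ, ← hv, ← hP, hvx]
    have : 0 ≤ P ^ 2 * (quad δ ξ x * pd i φ x - (n - 2) * φ x * (x i - ξ i)) ^ 2 := by positivity
    nlinarith
  have h2 := Finset.sum_le_sum (s := Finset.univ) fun i _ => h1 i
  rw [← Finset.mul_sum, Finset.sum_add_distrib, ← Finset.mul_sum, ← Finset.mul_sum] at h2
  have hqs := quad_eq_sum (δ := δ) (ξ := ξ) x
  have hr : ∑ i, (x i - ξ i) ^ 2 ≤ quad δ ξ x := by nlinarith [sq_nonneg δ]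
  have hd : δ ^ 2 ≤ quad δ ξ x := by
    have : 0 ≤ ∑ i, (x i - ξ i) ^ 2 := by positivity
    linarith
  have hG := sum_sq_pd_le (f := φ) x
  have h3 : quad δ ξ x ^ 2 * disc v m x ≤ quad δ ξ x ^ 2 * ((2 * (n - 2) ^ 2 + 4) *
      (quad δ ξ x ^ n * (‖fderiv ℝ φ x‖ ^ 2 + φ x ^ 2 / quad δ ξ x))) := by
    have hn' : (3 : ℝ) ≤ n := by exact_mod_cast hn
    have e1 : quad δ ξ x ^ 2 * ((2 * (n - 2) ^ 2 + 4) *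
        (quad δ ξ x ^ n * (‖fderiv ℝ φ x‖ ^ 2 + φ x ^ 2 / quad δ ξ x)))
        = P ^ 2 * ((2 * (n - 2) ^ 2 + 4) * (quad δ ξ x ^ 2 * ‖fderiv ℝ φ x‖ ^ 2)
          + (2 * (n - 2) ^ 2 + 4) * (φ x ^ 2 * quad δ ξ x)) := by
      rw [hP2]; field_simp
    rw [e1, ← hQ]
    calc _ ≤ P ^ 2 * (2 * quad δ ξ x ^ 2 * ∑ i, pd i φ x ^ 2 +
            2 * (n - 2) ^ 2 * φ x ^ 2 * ∑ i, (x i - ξ i) ^ 2) + 4 * δ ^ 2 * v x ^ 2 := by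
            linarith
      _ = P ^ 2 * (2 * (quad δ ξ x ^ 2 * ∑ i, pd i φ x ^ 2) +
            (2 * (n - 2) ^ 2 * (φ x ^ 2 * ∑ i, (x i - ξ i) ^ 2) + 4 * (φ x ^ 2 * δ ^ 2))) := by
            rw [hvx]; ring
      _ ≤ _ := by
            have a1 : quad δ ξ x ^ 2 * ∑ i, pd i φ x ^ 2
                ≤ quad δ ξ x ^ 2 * ‖fderiv ℝ φ x‖ ^ 2 := by gcongr
            have a2 : φ x ^ 2 * ∑ i, (x i - ξ i) ^ 2 ≤ φ x ^ 2 * quad δ ξ x := by gcongr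
            have a3 : φ x ^ 2 * δ ^ 2 ≤ φ x ^ 2 * quad δ ξ x := by gcongr
            have a4 : 0 ≤ quad δ ξ x ^ 2 * ‖fderiv ℝ φ x‖ ^ 2 := by positivity
            refine mul_le_mul_of_nonneg_left (add_le_add ?_ ?_) (sq_nonneg _)
            · nlinarith [mul_nonneg (sq_nonneg ((n : ℝ) - 2)) a4]
            · nlinarith [mul_le_mul_of_nonneg_left a2 (sq_nonneg ((n : ℝ) - 2))]
  exact le_of_mul_le_mul_left h3 (by positivity)

lemma exists_eq_const_of_pd_eq_zero {f : EuclideanSpace ℝ (Fin n) → ℝ} (hf : Smooth f)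
    (h : ∀ i x, pd i f x = 0) : ∃ c, ∀ x, f x = c := by
  refine ⟨f 0, fun x => is_const_of_fderiv_eq_zero (𝕜 := ℝ) hf.differentiable (fun y => ?_) x 0⟩
  ext w
  simp [fderiv_apply_eq_sum_pd, h]

lemma eq_quadratic_of_tfHessSq_eq_zero (hδ : 0 < δ) (hv : Smooth v) (hm : Smooth m)
    (heq : ∀ x, quad δ ξ x * m x = 2 * (∑ i, (x i - ξ i) * pd i v x - v x))
    (hT : ∀ x, tfHessSq v m x = 0) :
    ∃ (b : Fin n → ℝ) (μ : ℝ), ∀ x, v x = ∑ i, b i * (x i - ξ i)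
      + μ / 2 * (∑ i, (x i - ξ i) ^ 2 - δ ^ 2) := by
  have hT' : ∀ i j x, tfHess v m i j x = 0 := by
    intro i j x
    have h1 := (Finset.sum_eq_zero_iff_of_nonneg fun i _ => by positivity).1 (hT x) i
      (Finset.mem_univ i)
    exact pow_eq_zero_iff two_ne_zero |>.1 <|
      (Finset.sum_eq_zero_iff_of_nonneg fun j _ => by positivity).1 h1 j (Finset.mem_univ j)
  obtain ⟨μ, hμ⟩ := exists_eq_const_of_pd_eq_zero hm fun j x => by
    have h := quad_mul_pd_factor_eq_sum hv hm heq j x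
    simp only [hT', zero_mul, Finset.sum_const_zero, mul_zero] at h
    exact (mul_eq_zero.1 h).resolve_left (quad_pos hδ x).ne'
  have hb : ∀ i, ∃ b, ∀ x, pd i v x - μ * (x i - ξ i) = b := fun i =>
    exists_eq_const_of_pd_eq_zero ((hv.pd i).sub (contDiff_const.mul (smooth_coord i)))
      fun j x => by
        rw [pd_sub (hv.pd i) (contDiff_const.mul (smooth_coord i)), pd_const_mul (smooth_coord i),
          pd_coord]
        have h := hT' i j x
        rw [tfHess, hμ] at h
        simpa using h
  choose b hb using hb
  refine ⟨b, μ, fun x => ?_⟩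
  have h := heq x
  have hs : ∑ i, (x i - ξ i) * pd i v x
      = ∑ i, b i * (x i - ξ i) + μ * ∑ i, (x i - ξ i) ^ 2 := by
    rw [Finset.mul_sum, ← Finset.sum_add_distrib]
    refine Finset.sum_congr rfl fun i _ => ?_
    rw [← hb i x]; ring
  rw [hμ, hs, quad_eq_sum] at h
  linear_combination h / 2

lemma rescale_eq_quadratic (hn : 3 ≤ n) (hδ : 0 < δ) (hφ : Smooth φ)
    (hdecay : Tendsto φ (cocompact _) (𝓝 0)) (hint : Integrable fun x => ‖fderiv ℝ φ x‖ ^ 2)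
    (hlap : ∀ x, quad δ ξ x ^ 2 * ∑ i, pd i (pd i φ) x = -(n * (n + 2) * δ ^ 2) * φ x) :
    ∃ (b : Fin n → ℝ) (μ : ℝ), ∀ x, rescale δ ξ φ x = ∑ i, b i * (x i - ξ i)
      + μ / 2 * (∑ i, (x i - ξ i) ^ 2 - δ ^ 2) := by
  have hn0 : (n : ℝ) ≠ 0 := by
    have : n ≠ 0 := by omega
    exact_mod_cast this
  have hv : Smooth (rescale δ ξ φ) := smooth_rescale hδ hφ
  set m : EuclideanSpace ℝ (Fin n) → ℝ :=
    fun x => (n : ℝ)⁻¹ * ∑ i, pd i (pd i (rescale δ ξ φ)) x with hm'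
  have hm : Smooth m := contDiff_const.mul (ContDiff.sum fun i _ => (hv.pd i).pd i)
  have htr : ∀ x, ∑ i, pd i (pd i (rescale δ ξ φ)) x = n * m x := fun x => by
    simp only [hm']; field_simp
  have heq : ∀ x, quad δ ξ x * m x
      = 2 * (∑ i, (x i - ξ i) * pd i (rescale δ ξ φ) x - rescale δ ξ φ x) := fun x => by
    have h := quad_mul_lap_rescale hδ hφ hlap x
    rw [htr] at h
    refine mul_left_cancel₀ hn0 ?_
    linear_combination h
  refine eq_quadratic_of_tfHessSq_eq_zero hδ hv hm heq fun x =>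
    tfHessSq_eq_zero hn hδ hv hm htr heq (C := 2 * ((n : ℝ) - 2) ^ 2 + 4) (by positivity)
      (fun x => ?_) (hint.add (integrable_sq_div_quad (ξ := ξ) hn hδ hφ hdecay hint))
      (disc_rescale_le hn hδ hφ heq) x
  have := quad_pos (ξ := ξ) hδ x
  simp only [Pi.add_apply]
  positivity

end Classification

section Bubble

variable {n : ℕ} {δ : ℝ} {ξ : EuclideanSpace ℝ (Fin n)}

lemma bubble_rpow (hn : 3 ≤ n) {t : ℝ} (ht : 0 < t) :
    (((n : ℝ) * ((n : ℝ) - 2)) ^ (((n : ℝ) - 2) / 4) * t ^ (((n : ℝ) - 2) / 2))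
      ^ (4 / ((n : ℝ) - 2)) = n * (n - 2) * t ^ 2 := by
  have hn' : (3 : ℝ) ≤ n := by exact_mod_cast hn
  have hn2 : (0 : ℝ) < n - 2 := by linarith
  have hc : (0 : ℝ) ≤ n * (n - 2) := by positivity
  rw [Real.mul_rpow (by positivity) (by positivity), ← Real.rpow_mul hc, ← Real.rpow_mul ht.le]
  have e1 : ((n : ℝ) - 2) / 4 * (4 / (n - 2)) = 1 := by field_simp
  have e2 : ((n : ℝ) - 2) / 2 * (4 / (n - 2)) = 2 := by field_simp; norm_num
  rw [e1, e2, Real.rpow_one, Real.rpow_two]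

lemma pd_mul_rpow_quad (hδ : 0 < δ) (K : ℝ) (j : Fin n) (x : EuclideanSpace ℝ (Fin n)) :
    pd j (fun x => K * quad δ ξ x ^ (-(((n : ℝ) - 2) / 2))) x
      = -(n - 2) * K * (x j - ξ j) * (quad δ ξ x ^ ((n : ℝ) / 2))⁻¹ := by
  have hq := quad_pos (ξ := ξ) hδ x
  rw [pd_const_mul (smooth_rpow smooth_quad (quad_pos hδ) _), pd_rpow smooth_quad (quad_pos hδ),
    pd_quad, ← Real.rpow_neg hq.le]
  have e : -(((n : ℝ) - 2) / 2) - 1 = -((n : ℝ) / 2) := by ring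
  rw [e]
  ring

end Bubble

theorem yamabe_nondegeneracy (n : ℕ) (hn : 3 ≤ n)
    (δ : ℝ) (hδ : 0 < δ) (ξ : EuclideanSpace ℝ (Fin n))
    (u : EuclideanSpace ℝ (Fin n) → ℝ)
    (hu : ∀ x, u x = ((n : ℝ) * ((n : ℝ) - 2)) ^ (((n : ℝ) - 2) / 4) *
      (δ / (δ ^ 2 + ‖x - ξ‖ ^ 2)) ^ (((n : ℝ) - 2) / 2))
    (φ : EuclideanSpace ℝ (Fin n) → ℝ)
    (hφ : ContDiff ℝ (⊤ : ℕ∞) φ)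
    (hdecay : Tendsto φ (cocompact _) (nhds 0))
    (hint : Integrable (fun x => ‖fderiv ℝ φ x‖ ^ 2))
    (heq : ∀ x, -lap φ x = (((n : ℝ) + 2) / ((n : ℝ) - 2)) *
      u x ^ (4 / ((n : ℝ) - 2)) * φ x) :
    ∃ (c : Fin n → ℝ) (c₀ : ℝ),
      ∀ x, φ x = (∑ j, c j * fderiv ℝ u x (EuclideanSpace.single j 1)) +
        c₀ * (fderiv ℝ u x x + (((n : ℝ) - 2) / 2) * u x) := by
  have hn' : (3 : ℝ) ≤ n := by exact_mod_cast hn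
  have hn2 : (0 : ℝ) < n - 2 := by linarith
  have hq := quad_pos (n := n) (ξ := ξ) hδ
  have hlap : ∀ x, quad δ ξ x ^ 2 * ∑ i, pd i (pd i φ) x = -(n * (n + 2) * δ ^ 2) * φ x := by
    intro x
    have h := heq x
    have hqx := hq x
    rw [hu, ← quad, bubble_rpow hn (div_pos hδ hqx), lap_eq_sum_pd hφ] at h
    have h2 := hn2.ne'
    field_simp at h
    linear_combination -h
  obtain ⟨b, μ, hv⟩ := rescale_eq_quadratic hn hδ hφ hdecay hint hlap
  set K : ℝ := ((n : ℝ) * (n - 2)) ^ (((n : ℝ) - 2) / 4) * δ ^ (((n : ℝ) - 2) / 2) with hK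
  have hK0 : 0 < K := by positivity
  have hu' : u = fun x => K * quad δ ξ x ^ (-(((n : ℝ) - 2) / 2)) := by
    funext x
    rw [hu, hK, ← quad, Real.div_rpow hδ.le (hq x).le, Real.rpow_neg (hq x).le]
    ring
  have hpd : ∀ j x, pd j u x
      = -(n - 2) * K * (x j - ξ j) * (quad δ ξ x ^ ((n : ℝ) / 2))⁻¹ := by
    rw [hu']
    exact pd_mul_rpow_quad hδ K
  refine ⟨fun j => -(b j / ((n - 2) * K)) + μ / ((n - 2) * K) * ξ j, -(μ / ((n - 2) * K)),
    fun x => ?_⟩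
  have hqx := hq x
  have hP : 0 < quad δ ξ x ^ ((n : ℝ) / 2) := by positivity
  have hux : u x = K * (quad δ ξ x * (quad δ ξ x ^ ((n : ℝ) / 2))⁻¹) := by
    rw [hu', ← Real.rpow_neg hqx.le]
    simp only
    rw [← Real.rpow_one_add' hqx.le (by linarith)]
    congr 2; ring
  have hsum : ∑ j, (-(b j / ((n - 2) * K)) + μ / ((n - 2) * K) * ξ j) * pd j u x
      + -(μ / ((n - 2) * K)) * ∑ j, x j * pd j u x
      = (quad δ ξ x ^ ((n : ℝ) / 2))⁻¹ * (∑ i, b i * (x i - ξ i)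
        + μ * ∑ i, (x i - ξ i) ^ 2) := by
    simp only [Finset.mul_sum, ← Finset.sum_add_distrib]
    refine Finset.sum_congr rfl fun j _ => ?_
    rw [hpd]
    field_simp
    ring
  have hφx : φ x = (quad δ ξ x ^ ((n : ℝ) / 2))⁻¹ * rescale δ ξ φ x := by
    unfold rescale
    field_simp
  change φ x = ∑ j, (-(b j / ((n - 2) * K)) + μ / ((n - 2) * K) * ξ j) * pd j u x + _
  rw [fderiv_apply_eq_sum_pd, mul_add, ← add_assoc, hsum, hφx, hv, hux, quad_eq_sum]
  field_simp
  ring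
end
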